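/- Let A = kQ_A/I_A with Q_A the linear quiver 1 →^{α_1} 2 →^{α_2} ⋯ → m →^{α_m} m+1 possibly extended by quivers Q_{A'} attached at vertex 1 and Q_{A''} attached at vertex m+1 (both of arbitrary representation-finite hereditary type), and I_A = ⟨α_m⋯α_1⟩ with m ≥ 2. Let A_1 be the hereditary algebra obtained by deleting α_1 (containing α_m), A_2 the hereditary algebra obtained by deleting α_m (containing α_1), and A_1 ∩ A_2 the common hereditary subalgebra. Then r_A = r_{A_1} + r_{A_2} − r_{A_1∩A_2}. -/

import Mathlib

open CategoryTheory
open scoped Classical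

/-! ## Quiver combinatorics -/

/-- Paths in a quiver given by source and target maps. -/
inductive QPath {V E : Type} (src tgt : E → V) : V → V → Type
  | nil (a : V) : QPath src tgt a a
  | cons {a b : V} (p : QPath src tgt a b) (α : E) (h : src α = b) : QPath src tgt a (tgt α)

namespace QPath

variable {V E : Type} {src tgt : E → V}

def length : ∀ {a b : V}, QPath src tgt a b → ℕ
  | _, _, .nil _ => 0
  | _, _, .cons p _ _ => p.length + 1

def comp : ∀ {a b c : V}, QPath src tgt a b → QPath src tgt b c → QPath src tgt a c
  | _, _, _, p, .nil _ => p
  | _, _, _, p, .cons q α h => .cons (p.comp q) α h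

/-- The list of vertices visited by a path, in order. -/
def verts : ∀ {a b : V}, QPath src tgt a b → List V
  | a, _, .nil _ => [a]
  | _, _, .cons p α _ => p.verts ++ [tgt α]

/-- The interior (intermediate) vertices of a path. -/
def interior {a b : V} (p : QPath src tgt a b) : List V :=
  (p.verts.dropLast).drop 1

/-- The list of arrows of a path, in walk order. -/
def arrows : ∀ {a b : V}, QPath src tgt a b → List E
  | _, _, .nil _ => []
  | _, _, .cons p α _ => p.arrows ++ [α]

end QPath

/-- A presentation of the algebra `A` by the (ordinary) quiver with vertex set `V`
and arrow set `E` : a complete family of orthogonal primitive idempotents indexed by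
the vertices together with generators indexed by the arrows. -/
structure QuiverPresentation (k A V E : Type) [Field k] [Ring A] [Algebra k A]
    [Fintype V] [Fintype E] where
  src : E → V
  tgt : E → V
  idem : V → A
  arrow : E → A
  idem_idem : ∀ a : V, idem a * idem a = idem a
  idem_orth : ∀ a b : V, a ≠ b → idem a * idem b = 0
  sum_idem : ∑ a : V, idem a = 1
  idem_ne : ∀ a : V, idem a ≠ 0
  idem_primitive : ∀ (v : V) (f g : A), f * f = f → g * g = g → f * g = 0 → g * f = 0 →
    f + g = idem v → f = 0 ∨ g = 0
  arrow_mem : ∀ α : E, idem (tgt α) * arrow α * idem (src α) = arrow α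
  arrow_ne : ∀ α : E, arrow α ≠ 0
  generates : Algebra.adjoin k (Set.range idem ∪ Set.range arrow) = ⊤

namespace QuiverPresentation

variable {k A V E : Type} [Field k] [Ring A] [Algebra k A] [Fintype V] [Fintype E]

/-- The product in `A` of the arrows along a path (paths are written right to left). -/
def qprod (P : QuiverPresentation k A V E) :
    ∀ {a b : V}, QPath P.src P.tgt a b → A
  | _, _, .nil a => P.idem a
  | _, _, .cons p α _ => P.arrow α * P.qprod p

/-- The ideal of relations is admissible: all sufficiently long paths vanish. -/
def Admissible (P : QuiverPresentation k A V E) : Prop :=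
  ∃ N : ℕ, ∀ (a b : V) (p : QPath P.src P.tgt a b), N ≤ p.length → P.qprod p = 0

/-- The presentation is minimal: the idempotents and the arrows are linearly
independent modulo the span of the products of paths of length at least two,
so that `(V, E)` really is the ordinary quiver of `A`. -/
def Minimal (P : QuiverPresentation k A V E) : Prop :=
  ∀ (c : V → k) (d : E → k),
    ((∑ a : V, c a • P.idem a) + ∑ α : E, d α • P.arrow α) ∈
      Submodule.span k {x : A | ∃ (a b : V) (p : QPath P.src P.tgt a b),
        2 ≤ p.length ∧ P.qprod p = x} →
    (∀ a, c a = 0) ∧ (∀ α, d α = 0)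

/-- The algebra is monomial: the ideal of relations is generated by paths; equivalently,
the images of the paths which do not vanish are linearly independent. -/
def Monomial (P : QuiverPresentation k A V E) : Prop :=
  LinearIndependent k
    (fun q : {q : Σ a : V, Σ b : V, QPath P.src P.tgt a b // P.qprod q.2.2 ≠ 0} =>
      P.qprod q.1.2.2)

/-- A (minimal) zero-relation: a path of length at least two whose product vanishes
while the product along every proper subpath does not. -/
def IsZeroRel (P : QuiverPresentation k A V E) {a b : V} (p : QPath P.src P.tgt a b) : Prop :=
  P.qprod p = 0 ∧ 2 ≤ p.length ∧
  ∀ (x y : V) (q : QPath P.src P.tgt x y) (p₁ : QPath P.src P.tgt a x)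
    (p₂ : QPath P.src P.tgt y b),
      p = p₁.comp (q.comp p₂) → q.length < p.length → P.qprod q ≠ 0

/-- A vertex `u` is involved in a zero-relation `α_m ⋯ α_1` if `u = s(α_i)`
for some `i = 2, …, m`, i.e. `u` is an interior vertex of the relation. -/
def InvolvedInZeroRel (P : QuiverPresentation k A V E) (u : V) : Prop :=
  ∃ (a b : V) (p : QPath P.src P.tgt a b), P.IsZeroRel p ∧ u ∈ p.interior

/-! ### Walks (for strings and for connectivity) -/

/-- The starting vertex of a step (an arrow traversed forwards or backwards). -/
def stepSrc (P : QuiverPresentation k A V E) (s : E × Bool) : V :=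
  if s.2 then P.src s.1 else P.tgt s.1

/-- The ending vertex of a step. -/
def stepTgt (P : QuiverPresentation k A V E) (s : E × Bool) : V :=
  if s.2 then P.tgt s.1 else P.src s.1

/-- `l` is a walk from `a` to `b` in the underlying graph of the quiver. -/
def IsWalkFrom (P : QuiverPresentation k A V E) : V → List (E × Bool) → V → Prop
  | a, [], b => a = b
  | a, s :: l, b => P.stepSrc s = a ∧ P.IsWalkFrom (P.stepTgt s) l b

/-- The product in `A` of a list of arrows (listed in walk order). -/
def wprod (P : QuiverPresentation k A V E) (l : List E) : A :=
  ((l.map P.arrow).reverse).prod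

/-- A reduced walk: no step is immediately followed by its inverse. -/
def Reduced (l : List (E × Bool)) : Prop :=
  ¬ ∃ (l₁ : List (E × Bool)) (s : E × Bool) (l₂ : List (E × Bool)),
      l = l₁ ++ s :: (s.1, !s.2) :: l₂

/-- No direct subwalk of `l` nor the inverse of such lies in the ideal of relations. -/
def NoZeroSub (P : QuiverPresentation k A V E) (l : List (E × Bool)) : Prop :=
  ∀ (l₁ : List (E × Bool)) (r : List E) (l₂ : List (E × Bool)),
    (l = l₁ ++ (r.map (fun e => (e, true))) ++ l₂ → P.wprod r ≠ 0) ∧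
    (l = l₁ ++ (r.map (fun e => (e, false))) ++ l₂ → P.wprod r.reverse ≠ 0)

/-- A string from `a` to `b`. -/
def IsStringWalk (P : QuiverPresentation k A V E) (a : V) (l : List (E × Bool)) (b : V) : Prop :=
  P.IsWalkFrom a l b ∧ Reduced l ∧ P.NoZeroSub l

/-- `(Q_u^s)_0` : the strings starting at `u` that are trivial or start with an arrow. -/
def QSset (P : QuiverPresentation k A V E) (u : V) : Set (List (E × Bool)) :=
  {l | ∃ b : V, P.IsStringWalk u l b ∧ (l = [] ∨ ∃ (α : E) (l' : List (E × Bool)),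
    l = (α, true) :: l')}

/-- `(Q_u^e)_0` : the strings ending at `u` that are trivial or end with an arrow. -/
def QEset (P : QuiverPresentation k A V E) (u : V) : Set (List (E × Bool)) :=
  {l | ∃ a : V, P.IsStringWalk a l u ∧ (l = [] ∨ ∃ (α : E) (l' : List (E × Bool)),
    l = l' ++ [(α, true)])}

/-- `S_γ` : the strings starting with the arrow `γ`. -/
def Sarr (P : QuiverPresentation k A V E) (γ : E) : Set (List (E × Bool)) :=
  {l | ∃ b : V, P.IsStringWalk (P.src γ) l b ∧ ∃ l' : List (E × Bool), l = (γ, true) :: l'}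

/-- `E_γ` : the strings ending with the arrow `γ`. -/
def Earr (P : QuiverPresentation k A V E) (γ : E) : Set (List (E × Bool)) :=
  {l | ∃ a : V, P.IsStringWalk a l (P.tgt γ) ∧ ∃ l' : List (E × Bool), l = l' ++ [(γ, true)]}

/-- The defining conditions of a string algebra. -/
def IsStringAlgebra (P : QuiverPresentation k A V E) : Prop :=
  P.Monomial ∧
  (∀ v : V, Nat.card {α : E // P.src α = v} ≤ 2) ∧
  (∀ v : V, Nat.card {α : E // P.tgt α = v} ≤ 2) ∧
  (∀ γ : E, Nat.card {β : E // P.src β = P.tgt γ ∧ P.arrow β * P.arrow γ ≠ 0} ≤ 1) ∧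
  (∀ β : E, Nat.card {γ : E // P.src β = P.tgt γ ∧ P.arrow β * P.arrow γ ≠ 0} ≤ 1)

/-- Connectivity in the underlying graph, avoiding a given set of arrows. -/
def ConnAvoid (P : QuiverPresentation k A V E) (avoid : Set E) (a b : V) : Prop :=
  ∃ l : List (E × Bool), P.IsWalkFrom a l b ∧ ∀ s ∈ l, s.1 ∉ avoid

def Connected (P : QuiverPresentation k A V E) : Prop := ∀ a b : V, P.ConnAvoid ∅ a b

/-- The underlying graph of the quiver is a tree. -/
def IsTreeQuiver (P : QuiverPresentation k A V E) : Prop :=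
  P.Connected ∧ Fintype.card E + 1 = Fintype.card V

/-- The underlying (undirected) graph of the quiver is given by the edge-endpoint
specification `ends` on `nV` vertices and `nE` edges. -/
def GraphSpec (P : QuiverPresentation k A V E) (nV nE : ℕ) (ends : Fin nE → ℕ × ℕ) : Prop :=
  ∃ (v : Fin nV ≃ V) (ar : Fin nE ≃ E), ∀ i : Fin nE, ∃ a b : Fin nV,
    (a : ℕ) = (ends i).1 ∧ (b : ℕ) = (ends i).2 ∧
    ((P.src (ar i) = v a ∧ P.tgt (ar i) = v b) ∨ (P.src (ar i) = v b ∧ P.tgt (ar i) = v a))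

/-- The directed quiver is given by the arrow specification `ends`. -/
def DirGraphSpec (P : QuiverPresentation k A V E) (nV nE : ℕ) (ends : Fin nE → ℕ × ℕ) : Prop :=
  ∃ (v : Fin nV ≃ V) (ar : Fin nE ≃ E), ∀ i : Fin nE, ∃ a b : Fin nV,
    (a : ℕ) = (ends i).1 ∧ (b : ℕ) = (ends i).2 ∧
    P.src (ar i) = v a ∧ P.tgt (ar i) = v b

/-- The underlying graph of the full subquiver on vertices `S` and arrows `T`. -/
def SubGraphSpec (P : QuiverPresentation k A V E) (S : Set V) (T : Set E)
    (nV nE : ℕ) (ends : Fin nE → ℕ × ℕ) : Prop :=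
  ∃ (v : Fin nV ≃ S) (ar : Fin nE ≃ T), ∀ i : Fin nE, ∃ a b : Fin nV,
    (a : ℕ) = (ends i).1 ∧ (b : ℕ) = (ends i).2 ∧
    ((P.src (ar i) = v a ∧ P.tgt (ar i) = v b) ∨ (P.src (ar i) = v b ∧ P.tgt (ar i) = v a))

end QuiverPresentation

/-- Edge endpoints of the Dynkin graph `A_n`. -/
def typeAEnds (n : ℕ) : Fin (n - 1) → ℕ × ℕ := fun i => ((i : ℕ), (i : ℕ) + 1)

/-- Edge endpoints of the Dynkin graph `D_n`. -/
def typeDEnds (n : ℕ) : Fin (n - 1) → ℕ × ℕ := fun i =>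
  if (i : ℕ) = 0 then (0, 2) else if (i : ℕ) = 1 then (1, 2) else ((i : ℕ), (i : ℕ) + 1)

/-- Edge endpoints of the Dynkin graph `E_m` for `m = 6, 7, 8`. -/
def typeEEnds (m : ℕ) : Fin (m - 1) → ℕ × ℕ := fun i =>
  if (i : ℕ) = m - 2 then (2, m - 1) else ((i : ℕ), (i : ℕ) + 1)

/-! ## The module category, its radical and the nilpotency index -/

section ModuleSide

variable (A : Type) [Ring A]

/-- An indecomposable module: non-zero, with no non-trivial idempotent endomorphism. -/
def Indec (M : ModuleCat.{0} A) : Prop :=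
  Nontrivial M ∧ ∀ f : M ⟶ M, f ≫ f = f → f = 0 ∨ f = 𝟙 M

/-- A finitely generated indecomposable module. -/
def FinIndec (M : ModuleCat.{0} A) : Prop := Module.Finite A M ∧ Indec A M

/-- `A` is representation-finite: finitely many finitely generated indecomposables
up to isomorphism. -/
def RepFinite : Prop :=
  ∃ (n : ℕ) (T : Fin n → ModuleCat.{0} A),
    ∀ M : ModuleCat.{0} A, FinIndec A M → ∃ i, Nonempty (M ≅ T i)

/-- `A` is (left) hereditary. -/
def Hereditary : Prop := ∀ I : Submodule A A, Module.Projective A I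

/-- An irreducible morphism: it does not split, and in any factorization one of
the factors splits. -/
def IrredMor {X Y : ModuleCat.{0} A} (f : X ⟶ Y) : Prop :=
  (¬ ∃ g : Y ⟶ X, f ≫ g = 𝟙 X) ∧ (¬ ∃ g : Y ⟶ X, g ≫ f = 𝟙 Y) ∧
  ∀ (Z : ModuleCat.{0} A), Module.Finite A Z → ∀ (u : X ⟶ Z) (v : Z ⟶ Y), f = u ≫ v →
    (∃ r : Z ⟶ X, u ≫ r = 𝟙 X) ∨ (∃ s : Y ⟶ Z, s ≫ v = 𝟙 Y)

/-- The radical of `Hom(X, Y)`. -/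
def radSet (X Y : ModuleCat.{0} A) : Set (X ⟶ Y) :=
  {f | ∀ M : ModuleCat.{0} A, FinIndec A M →
    ∀ (h : M ⟶ X) (h' : Y ⟶ M), ¬ IsIso (h ≫ f ≫ h')}

/-- Compositions of `n` radical morphisms. -/
def radPowSet : ℕ → ∀ (X Y : ModuleCat.{0} A), Set (X ⟶ Y)
  | 0, _, _ => Set.univ
  | n + 1, X, Y => {f | ∃ (M : ModuleCat.{0} A) (g : X ⟶ M) (h : M ⟶ Y),
      Module.Finite A M ∧ g ∈ radSet A X M ∧ h ∈ radPowSet n M Y ∧ f = g ≫ h}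

/-- The `n`-th power of the radical of `mod A` vanishes. -/
def RadVanishes (n : ℕ) : Prop :=
  ∀ X Y : ModuleCat.{0} A, Module.Finite A X → Module.Finite A Y →
    ∀ f ∈ radPowSet A n X Y, f = 0

/-- `m` is the nilpotency index of the radical of `mod A`. -/
def NilpotencyIndex (m : ℕ) : Prop :=
  1 ≤ m ∧ RadVanishes A m ∧ ∀ l : ℕ, RadVanishes A l → m ≤ l

/-- A path of irreducible morphisms between (f.g.) indecomposable modules,
together with its composite morphism and its length. -/
inductive IrrPath : ∀ (M N : ModuleCat.{0} A), (M ⟶ N) → ℕ → Prop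
  | nil (M : ModuleCat.{0} A) : FinIndec A M → IrrPath M M (𝟙 M) 0
  | cons {M X N : ModuleCat.{0} A} (f : M ⟶ X) (g : X ⟶ N) (n : ℕ) :
      FinIndec A M → IrredMor A f → IrrPath X N g n → IrrPath M N (f ≫ g) (n + 1)

/-- The Auslander–Reiten quiver of `A` is a component with length : parallel paths
of irreducible morphisms have the same length. -/
def WithLength : Prop :=
  ∀ (M N : ModuleCat.{0} A) (n m : ℕ),
    (∃ f : M ⟶ N, IrrPath A M N f n) → (∃ g : M ⟶ N, IrrPath A M N g m) → n = m

/-- `N` is a successor of `M` (a path of non-zero morphisms between f.g.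
indecomposables from `M` to `N`). -/
inductive Reach : ModuleCat.{0} A → ModuleCat.{0} A → Prop
  | refl (M : ModuleCat.{0} A) : FinIndec A M → Reach M M
  | cons {M X N : ModuleCat.{0} A} : FinIndec A M → FinIndec A X →
      (∃ f : M ⟶ X, f ≠ 0) → Reach X N → Reach M N

/-- `N` is a direct summand of `M`. -/
def IsSummand (N M : ModuleCat.{0} A) : Prop :=
  ∃ (i : N ⟶ M) (p : M ⟶ N), i ≫ p = 𝟙 N

/-- The radical of a module (intersection of the maximal submodules). -/
def radOf (M : ModuleCat.{0} A) : Submodule A M := sInf {N | IsCoatom N}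

/-- The socle of a module (sum of the simple submodules). -/
def socOf (M : ModuleCat.{0} A) : Submodule A M := sSup {N | IsAtom N}

/-- `0 → X → E → Y → 0` is an almost split (Auslander–Reiten) sequence. -/
def IsAlmostSplit {X E Y : ModuleCat.{0} A} (f : X ⟶ E) (g : E ⟶ Y) : Prop :=
  FinIndec A X ∧ FinIndec A Y ∧ Module.Finite A E ∧
  Function.Injective f ∧ Function.Surjective g ∧
  (∀ x : X, g (f x) = 0) ∧ (∀ e : E, g e = 0 → ∃ x : X, f x = e) ∧
  (¬ ∃ s : Y ⟶ E, s ≫ g = 𝟙 Y) ∧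
  (∀ (M : ModuleCat.{0} A) (h : X ⟶ M), (¬ ∃ r : M ⟶ X, h ≫ r = 𝟙 X) →
    ∃ t : E ⟶ M, f ≫ t = h) ∧
  (∀ (M : ModuleCat.{0} A) (h : M ⟶ Y), (¬ ∃ s : Y ⟶ M, s ≫ h = 𝟙 Y) →
    ∃ t : M ⟶ E, t ≫ g = h)

/-- `X = τ Y` : there is an almost split sequence `0 → X → E → Y → 0`. -/
def IsTauOf (X Y : ModuleCat.{0} A) : Prop :=
  ∃ (E : ModuleCat.{0} A) (f : X ⟶ E) (g : E ⟶ Y), IsAlmostSplit A f g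

/-- A sectional path of irreducible morphisms of length `n` from `M` to `N`. -/
def SectionalPath (M N : ModuleCat.{0} A) (n : ℕ) : Prop :=
  ∃ Y : Fin (n + 1) → ModuleCat.{0} A,
    Y 0 = M ∧ Y (Fin.last n) = N ∧ (∀ i, FinIndec A (Y i)) ∧
    (∀ i : Fin n, ∃ f : Y i.castSucc ⟶ Y i.succ, IrredMor A f) ∧
    ∀ (i : ℕ) (h : i + 2 ≤ n),
      ¬ IsTauOf A (Y ⟨i, by omega⟩) (Y ⟨i + 2, by omega⟩)

end ModuleSide

/-! ## Modules attached to vertices -/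

section Vertices

variable {k A V E : Type} [Field k] [Ring A] [Algebra k A] [Fintype V] [Fintype E]

/-- `S` is the simple module at the vertex `a`. -/
def IsSimpleAt (P : QuiverPresentation k A V E) (a : V) (S : ModuleCat.{0} A) : Prop :=
  IsSimpleModule A S ∧ ∃ x : S, P.idem a • x ≠ 0

/-- `Pm` is the indecomposable projective at the vertex `a`. -/
def IsProjAt (P : QuiverPresentation k A V E) (a : V) (Pm : ModuleCat.{0} A) : Prop :=
  Module.Projective A Pm ∧ FinIndec A Pm ∧
  ∃ (S : ModuleCat.{0} A) (f : Pm ⟶ S), IsSimpleAt P a S ∧ Function.Surjective f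

/-- `Im` is the indecomposable injective at the vertex `a`. -/
def IsInjAt (P : QuiverPresentation k A V E) (a : V) (Im : ModuleCat.{0} A) : Prop :=
  Module.Injective A Im ∧ FinIndec A Im ∧
  ∃ (S : ModuleCat.{0} A) (f : S ⟶ Im), IsSimpleAt P a S ∧ Function.Injective f

/-- `RVal P a n` : `n` is the length of a non-zero path of irreducible morphisms
between indecomposable modules from `P_a` to `I_a` going through `S_a`. -/
def RVal (P : QuiverPresentation k A V E) (a : V) (n : ℕ) : Prop :=
  ∃ (Pm S Im : ModuleCat.{0} A) (f : Pm ⟶ S) (g : S ⟶ Im) (n₁ n₂ : ℕ),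
    IsProjAt P a Pm ∧ IsSimpleAt P a S ∧ IsInjAt P a Im ∧
    IrrPath A Pm S f n₁ ∧ IrrPath A S Im g n₂ ∧ f ≫ g ≠ 0 ∧ n = n₁ + n₂

end Vertices


/-- The vertices of the connected component of `root` in the underlying graph of the
quiver with the arrow `avoid` removed. -/
def compSet {k A V E : Type} [Field k] [Ring A] [Algebra k A] [Fintype V] [Fintype E]
    (P : QuiverPresentation k A V E) (avoid : E) (root : V) : Set V :=
  {v | P.ConnAvoid {e | e = avoid} v root}

/-- The arrows of the connected component of `root` in the underlying graph of the
quiver with the arrow `avoid` removed. -/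
def compArr {k A V E : Type} [Field k] [Ring A] [Algebra k A] [Fintype V] [Fintype E]
    (P : QuiverPresentation k A V E) (avoid : E) (root : V) : Set E :=
  {β | β ≠ avoid ∧ P.src β ∈ compSet P avoid root ∧ P.tgt β ∈ compSet P avoid root}

/-! ## The radical of the module category -/

section Radical

variable {A : Type} [Ring A] {X Y Z W : ModuleCat.{0} A}

theorem Indec.id_ne_zero {M : ModuleCat.{0} A} (hM : Indec A M) : 𝟙 M ≠ 0 := by
  intro h
  obtain ⟨x, hx⟩ := @exists_ne M hM.1 0
  exact hx (by simpa using congrArg (fun f : M ⟶ M => f.hom x) h)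

theorem Indec.comp_eq_id {M : ModuleCat.{0} A} (hM : Indec A M) (hY : Indec A Y)
    (r : M ⟶ Y) (s : Y ⟶ M) (h : r ≫ s = 𝟙 M) : s ≫ r = 𝟙 Y := by
  rcases hY.2 (s ≫ r) (by rw [Category.assoc, reassoc_of% h]) with h0 | h1
  · exfalso
    apply hM.id_ne_zero
    calc 𝟙 M = r ≫ (s ≫ r) ≫ s := by rw [Category.assoc, h, Category.comp_id, h]
      _ = 0 := by rw [h0]; simp
  · exact h1

theorem radSet_comp_left (u : Z ⟶ X) {f : X ⟶ Y} (hf : f ∈ radSet A X Y) :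
    u ≫ f ∈ radSet A Z Y := fun M hM h h' hi =>
  hf M hM (h ≫ u) h' (by simpa using hi)

theorem radSet_comp_right {f : X ⟶ Y} (hf : f ∈ radSet A X Y) (u : Y ⟶ Z) :
    f ≫ u ∈ radSet A X Z := fun M hM h h' hi =>
  hf M hM h (u ≫ h') (by simpa using hi)

theorem mem_radSet_of_not_splitEpi (hY : Indec A Y) (f : X ⟶ Y)
    (hf : ¬ ∃ s : Y ⟶ X, s ≫ f = 𝟙 Y) : f ∈ radSet A X Y := by
  intro M hM h h' hi
  apply hf
  have e : (inv (h ≫ f ≫ h') ≫ h ≫ f) ≫ h' = 𝟙 M := by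
    have := IsIso.inv_hom_id (h ≫ f ≫ h')
    simpa only [Category.assoc] using this
  have e2 := hM.2.comp_eq_id hY _ _ e
  exact ⟨h' ≫ inv (h ≫ f ≫ h') ≫ h, by simpa only [Category.assoc] using e2⟩

theorem mem_radSet_of_not_splitMono (hX : Indec A X) (f : X ⟶ Y)
    (hf : ¬ ∃ s : Y ⟶ X, f ≫ s = 𝟙 X) : f ∈ radSet A X Y := by
  intro M hM h h' hi
  apply hf
  have e : h ≫ (f ≫ h' ≫ inv (h ≫ f ≫ h')) = 𝟙 M := by
    have := IsIso.hom_inv_id (h ≫ f ≫ h')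
    simpa only [Category.assoc] using this
  have e2 := hM.2.comp_eq_id hX _ _ e
  exact ⟨h' ≫ inv (h ≫ f ≫ h') ≫ h, by simpa only [Category.assoc] using e2⟩

theorem not_splitEpi_of_mem_radSet (hY : FinIndec A Y) {f : X ⟶ Y} (hf : f ∈ radSet A X Y)
    (s : Y ⟶ X) : s ≫ f ≠ 𝟙 Y := fun h =>
  hf Y hY s (𝟙 Y) (by rw [Category.comp_id, h]; infer_instance)

theorem not_splitMono_of_mem_radSet (hX : FinIndec A X) {f : X ⟶ Y} (hf : f ∈ radSet A X Y)
    (s : Y ⟶ X) : f ≫ s ≠ 𝟙 X := fun h =>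
  hf X hX (𝟙 X) s (by rw [Category.id_comp, h]; infer_instance)

theorem mem_radSet_of_not_isIso (hX : Indec A X) (hY : Indec A Y) (f : X ⟶ Y)
    (hf : ¬ IsIso f) : f ∈ radSet A X Y := by
  refine mem_radSet_of_not_splitEpi hY f ?_
  rintro ⟨s, hs⟩
  exact hf ⟨s, hY.comp_eq_id hX _ _ hs, hs⟩

theorem zero_mem_radSet (X Y : ModuleCat.{0} A) : (0 : X ⟶ Y) ∈ radSet A X Y := by
  intro M hM h h' hi
  apply hM.2.id_ne_zero
  have := IsIso.inv_hom_id (h ≫ (0 : X ⟶ Y) ≫ h')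
  rw [← this]; simp

/-- In an indecomposable module of finite length, endomorphisms are invertible or nilpotent. -/
theorem FinIndec.isIso_or_isIso_one_sub [IsArtinianRing A] (hX : FinIndec A X) (f : X ⟶ X) :
    IsIso f ∨ IsIso (𝟙 X - f) := by
  have := hX.1
  obtain ⟨n, hn⟩ := Filter.eventually_atTop.1
    (LinearMap.eventually_isCompl_ker_pow_range_pow (R := A) (M := X) f.hom)
  have hc := hn (n + 1) (by omega)
  set g : Module.End A X := f.hom ^ (n + 1) with hg
  let p : X ⟶ X := ModuleCat.ofHom
    ((LinearMap.range g).subtype ∘ₗ Submodule.projectionOnto _ _ hc.symm)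
  have hp : p ≫ p = p := by
    ext x
    simp [p]
  rcases hX.2.2 p hp with h0 | h1
  · right
    have hz : g = 0 := by
      ext x
      have := congrArg (fun q : X ⟶ X => q.hom (g x)) h0
      have e : p.hom (g x) = g x := by
        change ((Submodule.projectionOnto _ _ hc.symm) (g x) : X) = g x
        have := Submodule.projectionOnto_apply_left hc.symm ⟨g x, LinearMap.mem_range_self g x⟩
        exact congrArg Subtype.val this
      have h2 : p.hom (g x) = 0 := this
      rwa [e] at h2
    have hu : IsUnit (1 - f.hom : Module.End A X) := IsNilpotent.isUnit_one_sub ⟨n + 1, hz⟩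
    rw [ConcreteCategory.isIso_iff_bijective]
    exact (Module.End.isUnit_iff _).1 hu
  · left
    have hk : LinearMap.ker g = ⊥ := by
      rw [eq_bot_iff]
      intro x hx
      have e : p.hom x = 0 := by
        change ((Submodule.projectionOnto _ _ hc.symm) x : X) = 0
        rw [(Submodule.projectionOnto_apply_eq_zero_iff hc.symm).2 hx]; rfl
      rw [h1] at e
      simpa using e
    have hr : LinearMap.range g = ⊤ := by
      have := hc.sup_eq_top
      rwa [hk, bot_sup_eq] at this
    rw [ConcreteCategory.isIso_iff_bijective]
    have hu : IsUnit g := (Module.End.isUnit_iff _).2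
      ⟨LinearMap.ker_eq_bot.1 hk, LinearMap.range_eq_top.1 hr⟩
    exact (Module.End.isUnit_iff (f.hom)).1 ((isUnit_pow_iff (by omega)).1 hu)

theorem FinIndec.isIso_of_add [IsArtinianRing A] (hX : FinIndec A X) (f g : X ⟶ X)
    (h : IsIso (f + g)) : IsIso f ∨ IsIso g := by
  rcases hX.isIso_or_isIso_one_sub (f ≫ inv (f + g)) with h1 | h1
  · left
    have : f = (f ≫ inv (f + g)) ≫ (f + g) := by
      rw [Category.assoc, IsIso.inv_hom_id, Category.comp_id]
    rw [this]; infer_instance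
  · right
    have : g = (𝟙 X - f ≫ inv (f + g)) ≫ (f + g) := by
      rw [Preadditive.sub_comp, Category.assoc, IsIso.inv_hom_id, Category.comp_id,
        Category.id_comp]
      abel
    rw [this]; infer_instance

theorem radSet_add [IsArtinianRing A] {f g : X ⟶ Y} (hf : f ∈ radSet A X Y)
    (hg : g ∈ radSet A X Y) : f + g ∈ radSet A X Y := by
  intro M hM h h' hi
  have : h ≫ (f + g) ≫ h' = h ≫ f ≫ h' + h ≫ g ≫ h' := by simp
  rw [this] at hi
  rcases hM.isIso_of_add _ _ hi with h1 | h1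
  · exact hf M hM h h' h1
  · exact hg M hM h h' h1

theorem radPowSet_comp_left : ∀ {n : ℕ} {X Y Z : ModuleCat.{0} A} (u : Z ⟶ X) {f : X ⟶ Y},
    f ∈ radPowSet A n X Y → u ≫ f ∈ radPowSet A n Z Y
  | 0, _, _, _, _, _, _ => Set.mem_univ _
  | n + 1, _, _, _, u, _, ⟨M, g, h, hM, hg, hh, e⟩ =>
    ⟨M, u ≫ g, h, hM, radSet_comp_left u hg, hh, by rw [e, Category.assoc]⟩

theorem radPowSet_comp_right : ∀ {n : ℕ} {X Y Z : ModuleCat.{0} A} {f : X ⟶ Y},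
    f ∈ radPowSet A n X Y → ∀ (u : Y ⟶ Z), f ≫ u ∈ radPowSet A n X Z
  | 0, _, _, _, _, _, _ => Set.mem_univ _
  | n + 1, _, _, _, _, ⟨M, g, h, hM, hg, hh, e⟩, u =>
    ⟨M, g, h ≫ u, hM, hg, radPowSet_comp_right hh u, by rw [e, Category.assoc]⟩

theorem radPowSet_comp : ∀ {a b : ℕ} {X Y Z : ModuleCat.{0} A} {f : X ⟶ Y} {g : Y ⟶ Z},
    f ∈ radPowSet A a X Y → g ∈ radPowSet A b Y Z → f ≫ g ∈ radPowSet A (a + b) X Z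
  | 0, b, _, _, _, f, g, _, hg => by
    rw [Nat.zero_add]; exact radPowSet_comp_left f hg
  | a + 1, b, _, _, _, f, g, ⟨M, u, v, hM, hu, hv, e⟩, hg => by
    rw [Nat.add_right_comm]
    exact ⟨M, u, v ≫ g, hM, hu, radPowSet_comp hv hg, by rw [e, Category.assoc]⟩

theorem mem_radPowSet_one [Module.Finite A Y] {f : X ⟶ Y} (hf : f ∈ radSet A X Y) :
    f ∈ radPowSet A 1 X Y :=
  ⟨Y, f, 𝟙 Y, inferInstance, hf, Set.mem_univ _, by simp⟩

theorem mem_radSet_of_mem_radPowSet_one {f : X ⟶ Y} (hf : f ∈ radPowSet A 1 X Y) :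
    f ∈ radSet A X Y := by
  obtain ⟨M, g, h, -, hg, -, rfl⟩ := hf
  exact radSet_comp_right hg h

theorem radPowSet_mono {m n : ℕ} (h : m ≤ n) : radPowSet A n X Y ⊆ radPowSet A m X Y := by
  induction m generalizing n X with
  | zero => exact fun _ _ => Set.mem_univ _
  | succ m ih =>
    obtain ⟨n, rfl⟩ : ∃ n', n = n' + 1 := ⟨n - 1, by omega⟩
    rintro f ⟨M, g, t, hM, hg, ht, e⟩
    exact ⟨M, g, t, hM, hg, ih (by omega) ht, e⟩

theorem finite_prod_modCat (M N : ModuleCat.{0} A) [Module.Finite A M] [Module.Finite A N] :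
    Module.Finite A (ModuleCat.of A (M × N)) :=
  inferInstanceAs (Module.Finite A (M × N))

theorem radPowSet_add [IsArtinianRing A] : ∀ {n : ℕ} {X Y : ModuleCat.{0} A} {f g : X ⟶ Y},
    f ∈ radPowSet A n X Y → g ∈ radPowSet A n X Y → f + g ∈ radPowSet A n X Y
  | 0, _, _, _, _, _, _ => Set.mem_univ _
  | n + 1, X, Y, f, g, ⟨M, u, v, hM, hu, hv, e⟩, ⟨M', u', v', hM', hu', hv', e'⟩ => by
    let p₁ : ModuleCat.of A (M × M') ⟶ M := ModuleCat.ofHom (LinearMap.fst A M M')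
    let p₂ : ModuleCat.of A (M × M') ⟶ M' := ModuleCat.ofHom (LinearMap.snd A M M')
    let i₁ : M ⟶ ModuleCat.of A (M × M') := ModuleCat.ofHom (LinearMap.inl A M M')
    let i₂ : M' ⟶ ModuleCat.of A (M × M') := ModuleCat.ofHom (LinearMap.inr A M M')
    refine ⟨ModuleCat.of A (M × M'), u ≫ i₁ + u' ≫ i₂, p₁ ≫ v + p₂ ≫ v',
      finite_prod_modCat M M', radSet_add (radSet_comp_right hu _) (radSet_comp_right hu' _),
      radPowSet_add (radPowSet_comp_left _ hv) (radPowSet_comp_left _ hv'), ?_⟩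
    rw [e, e']
    ext x
    simp [p₁, p₂, i₁, i₂]

theorem zero_mem_radPowSet : ∀ (n : ℕ) (X Y : ModuleCat.{0} A),
    (0 : X ⟶ Y) ∈ radPowSet A n X Y
  | 0, _, _ => Set.mem_univ _
  | n + 1, X, Y => ⟨ModuleCat.of A PUnit, 0, 0, inferInstanceAs (Module.Finite A PUnit),
      zero_mem_radSet _ _, zero_mem_radPowSet n _ _, by simp⟩

theorem radSet_sum [IsArtinianRing A] {ι : Type} (s : Finset ι) (f : ι → (X ⟶ Y))
    (h : ∀ i ∈ s, f i ∈ radSet A X Y) : ∑ i ∈ s, f i ∈ radSet A X Y :=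
  Finset.sum_induction _ (· ∈ radSet A X Y) (fun _ _ => radSet_add) (zero_mem_radSet _ _) h

theorem radPowSet_sum [IsArtinianRing A] {n : ℕ} {ι : Type} (s : Finset ι) (f : ι → (X ⟶ Y))
    (h : ∀ i ∈ s, f i ∈ radPowSet A n X Y) : ∑ i ∈ s, f i ∈ radPowSet A n X Y :=
  Finset.sum_induction _ (· ∈ radPowSet A n X Y) (fun _ _ => radPowSet_add)
    (zero_mem_radPowSet _ _ _) h

/-- A non-zero object that is not indecomposable splits into two smaller ones. -/
theorem exists_split_of_not_indec [IsArtinianRing A] (M : ModuleCat.{0} A) [Module.Finite A M]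
    [Nontrivial M] (h : ¬ Indec A M) :
    ∃ (M₁ M₂ : ModuleCat.{0} A) (p₁ : M ⟶ M₁) (i₁ : M₁ ⟶ M) (p₂ : M ⟶ M₂) (i₂ : M₂ ⟶ M),
      Module.Finite A M₁ ∧ Module.Finite A M₂ ∧ Module.length A M₁ < Module.length A M ∧
      Module.length A M₂ < Module.length A M ∧ p₁ ≫ i₁ + p₂ ≫ i₂ = 𝟙 M ∧
      i₁ ≫ p₁ = 𝟙 M₁ ∧ i₂ ≫ p₂ = 𝟙 M₂ := by
  have h' : ∃ f : M ⟶ M, f ≫ f = f ∧ f ≠ 0 ∧ f ≠ 𝟙 M := by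
    by_contra hc
    push Not at hc
    refine h ⟨inferInstance, fun f hf => ?_⟩
    by_cases h0 : f = 0
    · exact Or.inl h0
    · exact Or.inr (hc f hf h0)
  obtain ⟨f, hf, h0, h1⟩ := h'
  have key : ∀ g : M ⟶ M, g ≫ g = g → g ≠ 𝟙 M →
      ∃ (N : ModuleCat.{0} A) (p : M ⟶ N) (i : N ⟶ M), Module.Finite A N ∧
        Module.length A N < Module.length A M ∧ p ≫ i = g ∧ i ≫ p = 𝟙 N := by
    intro g hg hg1
    have hgg : ∀ x, g.hom (g.hom x) = g.hom x := fun x =>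
      congrArg (fun q : M ⟶ M => q.hom x) hg
    refine ⟨ModuleCat.of A (LinearMap.range g.hom), ModuleCat.ofHom g.hom.rangeRestrict,
      ModuleCat.ofHom (LinearMap.range g.hom).subtype, ?_, ?_, ?_, ?_⟩
    · exact inferInstanceAs (Module.Finite A (LinearMap.range g.hom))
    · apply Submodule.length_lt
      intro ht
      apply hg1
      ext x
      obtain ⟨y, rfl⟩ : x ∈ LinearMap.range g.hom := ht ▸ Submodule.mem_top
      simpa using hgg y
    · ext x; rfl
    · ext ⟨x, y, rfl⟩
      simpa using hgg y
  obtain ⟨M₁, p₁, i₁, a₁, b₁, c₁, d₁⟩ := key f hf h1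
  obtain ⟨M₂, p₂, i₂, a₂, b₂, c₂, d₂⟩ := key (𝟙 M - f) (by simp [hf]) (by simpa using h0)
  exact ⟨M₁, M₂, p₁, i₁, p₂, i₂, a₁, a₂, b₁, b₂, by rw [c₁, c₂]; abel, d₁, d₂⟩

/-- Every finitely generated module is a finite direct sum of indecomposables; this is
the induction principle it gives for properties of morphisms factoring through it. -/
theorem exists_indec_factor [IsArtinianRing A] (S : Set (X ⟶ Y)) (h0 : (0 : X ⟶ Y) ∈ S)
    (hadd : ∀ f ∈ S, ∀ g ∈ S, f + g ∈ S) (M : ModuleCat.{0} A) (hM : Module.Finite A M)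
    (g : X ⟶ M) (h : M ⟶ Y) (hgh : g ≫ h ∉ S) :
    ∃ (N : ModuleCat.{0} A) (p : M ⟶ N) (i : N ⟶ M), FinIndec A N ∧ i ≫ p = 𝟙 N ∧
      g ≫ p ≫ i ≫ h ∉ S := by
  induction hn : Module.length A M using WellFoundedLT.induction generalizing M with
  | ind n ih =>
    by_cases hnt : Nontrivial M
    · by_cases hi : Indec A M
      · exact ⟨M, 𝟙 M, 𝟙 M, ⟨hM, hi⟩, by simp, by simpa using hgh⟩
      · obtain ⟨M₁, M₂, p₁, i₁, p₂, i₂, a₁, a₂, b₁, b₂, e, d₁, d₂⟩ :=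
          exists_split_of_not_indec M hi
        have hsum : g ≫ h = (g ≫ p₁) ≫ (i₁ ≫ h) + (g ≫ p₂) ≫ (i₂ ≫ h) := by
          have : g ≫ h = g ≫ (p₁ ≫ i₁ + p₂ ≫ i₂) ≫ h := by rw [e]; simp
          rw [this]; simp
        have : (g ≫ p₁) ≫ (i₁ ≫ h) ∉ S ∨ (g ≫ p₂) ≫ (i₂ ≫ h) ∉ S := by
          by_contra hc
          push Not at hc
          exact hgh (hsum ▸ hadd _ hc.1 _ hc.2)
        rcases this with hc | hc
        · obtain ⟨N, p, i, hN, hip, hs⟩ := ih _ (hn ▸ b₁) M₁ a₁ _ _ hc rfl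
          refine ⟨N, p₁ ≫ p, i ≫ i₁, hN, ?_, by simpa using hs⟩
          rw [Category.assoc, reassoc_of% d₁, hip]
        · obtain ⟨N, p, i, hN, hip, hs⟩ := ih _ (hn ▸ b₂) M₂ a₂ _ _ hc rfl
          refine ⟨N, p₂ ≫ p, i ≫ i₂, hN, ?_, by simpa using hs⟩
          rw [Category.assoc, reassoc_of% d₂, hip]
    · exfalso
      apply hgh
      have hs : Subsingleton M := not_nontrivial_iff_subsingleton.1 hnt
      have : g = 0 := by
        ext x
        exact Subsingleton.elim _ _
      rw [this]; simpa using h0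

end Radical

/-! ## Irreducible maps and almost split maps -/

section AlmostSplit

variable {A : Type} [Ring A] {X Y Z W : ModuleCat.{0} A}

/-- There is a radical morphism from `X` to `Y` outside the square of the radical. -/
def HasIrr (X Y : ModuleCat.{0} A) : Prop := ∃ f ∈ radSet A X Y, f ∉ radPowSet A 2 X Y

/-- Chains of `n` irreducible steps between finitely generated indecomposables. -/
inductive IrrChain : ℕ → ModuleCat.{0} A → ModuleCat.{0} A → Prop
  | iso {X Y : ModuleCat.{0} A} (h : Nonempty (X ≅ Y)) : IrrChain 0 X Y
  | cons {X Y Z : ModuleCat.{0} A} {n : ℕ} (hX : FinIndec A X) (hY : FinIndec A Y)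
      (h : HasIrr X Y) (c : IrrChain n Y Z) : IrrChain (n + 1) X Z

theorem isIso_of_not_mem_radPowSet_one (hX : FinIndec A X) (hY : FinIndec A Y) {f : X ⟶ Y}
    (hf : f ∉ radPowSet A 1 X Y) : IsIso f := by
  by_contra hc
  have := hY.1
  exact hf (mem_radPowSet_one (mem_radSet_of_not_isIso hX.2 hY.2 f hc))

theorem mem_radPowSet_two {f : X ⟶ Y} {g : Y ⟶ Z} (hY : Module.Finite A Y)
    (hZ : Module.Finite A Z) (hf : f ∈ radSet A X Y) (hg : g ∈ radSet A Y Z) :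
    f ≫ g ∈ radPowSet A 2 X Z :=
  radPowSet_comp (a := 1) (b := 1) (mem_radPowSet_one hf) (mem_radPowSet_one hg)

theorem irrChain_of_mem [IsArtinianRing A] : ∀ {n : ℕ} {X Y : ModuleCat.{0} A}
    (_ : FinIndec A X) (_ : FinIndec A Y) {f : X ⟶ Y}, f ∈ radPowSet A n X Y →
    f ∉ radPowSet A (n + 1) X Y → IrrChain n X Y
  | 0, X, Y, hX, hY, f, _, hf => by
    have := isIso_of_not_mem_radPowSet_one hX hY hf
    exact .iso ⟨asIso f⟩
  | n + 1, X, Y, hX, hY, _, ⟨M, g, h, hM, hg, hh, rfl⟩, hf => by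
    obtain ⟨N, p, i, hN, -, hni⟩ := exists_indec_factor (radPowSet A (n + 2) X Y)
      (zero_mem_radPowSet _ _ _) (fun _ a _ b => radPowSet_add a b) M hM g h hf
    refine .cons hX hN ⟨g ≫ p, radSet_comp_right hg p, fun hc => hni ?_⟩
      (irrChain_of_mem hN hY (f := i ≫ h) (radPowSet_comp_left i hh) fun hc => hni ?_)
    · have := radPowSet_comp hc (radPowSet_comp_left i hh)
      rw [Nat.add_comm] at this
      simpa using this
    · have := hN.1
      have := radPowSet_comp (mem_radPowSet_one (radSet_comp_right hg p)) hc
      rw [Nat.add_comm] at this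
      simpa using this

/-- A non-zero morphism has a well-defined depth if the radical is nilpotent. -/
theorem exists_depth {r m : ℕ} (hr : RadVanishes A r) [Module.Finite A X] [Module.Finite A Y]
    {f : X ⟶ Y} (hf : f ≠ 0) (hm : f ∈ radPowSet A m X Y) :
    ∃ n, m ≤ n ∧ n < r ∧ f ∈ radPowSet A n X Y ∧ f ∉ radPowSet A (n + 1) X Y := by
  have hex : ∃ n, f ∉ radPowSet A n X Y :=
    ⟨r, fun h => hf (hr X Y inferInstance inferInstance f h)⟩
  have h1 := Nat.find_spec hex
  have h2 : m < Nat.find hex := by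
    by_contra hc
    exact h1 (radPowSet_mono (not_lt.1 hc) hm)
  have h3 : Nat.find hex ≤ r :=
    Nat.find_min' hex fun h => hf (hr X Y inferInstance inferInstance f h)
  refine ⟨Nat.find hex - 1, by omega, by omega, ?_, ?_⟩
  · by_contra hc
    exact Nat.find_min hex (by omega) hc
  · rwa [Nat.sub_add_cancel (by omega)]

/-- A radical morphism through which all radical morphisms from finitely generated
indecomposables factor. -/
def IsRightAlmost {E Y : ModuleCat.{0} A} (g : E ⟶ Y) : Prop :=
  Module.Finite A E ∧ g ∈ radSet A E Y ∧
    ∀ X : ModuleCat.{0} A, FinIndec A X → ∀ f ∈ radSet A X Y, ∃ t : X ⟶ E, t ≫ g = f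

theorem IsRightAlmost.factor [IsArtinianRing A] {E Y : ModuleCat.{0} A} {g : E ⟶ Y}
    (hg : IsRightAlmost g) (M : ModuleCat.{0} A) [hM : Module.Finite A M] (f : M ⟶ Y)
    (hf : f ∈ radSet A M Y) : ∃ t : M ⟶ E, t ≫ g = f := by
  by_contra hc
  obtain ⟨N, p, i, hN, -, hni⟩ := exists_indec_factor {f : M ⟶ Y | ∃ t : M ⟶ E, t ≫ g = f}
    ⟨0, by simp⟩ (by
      rintro _ ⟨a, rfl⟩ _ ⟨b, rfl⟩
      exact ⟨a + b, by simp⟩) M hM (𝟙 M) f (by simpa using hc)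
  obtain ⟨t, ht⟩ := hg.2.2 N hN (i ≫ f) (radSet_comp_left i hf)
  exact hni ⟨p ≫ t, by simp [ht]⟩

end AlmostSplit

section Existence

open scoped ModuleCat

variable (k : Type) {A : Type} [Field k] [Ring A] [Algebra k A] [FiniteDimensional k A]

theorem finiteDimensional_modCat (X : ModuleCat.{0} A) [Module.Finite A X] :
    Module.Finite k X := Module.Finite.trans A X

theorem finiteDimensional_hom (X Y : ModuleCat.{0} A) [Module.Finite A X] [Module.Finite A Y] :
    Module.Finite k (X ⟶ Y) := by
  have := finiteDimensional_modCat k X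
  have := finiteDimensional_modCat k Y
  let F : (X ⟶ Y) →ₗ[k] (X →ₗ[k] Y) :=
    { toFun := fun f => f.hom.restrictScalars k
      map_add' := fun f g => rfl
      map_smul' := fun c f => rfl }
  apply Module.Finite.of_injective F
  intro f g h
  ext x
  exact congrArg (fun q : X →ₗ[k] Y => q x) h

include k in
theorem exists_isRightAlmost (hrf : RepFinite A) (Y : ModuleCat.{0} A) (hY : FinIndec A Y) :
    ∃ (E : ModuleCat.{0} A) (g : E ⟶ Y), IsRightAlmost g := by
  have := IsArtinianRing.of_finite k A
  obtain ⟨n, T, hT⟩ := hrf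
  have hYf := hY.1
  have hfg : ∀ i : Fin n, Module.Finite A (T i) → ∃ s : Finset (T i ⟶ Y),
      (∀ f ∈ s, f ∈ radSet A (T i) Y) ∧
      ∀ f ∈ radSet A (T i) Y, f ∈ Submodule.span k (s : Set (T i ⟶ Y)) := by
    intro i hi
    have := finiteDimensional_hom k (T i) Y
    let S : Submodule k (T i ⟶ Y) :=
      { carrier := radSet A (T i) Y
        add_mem' := radSet_add
        zero_mem' := zero_mem_radSet _ _
        smul_mem' := fun c f hf => by
          have := radSet_comp_right hf (c • 𝟙 Y)
          simpa using this }
    obtain ⟨s, hs⟩ := (IsNoetherian.noetherian S : S.FG)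
    refine ⟨s, fun f hf => ?_, fun f hf => ?_⟩
    · have : f ∈ S := hs ▸ Submodule.subset_span hf
      exact this
    · rw [hs]; exact hf
  let I : Type := {i : Fin n // Module.Finite A (T i)}
  choose s hs1 hs2 using fun i : I => hfg i.1 i.2
  let J : Type := Σ i : I, s i
  let E : ModuleCat.{0} A := ModuleCat.of A (∀ j : J, T j.1.1)
  let pr : ∀ j : J, E ⟶ T j.1.1 := fun j => ModuleCat.ofHom (LinearMap.proj j)
  let inj : ∀ j : J, T j.1.1 ⟶ E := fun j => ModuleCat.ofHom
    (LinearMap.single A (fun j : J => (T j.1.1 : Type)) j)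
  let g : E ⟶ Y := ∑ j : J, pr j ≫ j.2.1
  have hinj : ∀ j, inj j ≫ g = j.2.1 := by
    intro j
    have h1 : inj j ≫ g = ∑ l : J, inj j ≫ pr l ≫ l.2.1 := Preadditive.comp_sum _ _ _
    rw [h1, Finset.sum_eq_single j]
    · have e : inj j ≫ pr j = 𝟙 _ := by
        ext x
        exact Pi.single_eq_same (M := fun j : J => (T j.1.1 : Type)) j x
      rw [reassoc_of% e]
    · intro l _ hl
      have e : inj j ≫ pr l = 0 := by
        ext x
        exact Pi.single_eq_of_ne (M := fun j : J => (T j.1.1 : Type)) hl x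
      rw [reassoc_of% e]; simp
    · simp
  have hE : Module.Finite A E := by
    have : ∀ j : J, Module.Finite A (T j.1.1) := fun j => j.1.2
    exact inferInstanceAs (Module.Finite A (∀ j : J, T j.1.1))
  refine ⟨E, g, hE, radSet_sum _ _ fun j _ => radSet_comp_left _ (hs1 _ _ j.2.2), ?_⟩
  intro X hX f hf
  obtain ⟨i, ⟨e⟩⟩ := hT X hX
  have hTi : Module.Finite A (T i) := by
    have := hX.1
    exact Module.Finite.equiv e.toLinearEquiv
  have hmem := hs2 ⟨i, hTi⟩ (e.inv ≫ f) (radSet_comp_left _ hf)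
  have : ∃ t : T i ⟶ E, t ≫ g = e.inv ≫ f := by
    generalize e.inv ≫ f = q at hmem
    induction hmem using Submodule.span_induction with
    | mem x hx => exact ⟨inj ⟨⟨i, hTi⟩, ⟨x, hx⟩⟩, hinj _⟩
    | zero => exact ⟨0, by simp⟩
    | add x y _ _ hx hy =>
      obtain ⟨a, rfl⟩ := hx
      obtain ⟨b, rfl⟩ := hy
      exact ⟨a + b, by simp⟩
    | smul c x _ hx =>
      obtain ⟨a, rfl⟩ := hx
      exact ⟨c • a, by simp⟩
  obtain ⟨t, ht⟩ := this
  exact ⟨e.hom ≫ t, by rw [Category.assoc, ht]; simp⟩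

include k in
/-- A right almost split map whose source has minimal length is right minimal. -/
theorem exists_minimal_isRightAlmost (hrf : RepFinite A) (Y : ModuleCat.{0} A)
    (hY : FinIndec A Y) : ∃ (E : ModuleCat.{0} A) (g : E ⟶ Y), IsRightAlmost g ∧
      ∀ ψ : E ⟶ E, ψ ≫ g = g → IsIso ψ := by
  have := IsArtinianRing.of_finite k A
  have hex : ∃ l : ℕ∞, ∃ (E : ModuleCat.{0} A) (g : E ⟶ Y), IsRightAlmost g ∧
      Module.length A E = l := by
    obtain ⟨E, g, h⟩ := exists_isRightAlmost k hrf Y hY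
    exact ⟨_, E, g, h, rfl⟩
  obtain ⟨l, ⟨E, g, hg, hl⟩, hmin⟩ := WellFounded.has_min (wellFounded_lt (α := ℕ∞))
    {l | ∃ (E : ModuleCat.{0} A) (g : E ⟶ Y), IsRightAlmost g ∧ Module.length A E = l} hex
  refine ⟨E, g, hg, fun ψ hψ => ?_⟩
  have := hg.1
  have htop : LinearMap.range ψ.hom = ⊤ := by
    by_contra hne
    let E' : ModuleCat.{0} A := ModuleCat.of A (LinearMap.range ψ.hom)
    let i : E' ⟶ E := ModuleCat.ofHom (LinearMap.range ψ.hom).subtype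
    let q : E ⟶ E' := ModuleCat.ofHom ψ.hom.rangeRestrict
    refine hmin (Module.length A E') ⟨E', i ≫ g, ⟨?_, radSet_comp_left i hg.2.1, ?_⟩, rfl⟩ ?_
    · exact inferInstanceAs (Module.Finite A (LinearMap.range ψ.hom))
    · intro X hX f hf
      obtain ⟨t, ht⟩ := hg.2.2 X hX f hf
      have hqi : q ≫ i = ψ := by ext x; rfl
      exact ⟨t ≫ q, by rw [Category.assoc, reassoc_of% hqi, hψ, ht]⟩
    · rw [← hl]
      exact Submodule.length_lt hne
  rw [ConcreteCategory.isIso_iff_bijective]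
  have hs : Function.Surjective ψ.hom := LinearMap.range_eq_top.1 htop
  exact ⟨IsNoetherian.injective_of_surjective_endomorphism ψ.hom hs, hs⟩

end Existence

section Kernel

variable {A : Type} [Ring A] {E Y : ModuleCat.{0} A}

/-- The kernel of a morphism as an object. -/
def kerObj (g : E ⟶ Y) : ModuleCat.{0} A := ModuleCat.of A (LinearMap.ker g.hom)

def kerInc (g : E ⟶ Y) : kerObj g ⟶ E := ModuleCat.ofHom (LinearMap.ker g.hom).subtype

theorem kerInc_comp (g : E ⟶ Y) : kerInc g ≫ g = 0 := by
  ext x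
  exact x.2

theorem finite_kerObj [IsArtinianRing A] [Module.Finite A E] (g : E ⟶ Y) :
    Module.Finite A (kerObj g) :=
  inferInstanceAs (Module.Finite A (LinearMap.ker g.hom))

theorem exists_kerLift (g : E ⟶ Y) {M : ModuleCat.{0} A} (f : M ⟶ E) (h : f ≫ g = 0) :
    ∃ r : M ⟶ kerObj g, r ≫ kerInc g = f := by
  refine ⟨ModuleCat.ofHom (LinearMap.codRestrict _ f.hom fun x => ?_), ?_⟩
  · exact congrArg (fun q : M ⟶ Y => q.hom x) h
  · ext x; rfl

theorem kerInc_cancel (g : E ⟶ Y) {M : ModuleCat.{0} A} (f f' : M ⟶ kerObj g)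
    (h : f ≫ kerInc g = f' ≫ kerInc g) : f = f' := by
  ext x
  exact Subtype.ext (congrArg (fun q : M ⟶ E => q.hom x) h)

theorem exists_cokerDesc (g : E ⟶ Y) (hg : Function.Surjective g.hom) {M : ModuleCat.{0} A}
    (f : E ⟶ M) (h : kerInc g ≫ f = 0) : ∃ w : Y ⟶ M, g ≫ w = f := by
  have hk : ∀ x, g.hom x = 0 → f.hom x = 0 := fun x hx =>
    congrArg (fun q : kerObj g ⟶ M => q.hom ⟨x, hx⟩) h
  have key : ∀ x y, g.hom x = g.hom y → f.hom x = f.hom y := by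
    intro x y hxy
    have := hk (x - y) (by rw [map_sub, hxy, sub_self])
    rwa [map_sub, sub_eq_zero] at this
  choose s hs using hg
  refine ⟨ModuleCat.ofHom
    { toFun := fun y => f.hom (s y)
      map_add' := fun a b => ?_
      map_smul' := fun a b => ?_ }, ?_⟩
  · rw [← map_add]
    exact key _ _ (by rw [map_add, hs, hs, hs])
  · rw [RingHom.id_apply, ← map_smul]
    exact key _ _ (by rw [map_smul, hs, hs])
  · ext x
    exact key _ _ (hs _)

/-- The kernel of a surjective right minimal right almost split map is left almost split. -/
theorem exists_extension_of_minimal [IsArtinianRing A] {g : E ⟶ Y} (hY : FinIndec A Y)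
    (hg : IsRightAlmost g) (hmin : ∀ ψ : E ⟶ E, ψ ≫ g = g → IsIso ψ)
    {M : ModuleCat.{0} A} (hM : Module.Finite A M) (h : kerObj g ⟶ M)
    (hh : ¬ ∃ r : M ⟶ kerObj g, h ≫ r = 𝟙 _) : ∃ ρ : E ⟶ M, kerInc g ≫ ρ = h := by
  have := hg.1
  let N : Submodule A (E × M) := LinearMap.range ((kerInc g).hom.prod (-h.hom))
  let Q : ModuleCat.{0} A := ModuleCat.of A ((E × M) ⧸ N)
  let iE : E ⟶ Q := ModuleCat.ofHom (N.mkQ ∘ₗ LinearMap.inl A E M)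
  let iM : M ⟶ Q := ModuleCat.ofHom (N.mkQ ∘ₗ LinearMap.inr A E M)
  have hcomm : kerInc g ≫ iE = h ≫ iM := by
    ext x
    refine (Submodule.Quotient.eq N).2 ⟨x, ?_⟩
    refine Prod.ext ?_ ?_
    · change (kerInc g).hom x = (kerInc g).hom x - 0
      rw [sub_zero]
    · change - h.hom x = 0 - h.hom x
      rw [zero_sub]
  have hN : N ≤ LinearMap.ker (g.hom ∘ₗ LinearMap.fst A E M) := by
    rintro _ ⟨x, rfl⟩
    exact x.2
  let d : Q ⟶ Y := ModuleCat.ofHom (N.liftQ (g.hom ∘ₗ LinearMap.fst A E M) hN)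
  have hE : iE ≫ d = g := by ext x; rfl
  have hMd : iM ≫ d = 0 := by
    ext x
    exact map_zero g.hom
  have hQ : Module.Finite A Q := inferInstanceAs (Module.Finite A ((E × M) ⧸ N))
  by_cases hs : ∃ s : Y ⟶ Q, s ≫ d = 𝟙 Y
  · obtain ⟨s, hs⟩ := hs
    have hinj : Function.Injective iM.hom := by
      rw [← LinearMap.ker_eq_bot, eq_bot_iff]
      intro x hx
      obtain ⟨y, hy⟩ : ((0 : E), x) ∈ N := (Submodule.Quotient.mk_eq_zero N).1 hx
      have h1 : (kerInc g).hom y = 0 := congrArg Prod.fst hy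
      have h2 : - h.hom y = x := congrArg Prod.snd hy
      have h3 : y = 0 := Subtype.ext h1
      rw [h3, map_zero, neg_zero] at h2
      exact h2.symm
    have hker : ∀ q : Q, d.hom q = 0 → ∃ x : M, iM.hom x = q := by
      intro q hq
      obtain ⟨⟨e, x⟩, rfl⟩ := Submodule.Quotient.mk_surjective N q
      have he : g.hom e = 0 := hq
      let κ : kerObj g := ⟨e, he⟩
      refine ⟨x + h.hom κ, ?_⟩
      refine (Submodule.Quotient.eq N).2 ⟨-κ, ?_⟩
      refine Prod.ext ?_ ?_
      · change - e = 0 - e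
        rw [zero_sub]
      · change - h.hom (-κ) = x + h.hom κ - x
        rw [map_neg, neg_neg, add_sub_cancel_left]
    let δ : E ⟶ Q := iE - g ≫ s
    have hδ : δ ≫ d = 0 := by
      simp [δ, hE, hs]
    have hr : ∀ x, δ.hom x ∈ LinearMap.range iM.hom := fun x =>
      hker _ (congrArg (fun q : E ⟶ Y => q.hom x) hδ)
    let eM := LinearEquiv.ofInjective iM.hom hinj
    refine ⟨ModuleCat.ofHom (eM.symm.toLinearMap ∘ₗ LinearMap.codRestrict _ δ.hom hr), ?_⟩
    ext x
    change eM.symm (LinearMap.codRestrict _ δ.hom hr ((kerInc g).hom x)) = h.hom x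
    rw [LinearEquiv.symm_apply_eq]
    apply Subtype.ext
    change δ.hom ((kerInc g).hom x) = iM.hom (h.hom x)
    have : kerInc g ≫ δ = h ≫ iM := by
      simp only [δ, Preadditive.comp_sub, hcomm]
      rw [← Category.assoc, kerInc_comp]; simp
    exact congrArg (fun q : kerObj g ⟶ Q => q.hom x) this
  · exfalso
    obtain ⟨t, ht⟩ := hg.factor Q d (mem_radSet_of_not_splitEpi hY.2 d hs)
    have hψ : IsIso (iE ≫ t) := hmin _ (by rw [Category.assoc, ht, hE])
    have hinv : inv (iE ≫ t) ≫ g = g := by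
      rw [IsIso.inv_comp_eq, Category.assoc, ht, hE]
    obtain ⟨r, hr⟩ := exists_kerLift g (iM ≫ t ≫ inv (iE ≫ t)) (by
      simp only [Category.assoc]
      rw [hinv, ht, hMd])
    refine hh ⟨r, kerInc_cancel g _ _ ?_⟩
    rw [Category.assoc, hr, ← Category.assoc, ← hcomm]
    have := IsIso.hom_inv_id (iE ≫ t)
    simp only [Category.assoc] at this ⊢
    rw [this]; simp

theorem no_retraction_of_minimal {g : E ⟶ Y} (hmin : ∀ ψ : E ⟶ E, ψ ≫ g = g → IsIso ψ)
    (hK : kerInc g ≠ 0) (ρ : E ⟶ kerObj g) : kerInc g ≫ ρ ≠ 𝟙 _ := by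
  intro hρ
  have hψ : IsIso (𝟙 E - ρ ≫ kerInc g) := hmin _ (by simp [kerInc_comp])
  apply hK
  have : kerInc g ≫ (𝟙 E - ρ ≫ kerInc g) = 0 := by
    rw [Preadditive.comp_sub, reassoc_of% hρ]; simp
  rwa [← cancel_mono (𝟙 E - ρ ≫ kerInc g), Limits.zero_comp]

theorem kerInc_ne_zero_of_rightAlmost {g : E ⟶ Y} (hY : FinIndec A Y) (hg : IsRightAlmost g)
    (hs : Function.Surjective g.hom) : kerInc g ≠ 0 := by
  intro h0
  have hinj : Function.Injective g.hom := by
    rw [← LinearMap.ker_eq_bot, eq_bot_iff]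
    intro x hx
    exact congrArg (fun q : kerObj g ⟶ E => q.hom ⟨x, hx⟩) h0
  have : IsIso g := (ConcreteCategory.isIso_iff_bijective g).2 ⟨hinj, hs⟩
  exact not_splitEpi_of_mem_radSet hY hg.2.1 (inv g) (by simp)

theorem finIndec_kerObj_of_minimal [IsArtinianRing A] {g : E ⟶ Y} (hY : FinIndec A Y)
    (hg : IsRightAlmost g) (hmin : ∀ ψ : E ⟶ E, ψ ≫ g = g → IsIso ψ)
    (hs : Function.Surjective g.hom) : FinIndec A (kerObj g) := by
  have := hg.1
  have hfin := finite_kerObj g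
  have hne := kerInc_ne_zero_of_rightAlmost hY hg hs
  refine ⟨hfin, ?_, ?_⟩
  · by_contra hc
    rw [not_nontrivial_iff_subsingleton] at hc
    apply hne
    ext x
    rw [Subsingleton.elim x 0]; simp
  · intro e he
    by_contra hc
    push Not at hc
    have key : ∀ u : kerObj g ⟶ kerObj g, u ≫ u = u → u ≠ 𝟙 _ →
        ∃ ρ : E ⟶ kerObj g, kerInc g ≫ ρ = u := by
      intro u hu hu1
      refine exists_extension_of_minimal hY hg hmin hfin u ?_
      rintro ⟨r, hr⟩
      apply hu1
      calc u = u ≫ (u ≫ r) := by rw [hr, Category.comp_id]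
        _ = 𝟙 _ := by rw [← Category.assoc, hu, hr]
    obtain ⟨ρ₁, h₁⟩ := key e he hc.2
    obtain ⟨ρ₂, h₂⟩ := key (𝟙 _ - e) (by simp [he]) (by simpa using hc.1)
    exact no_retraction_of_minimal hmin hne (ρ₁ + ρ₂) (by simp [h₁, h₂])

/-- If `Y` is not projective there is an indecomposable `K` such that every irreducible
`X ⟶ Y` gives rise to an irreducible `K ⟶ X`. -/
theorem exists_translate (k : Type) [Field k] [Algebra k A] [FiniteDimensional k A]
    (hrf : RepFinite A) (hY : FinIndec A Y) (hnp : ¬ Module.Projective A Y) :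
    ∃ K : ModuleCat.{0} A, FinIndec A K ∧
      ∀ X : ModuleCat.{0} A, FinIndec A X → HasIrr X Y → HasIrr K X := by
  have := IsArtinianRing.of_finite k A
  obtain ⟨E, g, hg, hmin⟩ := exists_minimal_isRightAlmost k hrf Y hY
  have hEf := hg.1
  have hs : Function.Surjective g.hom := by
    have := hY.1
    obtain ⟨n, f, hf⟩ := Module.Finite.exists_fin' A Y
    let F : ModuleCat.{0} A := ModuleCat.of A (Fin n → A)
    let f' : F ⟶ Y := ModuleCat.ofHom f
    have hfr : f' ∈ radSet A F Y := by
      refine mem_radSet_of_not_splitEpi hY.2 f' ?_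
      rintro ⟨s, hs⟩
      exact hnp (Module.Projective.of_split s.hom f
        (congrArg (fun q : Y ⟶ Y => q.hom) hs))
    have : Module.Finite A F := inferInstanceAs (Module.Finite A (Fin n → A))
    obtain ⟨t, ht⟩ := hg.factor F f' hfr
    intro y
    obtain ⟨x, rfl⟩ := hf y
    exact ⟨t.hom x, congrArg (fun q : F ⟶ Y => q.hom x) ht⟩
  have hne := kerInc_ne_zero_of_rightAlmost hY hg hs
  have hK := finIndec_kerObj_of_minimal hY hg hmin hs
  refine ⟨kerObj g, hK, ?_⟩
  rintro X hX ⟨f, hf, hf2⟩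
  obtain ⟨t, rfl⟩ := hg.2.2 X hX f hf
  have ht : t ∉ radSet A X E := fun h => hf2 (mem_radPowSet_two hEf hY.1 h hg.2.1)
  obtain ⟨p, hp⟩ : ∃ p : E ⟶ X, t ≫ p = 𝟙 X := by
    by_contra hc
    exact ht (mem_radSet_of_not_splitMono hX.2 t hc)
  refine ⟨kerInc g ≫ p, ?_, ?_⟩
  · refine mem_radSet_of_not_splitMono hK.2 _ ?_
    rintro ⟨r, hr⟩
    exact no_retraction_of_minimal hmin hne (p ≫ r) (by rw [← Category.assoc, hr])
  · rintro ⟨M, a, b, hM, ha, hb, hab⟩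
    obtain ⟨a', ha'⟩ := exists_extension_of_minimal hY hg hmin hM a
      (fun ⟨r, hr⟩ => not_splitMono_of_mem_radSet hK ha r hr)
    obtain ⟨w, hw⟩ := exists_cokerDesc g hs (p - a' ≫ b) (by
      rw [Preadditive.comp_sub, hab, reassoc_of% ha', sub_self])
    have h1 : 𝟙 X = t ≫ a' ≫ b + (t ≫ g) ≫ w := by
      rw [Category.assoc, hw, Preadditive.comp_sub, hp]; abel
    have hrad : 𝟙 X ∈ radSet A X X := by
      rw [h1]
      refine radSet_add ?_ (radSet_comp_right hf w)
      exact radSet_comp_left _ (radSet_comp_left _ (mem_radSet_of_mem_radPowSet_one hb))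
    exact not_splitMono_of_mem_radSet hX hrad (𝟙 X) (by simp)

end Kernel

section Paths

variable {V E : Type} {src tgt : E → V}

/-- Every rational function on the arrows is the difference of a function on the vertices. -/
def HasPotentials (src tgt : E → V) : Prop :=
  ∀ w : E → ℚ, ∃ h : V → ℚ, ∀ e, h (src e) - h (tgt e) = w e

theorem QPath.potential_eq {h : V → ℚ} {w : E → ℚ} (hw : ∀ e, h (src e) - h (tgt e) = w e) :
    ∀ {a b : V} (p : QPath src tgt a b), h a - h b = (p.arrows.map w).sum
  | _, _, .nil a => by simp [QPath.arrows]
  | a, _, .cons p α hα => by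
    have := QPath.potential_eq hw p
    have := hw α
    subst hα
    simp [QPath.arrows]
    linarith

theorem QPath.length_arrows : ∀ {a b : V} (p : QPath src tgt a b), p.arrows.length = p.length
  | _, _, .nil a => by rw [QPath.arrows, QPath.length, List.length_nil]
  | a, _, .cons p α hα => by
    simp [QPath.arrows, QPath.length, QPath.length_arrows p]

theorem QPath.potential_length {h : V → ℚ} (hw : ∀ e, h (src e) - h (tgt e) = 1)
    {a b : V} (p : QPath src tgt a b) : h a - h b = p.length := by
  rw [QPath.potential_eq hw p, ← QPath.length_arrows]; simp

theorem QPath.le_of_mem {h : V → ℚ} (hw : ∀ e, h (src e) - h (tgt e) = 1) {α : E} :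
    ∀ {a b : V} (p : QPath src tgt a b), α ∈ p.arrows → h b ≤ h (tgt α)
  | _, _, .nil a, hm => by simp [QPath.arrows] at hm
  | a, _, .cons p β hβ, hm => by
    simp only [QPath.arrows, List.mem_append, List.mem_singleton] at hm
    rcases hm with hm | rfl
    · have := QPath.le_of_mem hw p hm
      have := hw β
      subst hβ
      linarith
    · exact le_rfl

theorem QPath.eq_of_closed (ht : HasPotentials src tgt) {a : V} (p : QPath src tgt a a) :
    p.length = 0 := by
  obtain ⟨h, hw⟩ := ht fun _ => 1
  have := p.potential_length hw
  rw [sub_self] at this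
  exact_mod_cast this.symm

/-- Two parallel paths in a tree end with the same arrow. -/
theorem QPath.last_eq (ht : HasPotentials src tgt) {a : V} {α β : E}
    (p : QPath src tgt a (src α)) (q : QPath src tgt a (src β)) (h : tgt α = tgt β) : α = β := by
  by_contra hne
  obtain ⟨l, hl⟩ := ht fun _ => 1
  obtain ⟨H, hH⟩ := ht fun e => if e = α then 1 else 0
  have h1 : 0 ≤ H a - H (src α) := by
    rw [p.potential_eq hH]
    apply List.sum_nonneg
    simp only [List.mem_map]
    rintro _ ⟨e, -, rfl⟩
    split_ifs <;> norm_num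
  have h2 : α ∉ q.arrows := fun hm => by
    have := QPath.le_of_mem hl q hm
    have := hl β
    rw [h] at *
    linarith
  have h3 : H a - H (src β) = 0 := by
    rw [q.potential_eq hH]
    apply List.sum_eq_zero
    simp only [List.mem_map]
    rintro _ ⟨e, he, rfl⟩
    rw [if_neg]
    rintro rfl
    exact h2 he
  have h4 := hH α
  have h5 := hH β
  rw [if_pos rfl] at h4
  rw [if_neg (Ne.symm hne)] at h5
  rw [h] at h4
  linarith

end Paths

section PathAlgebra

variable {k R V E : Type} [Field k] [Ring R] [Algebra k R] [Fintype V] {src tgt : E → V}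

/-- The product of arrows along a path. -/
def pprod (e : V → R) (x : E → R) : ∀ {a b : V}, QPath src tgt a b → R
  | _, _, .nil a => e a
  | _, _, .cons p α _ => x α * pprod e x p

/-- A complete family of orthogonal idempotents and arrow elements compatible with it. -/
structure IsQuiverSystem (src tgt : E → V) (e : V → R) (x : E → R) : Prop where
  idem : ∀ a, e a * e a = e a
  orth : ∀ a b, a ≠ b → e a * e b = 0
  sum : ∑ a, e a = 1
  left : ∀ α, e (tgt α) * x α = x α
  right : ∀ α, x α * e (src α) = x α

omit [Fintype V] in
theorem pprod_nil (e : V → R) (x : E → R) (a : V) :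
    pprod e x (.nil a : QPath src tgt a a) = e a := by rw [pprod]

omit [Fintype V] in
theorem pprod_cons (e : V → R) (x : E → R) {a b : V} (p : QPath src tgt a b) (α : E)
    (h : src α = b) : pprod e x (p.cons α h) = x α * pprod e x p := by rw [pprod]

namespace IsQuiverSystem

variable {e : V → R} {x : E → R} (S : IsQuiverSystem src tgt e x)

include S

theorem pprod_left {a b : V} (p : QPath src tgt a b) : e b * pprod e x p = pprod e x p := by
  cases p with
  | nil => rw [pprod_nil, S.idem]
  | cons p α h => rw [pprod_cons, ← mul_assoc, S.left]

theorem pprod_right {a b : V} (p : QPath src tgt a b) : pprod e x p * e a = pprod e x p := by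
  induction p with
  | nil => rw [pprod_nil, S.idem]
  | cons p α h ih => rw [pprod_cons, mul_assoc, ih]

omit S in
theorem pprod_closed (ht : HasPotentials src tgt) {a : V} (p : QPath src tgt a a) :
    pprod e x p = e a := by
  have h0 := p.eq_of_closed ht
  have : ∀ {b : V} (p : QPath src tgt a b), p.length = 0 → pprod e x p = e a := by
    intro b p hp
    cases p with
    | nil => rw [pprod_nil]
    | cons p α h => simp [QPath.length] at hp
  exact this p h0

/-- Parallel paths in a tree have the same product. -/
theorem pprod_parallel (ht : HasPotentials src tgt) {a b : V} (p q : QPath src tgt a b) :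
    pprod e x p = pprod e x q := by
  have key : ∀ {b : V} (p : QPath src tgt a b) {b' : V} (q : QPath src tgt a b'), b = b' →
      pprod e x p = pprod e x q := by
    intro b p
    induction p with
    | nil =>
      intro b' q h
      subst h
      rw [pprod_nil, pprod_closed (e := e) (x := x) ht q]
    | cons p α hα ih =>
      intro b' q h
      cases q with
      | nil =>
        subst h
        rw [pprod_nil, pprod_closed (e := e) (x := x) ht _]
      | cons q β hβ =>
        subst hα hβ
        obtain rfl := QPath.last_eq ht p q h
        rw [pprod_cons, pprod_cons, ih q rfl]
  exact key p q rfl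

/-- A non-trivial path starts with an arrow. -/
theorem exists_first {a b : V} (p : QPath src tgt a b) :
    (p.length = 0 ∧ a = b ∧ pprod e x p = e a) ∨ ∃ (β : E) (q : QPath src tgt (tgt β) b),
      src β = a ∧ pprod e x p = pprod e x q * x β ∧ q.length + 1 = p.length := by
  induction p with
  | nil => exact Or.inl ⟨by rw [QPath.length], rfl, by rw [pprod_nil]⟩
  | cons p α hα ih =>
    right
    rcases ih with ⟨hl, rfl, h⟩ | ⟨β, q, hβ, h, hl⟩
    · refine ⟨α, .nil _, hα, ?_, ?_⟩
      · rw [pprod_cons, h, pprod_nil, S.left, ← hα, S.right]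
      · rw [QPath.length, QPath.length, hl]
    · exact ⟨β, .cons q α hα, hβ, by rw [pprod_cons, pprod_cons, h, mul_assoc],
        by simp [QPath.length, hl]⟩

theorem sum_sandwich (y : R) :
    y = ∑ b, ∑ a, e b * y * e a := by
  simp_rw [← Finset.mul_sum, S.sum, mul_one, ← Finset.sum_mul, S.sum, one_mul]

/-- If the system generates, the path products span. -/
theorem span_pprod (hgen : Algebra.adjoin k (Set.range e ∪ Set.range x) = ⊤) (y : R) :
    y ∈ Submodule.span k {z : R | ∃ (a b : V) (p : QPath src tgt a b), pprod e x p = z} := by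
  set N := Submodule.span k {z : R | ∃ (a b : V) (p : QPath src tgt a b), pprod e x p = z}
    with hN
  have hsub : ∀ {a b : V} (p : QPath src tgt a b), pprod e x p ∈ N := fun p =>
    Submodule.subset_span ⟨_, _, p, rfl⟩
  have key : ∀ w ∈ Algebra.adjoin k (Set.range e ∪ Set.range x), ∀ y ∈ N, w * y ∈ N := by
    intro w hw
    induction hw using Algebra.adjoin_induction with
    | mem w hw =>
      intro y hy
      induction hy using Submodule.span_induction with
      | zero => simp
      | add _ _ _ _ h1 h2 => rw [mul_add]; exact N.add_mem h1 h2
      | smul c _ _ h1 => rw [mul_smul_comm]; exact N.smul_mem c h1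
      | mem y hy =>
        obtain ⟨a, b, p, rfl⟩ := hy
        rcases hw with ⟨c, rfl⟩ | ⟨α, rfl⟩
        · by_cases hcb : c = b
          · subst hcb; rw [S.pprod_left]; exact hsub p
          · rw [← S.pprod_left p, ← mul_assoc, S.orth _ _ hcb, zero_mul]; exact N.zero_mem
        · by_cases hcb : src α = b
          · rw [← pprod_cons e x p α hcb]; exact hsub _
          · rw [← S.pprod_left p, ← S.right α, mul_assoc, ← mul_assoc (e (src α)),
              S.orth _ _ hcb, zero_mul, mul_zero]
            exact N.zero_mem
    | algebraMap c =>
      intro y hy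
      rw [← Algebra.smul_def]; exact N.smul_mem c hy
    | add _ _ _ _ h1 h2 => intro y hy; rw [add_mul]; exact N.add_mem (h1 y hy) (h2 y hy)
    | mul _ _ _ _ h1 h2 => intro y hy; rw [mul_assoc]; exact h1 _ (h2 y hy)
  have h1 : (1 : R) ∈ N := by
    rw [← S.sum]
    exact N.sum_mem fun a _ => by rw [← pprod_nil (src := src) (tgt := tgt) e x a]; exact hsub _
  simpa using key y (hgen ▸ Algebra.mem_top) 1 h1

theorem sandwich_pprod_ne {a b c d : V} (p : QPath src tgt a b) (h : ¬ (c = b ∧ d = a)) :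
    e c * pprod e x p * e d = 0 := by
  rw [← S.pprod_left p, ← S.pprod_right p]
  by_cases hc : c = b
  · have hd : d ≠ a := fun hd => h ⟨hc, hd⟩
    rw [mul_assoc, mul_assoc, mul_assoc, S.orth a d (Ne.symm hd)]; simp
  · rw [← mul_assoc, S.orth c b hc]; simp

theorem sandwich_eq_zero (hgen : Algebra.adjoin k (Set.range e ∪ Set.range x) = ⊤)
    {c d : V} (h : IsEmpty (QPath src tgt d c)) (y : R) : e c * y * e d = 0 := by
  have hy := S.span_pprod hgen y
  induction hy using Submodule.span_induction with
  | zero => simp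
  | add _ _ _ _ h1 h2 => rw [mul_add, add_mul, h1, h2, add_zero]
  | smul r _ _ h1 => rw [mul_smul_comm, smul_mul_assoc, h1, smul_zero]
  | mem y hy =>
    obtain ⟨a, b, p, rfl⟩ := hy
    apply S.sandwich_pprod_ne
    rintro ⟨rfl, rfl⟩
    exact h.elim p

theorem exists_sandwich_eq_smul (ht : HasPotentials src tgt)
    (hgen : Algebra.adjoin k (Set.range e ∪ Set.range x) = ⊤)
    {c d : V} (p : QPath src tgt d c) (y : R) : ∃ r : k, e c * y * e d = r • pprod e x p := by
  have hy := S.span_pprod hgen y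
  induction hy using Submodule.span_induction with
  | zero => exact ⟨0, by simp⟩
  | add _ _ _ _ h1 h2 =>
    obtain ⟨r, hr⟩ := h1
    obtain ⟨s, hs⟩ := h2
    exact ⟨r + s, by rw [mul_add, add_mul, hr, hs, add_smul]⟩
  | smul r _ _ h1 =>
    obtain ⟨s, hs⟩ := h1
    exact ⟨r * s, by rw [mul_smul_comm, smul_mul_assoc, hs, mul_smul]⟩
  | mem y hy =>
    obtain ⟨a, b, q, rfl⟩ := hy
    by_cases h : c = b ∧ d = a
    · obtain ⟨rfl, rfl⟩ := h
      exact ⟨1, by rw [S.pprod_left, S.pprod_right, S.pprod_parallel ht p q, one_smul]⟩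
    · exact ⟨0, by rw [S.sandwich_pprod_ne q h, zero_smul]⟩

theorem nonempty_path_of_ne (hgen : Algebra.adjoin k (Set.range e ∪ Set.range x) = ⊤)
    {c d : V} {y : R} (h : e c * y * e d ≠ 0) : Nonempty (QPath src tgt d c) := by
  by_contra hc
  rw [not_nonempty_iff] at hc
  exact h (S.sandwich_eq_zero hgen hc y)

theorem exists_local_scalar (ht : HasPotentials src tgt)
    (hgen : Algebra.adjoin k (Set.range e ∪ Set.range x) = ⊤) (c : V) (y : R) :
    ∃ r : k, e c * y * e c = r • e c := by
  obtain ⟨r, hr⟩ := S.exists_sandwich_eq_smul ht hgen (.nil c) y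
  exact ⟨r, by rw [hr, pprod_nil]⟩

theorem mul_arrow_eq_zero (ht : HasPotentials src tgt)
    (hgen : Algebra.adjoin k (Set.range e ∪ Set.range x) = ⊤) (α : E) (y : R) :
    e (src α) * y * x α = 0 := by
  rw [← S.left, ← mul_assoc, S.sandwich_eq_zero hgen ⟨fun p => ?_⟩, zero_mul]
  obtain ⟨h, hw⟩ := ht fun _ => 1
  have h1 := p.potential_length hw
  have h2 := hw α
  have h3 : (0 : ℚ) ≤ p.length := Nat.cast_nonneg _
  linarith

/-- Left ideals generated by vertices decompose along the arrows starting there. -/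
theorem exists_mul_idem_eq [Fintype E]
    (hgen : Algebra.adjoin k (Set.range e ∪ Set.range x) = ⊤) (c : V) (y : R) :
    ∃ (r : k) (z : E → R), y * e c =
      r • e c + ∑ β ∈ Finset.univ.filter (fun β => src β = c), z β * x β := by
  have hy := S.span_pprod hgen y
  induction hy using Submodule.span_induction with
  | zero => exact ⟨0, 0, by simp⟩
  | add _ _ _ _ h1 h2 =>
    obtain ⟨r, z, hr⟩ := h1
    obtain ⟨s, w, hs⟩ := h2
    refine ⟨r + s, z + w, ?_⟩
    rw [add_mul, hr, hs, add_smul]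
    simp only [Pi.add_apply, add_mul, Finset.sum_add_distrib]
    abel
  | smul r _ _ h1 =>
    obtain ⟨s, z, hs⟩ := h1
    refine ⟨r * s, r • z, ?_⟩
    rw [smul_mul_assoc, hs, smul_add, Finset.smul_sum, mul_smul]
    simp only [Pi.smul_apply, smul_mul_assoc]
  | mem y hy =>
    obtain ⟨a, b, p, rfl⟩ := hy
    by_cases hac : a = c
    · subst hac
      rw [S.pprod_right]
      rcases S.exists_first p with ⟨-, -, h⟩ | ⟨β, q, hβ, h, -⟩
      · exact ⟨1, 0, by simp [h]⟩
      · refine ⟨0, Pi.single β (pprod e x q), ?_⟩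
        rw [Finset.sum_eq_single β]
        · simp [h]
        · intro γ _ hγ
          simp [hγ]
        · intro hn
          simp [hβ] at hn
    · refine ⟨0, 0, ?_⟩
      rw [← S.pprod_right p, mul_assoc, S.orth a c hac]; simp

end IsQuiverSystem

end PathAlgebra

section HereditarySystem

variable {k R V E : Type} [Field k] [Ring R] [Algebra k R] [Fintype V] {src tgt : E → V}

/-- A quiver system over a tree which presents a hereditary algebra. -/
structure IsHerSystem (k : Type) {R V E : Type} [Field k] [Ring R] [Algebra k R] [Fintype V]
    (src tgt : E → V) (e : V → R) (x : E → R) : Prop extends IsQuiverSystem src tgt e x where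
  tree : HasPotentials src tgt
  gen : Algebra.adjoin k (Set.range e ∪ Set.range x) = ⊤
  idem_ne : ∀ a, e a ≠ 0
  arrow_ne : ∀ α, x α ≠ 0
  her : Hereditary R

namespace IsHerSystem

variable {e : V → R} {x : E → R} (S : IsHerSystem k src tgt e x)

include S

theorem right_mul_arrow (β : E) (y : R) (hy : y * x β = 0) : y * e (tgt β) = 0 := by
  let I : Submodule R R := Submodule.span R {x β}
  let f : R →ₗ[R] I := LinearMap.codRestrict I (LinearMap.toSpanSingleton R R (x β)) fun r =>
    Submodule.smul_mem _ r (Submodule.subset_span rfl)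
  have hf : Function.Surjective f := by
    rintro ⟨z, hz⟩
    obtain ⟨r, rfl⟩ := Submodule.mem_span_singleton.1 hz
    exact ⟨r, rfl⟩
  have := S.her I
  obtain ⟨σ, hσ⟩ := Module.projective_lifting_property f LinearMap.id hf
  let b : I := ⟨x β, Submodule.subset_span rfl⟩
  set w := σ b with hw
  have h1 : w * x β = x β := congrArg Subtype.val (LinearMap.congr_fun hσ b)
  have h2 : e (tgt β) * w = w := by
    have : e (tgt β) • b = b := Subtype.ext (S.left β)
    rw [hw, ← smul_eq_mul, ← map_smul, this]
  obtain ⟨r, hr⟩ := S.exists_local_scalar S.tree S.gen (tgt β) w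
  rw [h2] at hr
  have h3 : r = 1 := by
    have : r • x β = x β := by
      conv_rhs => rw [← h1, ← S.left β, ← mul_assoc, hr, smul_mul_assoc, S.left]
    by_contra hne
    apply S.arrow_ne β
    have h4 : (r - 1) • x β = 0 := by rw [sub_smul, this, one_smul, sub_self]
    exact (smul_eq_zero.1 h4).resolve_left (sub_ne_zero.2 hne)
  rw [h3, one_smul] at hr
  have h5 : y * w = 0 := by
    have : y • b = 0 := Subtype.ext hy
    rw [hw, ← smul_eq_mul, ← map_smul, this, map_zero]
  rw [← hr, ← mul_assoc, h5, zero_mul]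

theorem pprod_ne_zero {a b : V} (p : QPath src tgt a b) : pprod e x p ≠ 0 := by
  induction hn : p.length using Nat.strong_induction_on generalizing a with
  | _ n ih =>
    rcases S.exists_first p with ⟨-, -, h⟩ | ⟨β, q, hβ, h, hl⟩
    · rw [h]; exact S.idem_ne a
    · intro h0
      rw [h] at h0
      have := S.right_mul_arrow β _ h0
      rw [S.pprod_right] at this
      exact ih q.length (by omega) q rfl this

theorem left_mul_arrow (α : E) (y : R) (hy : x α * y = 0) : e (src α) * y = 0 := by
  have h1 : e (src α) * y = ∑ a, e (src α) * y * e a := by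
    rw [← Finset.mul_sum, S.sum, mul_one]
  rw [h1]
  refine Finset.sum_eq_zero fun a _ => ?_
  by_contra hne
  obtain ⟨p⟩ := S.nonempty_path_of_ne S.gen hne
  obtain ⟨r, hr⟩ := S.exists_sandwich_eq_smul S.tree S.gen p y
  have h2 : r • pprod e x (p.cons α rfl) = 0 := by
    rw [pprod_cons, ← mul_smul_comm, ← hr, ← mul_assoc, ← mul_assoc, S.right, hy, zero_mul]
  have h3 := (smul_eq_zero.1 h2).resolve_right (S.pprod_ne_zero _)
  rw [h3, zero_smul] at hr
  exact hne hr

end IsHerSystem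

end HereditarySystem

section Projectives

variable {R : Type} [Ring R]

/-- The left ideal generated by an idempotent. -/
def idemIdeal (f : R) : Submodule R R where
  carrier := {y | y * f = y}
  add_mem' := fun {a b} ha hb => by
    change (a + b) * f = a + b
    rw [add_mul, ha, hb]
  zero_mem' := zero_mul f
  smul_mem' := fun r y hy => by
    change r * y * f = r * y
    rw [mul_assoc, hy]

def projObj (f : R) : ModuleCat.{0} R := ModuleCat.of R (idemIdeal f)

/-- The morphism from the projective at an idempotent determined by an element. -/
def projMap (f : R) {Y : ModuleCat.{0} R} (y : Y) : projObj f ⟶ Y :=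
  ModuleCat.ofHom (LinearMap.toSpanSingleton R Y y ∘ₗ (idemIdeal f).subtype)

/-- The underlying ring element of an element of the projective at an idempotent. -/
def projVal (f : R) : projObj f →ₗ[R] R := (idemIdeal f).subtype

/-- An element of the projective at an idempotent. -/
def projMk {f : R} (z : R) (hz : z * f = z) : projObj f := (⟨z, hz⟩ : idemIdeal f)

theorem projVal_mk {f : R} (z : R) (hz : z * f = z) : projVal f (projMk z hz) = z := rfl

theorem projVal_mul {f : R} (y : projObj f) : projVal f y * f = projVal f y :=
  (show idemIdeal f from y).2

theorem projVal_ext {f : R} {y z : projObj f} (h : projVal f y = projVal f z) : y = z :=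
  Subtype.ext h

/-- The generator of the projective at an idempotent. -/
def projGen {f : R} (hf : f * f = f) : projObj f := projMk f hf

theorem projVal_gen {f : R} (hf : f * f = f) : projVal f (projGen hf) = f := rfl

theorem projVal_smul_gen {f : R} (hf : f * f = f) (y : projObj f) :
    projVal f y • projGen hf = y := by
  apply projVal_ext
  rw [map_smul, projVal_gen, smul_eq_mul, projVal_mul]

theorem projMap_gen {f : R} (hf : f * f = f) {Y : ModuleCat.{0} R} (y : Y) :
    (projMap f y).hom (projGen hf) = f • y := rfl

theorem smul_gen {f : R} (hf : f * f = f) : f • projGen hf = projGen hf :=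
  projVal_smul_gen hf (projGen hf)

theorem hom_apply_gen {f : R} (hf : f * f = f) {Y : ModuleCat.{0} R} (g : projObj f ⟶ Y)
    (y : projObj f) : g.hom y = projVal f y • g.hom (projGen hf) := by
  rw [← map_smul, projVal_smul_gen]

theorem hom_ext_gen {f : R} (hf : f * f = f) {Y : ModuleCat.{0} R} {g h : projObj f ⟶ Y}
    (hgh : g.hom (projGen hf) = h.hom (projGen hf)) : g = h := by
  ext y
  rw [hom_apply_gen hf g, hom_apply_gen hf h, hgh]

theorem smul_gen_map {f : R} (hf : f * f = f) {Y : ModuleCat.{0} R} (g : projObj f ⟶ Y) :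
    f • g.hom (projGen hf) = g.hom (projGen hf) := by
  rw [← map_smul, smul_gen]

theorem hom_sum_apply {ι : Type} {X Y : ModuleCat.{0} R} (s : Finset ι) (f : ι → (X ⟶ Y))
    (v : X) : (∑ i ∈ s, f i : X ⟶ Y).hom v = ∑ i ∈ s, (f i).hom v := by
  rw [ModuleCat.hom_sum, LinearMap.sum_apply]

end Projectives

namespace IsHerSystem

variable {k R V E : Type} [Field k] [Ring R] [Algebra k R] [Fintype V] {src tgt : E → V}
  {e : V → R} {x : E → R} (S : IsHerSystem k src tgt e x)

include S

theorem projective_projObj (c : V) : Module.Projective R (projObj (e c)) :=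
  S.her (idemIdeal (e c))

theorem exists_smul_gen (c : V) (w : projObj (e c)) (hw : e c • w = w) :
    ∃ r : k, projVal (e c) w = r • e c := by
  obtain ⟨r, hr⟩ := S.exists_local_scalar S.tree S.gen c (projVal (e c) w)
  rw [mul_assoc, projVal_mul, ← smul_eq_mul, ← map_smul, hw] at hr
  exact ⟨r, hr⟩

theorem finIndec_projObj [IsArtinianRing R] (c : V) : FinIndec R (projObj (e c)) := by
  refine ⟨inferInstanceAs (Module.Finite R (idemIdeal (e c))), ⟨projGen (S.idem c), 0, ?_⟩, ?_⟩
  · intro h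
    have := congrArg (projVal (e c)) h
    rw [map_zero, projVal_gen] at this
    exact S.idem_ne c this
  · intro f hf
    obtain ⟨r, hr⟩ := S.exists_smul_gen c _ (smul_gen_map (S.idem c) f)
    have h4 : r * r = r := by
      have h5 : f.hom (f.hom (projGen (S.idem c))) = f.hom (projGen (S.idem c)) :=
        congrArg (fun q : projObj (e c) ⟶ projObj (e c) => q.hom (projGen (S.idem c))) hf
      rw [hom_apply_gen (S.idem c) f] at h5
      have h6 := congrArg (projVal (e c)) h5
      rw [map_smul, hr, smul_eq_mul, smul_mul_smul_comm, S.idem, ← sub_eq_zero, ← sub_smul] at h6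
      exact sub_eq_zero.1 ((smul_eq_zero.1 h6).resolve_right (S.idem_ne c))
    rcases eq_or_ne r 0 with h0 | h0
    · left
      apply hom_ext_gen (S.idem c)
      apply projVal_ext
      rw [hr, h0, zero_smul]
      exact (map_zero _).symm
    · right
      have h7 : r = 1 := mul_left_cancel₀ h0 (by rw [h4, mul_one])
      apply hom_ext_gen (S.idem c)
      apply projVal_ext
      rw [hr, h7, one_smul]
      rfl

/-- The inclusion of projectives given by right multiplication by an arrow. -/
def arrowMap (x : E → R) (e : V → R) (hx : ∀ α, x α * e (src α) = x α) (β : E) :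
    projObj (e (tgt β)) ⟶ projObj (e (src β)) :=
  projMap (e (tgt β)) (projMk (x β) (hx β))

omit S [Fintype V] in
theorem arrowMap_apply (hx : ∀ α, x α * e (src α) = x α) (β : E) (y : projObj (e (tgt β))) :
    projVal (e (src β)) ((arrowMap (tgt := tgt) x e hx β).hom y) =
      projVal (e (tgt β)) y * x β := rfl

theorem arrowMap_mem_radSet [IsArtinianRing R] (β : E) :
    arrowMap (tgt := tgt) x e S.right β ∈ radSet R _ _ := by
  refine mem_radSet_of_not_splitEpi (S.finIndec_projObj _).2 _ ?_
  rintro ⟨s, hs⟩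
  have h1 : (arrowMap (tgt := tgt) x e S.right β).hom (s.hom (projGen (S.idem (src β)))) =
      projGen (S.idem (src β)) :=
    congrArg (fun q : projObj (e (src β)) ⟶ projObj (e (src β)) =>
      q.hom (projGen (S.idem (src β)))) hs
  have h2 := congrArg (projVal (e (src β))) h1
  rw [arrowMap_apply, projVal_gen] at h2
  have h3 := S.mul_arrow_eq_zero S.tree S.gen β
    (projVal (e (tgt β)) (s.hom (projGen (S.idem (src β)))))
  rw [mul_assoc, h2, S.idem] at h3
  exact S.idem_ne _ h3

/-- Indecomposable projectives are the projectives at the vertices. -/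
theorem exists_iso_projObj [IsArtinianRing R] {Y : ModuleCat.{0} R} (hY : FinIndec R Y)
    (hp : Module.Projective R Y) : ∃ c, Nonempty (projObj (e c) ≅ Y) := by
  by_contra hc
  push Not at hc
  have hrad : ∀ c (f : projObj (e c) ⟶ Y), f ∈ radSet R _ _ := by
    intro c f
    refine mem_radSet_of_not_isIso (S.finIndec_projObj c).2 hY.2 f fun hi => ?_
    exact (hc c).elim (asIso f)
  have := hY.1
  obtain ⟨n, f, hf⟩ := Module.Finite.exists_fin' R Y
  obtain ⟨s, hs⟩ := Module.projective_lifting_property f LinearMap.id hf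
  let F : ModuleCat.{0} R := ModuleCat.of R (Fin n → R)
  let pr : ∀ (c : V), Fin n → (F ⟶ projObj (e c)) := fun c i => ModuleCat.ofHom
    (LinearMap.codRestrict (idemIdeal (e c)) (LinearMap.toSpanSingleton R R (e c) ∘ₗ
      LinearMap.proj i) fun v => by
        change v i * e c * e c = v i * e c
        rw [mul_assoc, S.idem])
  let pm : ∀ (c : V), Fin n → (projObj (e c) ⟶ Y) := fun c i =>
    projMap (e c) (f (Pi.single i 1))
  let ff : F ⟶ Y := ModuleCat.ofHom f
  let gg : Fin n → (F ⟶ Y) := fun i => ∑ c, (show F ⟶ Y from pr c i ≫ pm c i)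
  have hsum : ff = ∑ i, gg i := by
    refine ModuleCat.hom_ext (LinearMap.ext fun v => ?_)
    have h1 : (∑ i, gg i : F ⟶ Y).hom v = ∑ i, ∑ c, (v i * e c) • f (Pi.single i 1) := by
      rw [hom_sum_apply]
      exact Finset.sum_congr rfl fun i _ => hom_sum_apply _ _ _
    rw [h1]
    simp_rw [← Finset.sum_smul, ← Finset.mul_sum, S.sum, mul_one, ← map_smul, ← map_sum]
    change f v = _
    congr 1
    ext j
    simp [Finset.sum_apply, Pi.single_apply]
  have hfr : ff ∈ radSet R F Y := by
    rw [hsum]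
    exact radSet_sum _ _ fun i _ => radSet_sum _ _ fun c _ => radSet_comp_left _ (hrad c _)
  refine not_splitEpi_of_mem_radSet hY hfr (ModuleCat.ofHom s) ?_
  rw [← ModuleCat.ofHom_comp, hs]; rfl

theorem exists_iso_of_hasIrr_projObj [Fintype E] [IsArtinianRing R] {X : ModuleCat.{0} R}
    (hX : FinIndec R X) {c : V} (h : HasIrr X (projObj (e c))) :
    ∃ β, src β = c ∧ Nonempty (X ≅ projObj (e (tgt β))) := by
  obtain ⟨f, hf, hf2⟩ := h
  have hPc := S.finIndec_projObj c
  have hproj := S.projective_projObj c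
  -- the image of `f` misses the generator
  have hgen : ∀ v : X, projVal (e c) (f.hom v) ≠ e c := by
    intro v hv
    refine not_splitEpi_of_mem_radSet hPc hf (projMap (e c) v) ?_
    apply hom_ext_gen (S.idem c)
    apply projVal_ext
    change projVal (e c) (f.hom (e c • v)) = e c
    rw [map_smul, map_smul, hv, smul_eq_mul, S.idem]
  let Bc : Type := {β : E // src β = c}
  let Q : Type := ∀ β : Bc, projObj (e (tgt β.1))
  let mu : Q →ₗ[R] R :=
    ∑ β : Bc, LinearMap.toSpanSingleton R R (x β.1) ∘ₗ projVal (e (tgt β.1)) ∘ₗ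
      LinearMap.proj β
  have hmu : ∀ q : Q, mu q = ∑ β : Bc, projVal (e (tgt β.1)) (q β) * x β.1 := by
    intro q
    simp only [mu, LinearMap.sum_apply]; rfl
  have himg : ∀ v : X, projVal (e c) (f.hom v) ∈ LinearMap.range mu := by
    intro v
    obtain ⟨r, z, hrz⟩ := S.exists_mul_idem_eq S.gen c (projVal (e c) (f.hom v))
    rw [projVal_mul] at hrz
    have hr : r = 0 := by
      by_contra hr
      apply hgen (((algebraMap k R) r⁻¹ * e c) • v)
      rw [map_smul, map_smul, smul_eq_mul]
      rw [hrz, mul_assoc, mul_add, Finset.mul_sum, Finset.sum_eq_zero, add_zero, mul_smul_comm,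
        S.idem, ← Algebra.smul_def, ← mul_smul, inv_mul_cancel₀ hr, one_smul]
      intro β hβ
      obtain rfl := (Finset.mem_filter.1 hβ).2
      rw [← mul_assoc]
      exact S.mul_arrow_eq_zero S.tree S.gen β _
    refine ⟨fun β => projMk (z β.1 * e (tgt β.1)) ?_, ?_⟩
    · rw [mul_assoc, S.idem]
    · rw [hmu, hrz, hr, zero_smul, zero_add]
      simp only [projVal_mk, mul_assoc, S.left]
      exact (Finset.sum_subtype (Finset.univ.filter fun β => src β = c) (by simp)
        (fun β => z β * x β)).symm
  -- the source of `f` is projective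
  have hXp : Module.Projective R X := by
    let g : X →ₗ[R] R := projVal (e c) ∘ₗ f.hom
    let I : Submodule R R := LinearMap.range g
    have hI := S.her I
    obtain ⟨s, hs⟩ := Module.projective_lifting_property g.rangeRestrict LinearMap.id
      g.surjective_rangeRestrict
    let u : X ⟶ X := ModuleCat.ofHom (s ∘ₗ g.rangeRestrict)
    have hu : u ≫ u = u := by
      ext v
      exact congrArg s (LinearMap.congr_fun hs (g.rangeRestrict v))
    rcases hX.2.2 u hu with h0 | h1
    · exfalso
      apply hf2
      have : f = 0 := by
        ext v
        apply projVal_ext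
        have h3 : s (g.rangeRestrict v) = 0 := congrArg (fun q : X ⟶ X => q.hom v) h0
        have h4 := LinearMap.congr_fun hs (g.rangeRestrict v)
        change g.rangeRestrict (s (g.rangeRestrict v)) = g.rangeRestrict v at h4
        rw [h3, map_zero] at h4
        exact ((congrArg Subtype.val h4).symm.trans (map_zero (projVal (e c))).symm)
      rw [this]; exact zero_mem_radPowSet _ _ _
    · exact Module.Projective.of_split g.rangeRestrict s (congrArg (fun q : X ⟶ X => q.hom) h1)
  obtain ⟨t, ht⟩ := Module.projective_lifting_property mu.rangeRestrict
    (LinearMap.codRestrict (LinearMap.range mu) (projVal (e c) ∘ₗ f.hom) himg)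
    mu.surjective_rangeRestrict
  have ht' : ∀ v, projVal (e c) (f.hom v) =
      ∑ β : Bc, projVal (e (tgt β.1)) (t v β) * x β.1 := by
    intro v
    rw [← hmu]
    exact (congrArg Subtype.val (LinearMap.congr_fun ht v)).symm
  let tc : ∀ β : Bc, X ⟶ projObj (e (tgt β.1)) := fun β => ModuleCat.ofHom (LinearMap.proj β ∘ₗ t)
  have hxc : ∀ β : Bc, x β.1 * e c = x β.1 := by
    rintro ⟨β, rfl⟩
    exact S.right β
  let am : ∀ β : Bc, projObj (e (tgt β.1)) ⟶ projObj (e c) := fun β =>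
    projMap _ (projMk (x β.1) (hxc β))
  have ham : ∀ β, am β ∈ radSet R _ _ := by
    rintro ⟨β, rfl⟩
    exact S.arrowMap_mem_radSet β
  let gg : Bc → (X ⟶ projObj (e c)) := fun β => tc β ≫ am β
  have hfs : f = ∑ β, gg β := by
    ext v
    apply projVal_ext
    rw [ht']
    have h1 : (∑ β, gg β : X ⟶ projObj (e c)).hom v = ∑ β, (am β).hom ((tc β).hom v) :=
      hom_sum_apply _ _ _
    have h2 := congrArg (projVal (e c)) h1
    rw [map_sum] at h2
    exact h2.symm
  have hex : ∃ β, tc β ∉ radSet R _ _ := by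
    by_contra hcon
    push Not at hcon
    apply hf2
    rw [hfs]
    exact radPowSet_sum _ _ fun β _ =>
      mem_radPowSet_two (S.finIndec_projObj _).1 hPc.1 (hcon β) (ham β)
  obtain ⟨β, hβ⟩ := hex
  have hiso : IsIso (tc β) := by
    by_contra hn
    exact hβ (mem_radSet_of_not_isIso hX.2 (S.finIndec_projObj _).2 _ hn)
  exact ⟨β.1, β.2, ⟨asIso (tc β)⟩⟩

end IsHerSystem

section LengthFunction

/-- A translation quiver generated by its projective vertices, on which the arrows into projectives
are graded by `h`, carries a grading. -/
theorem exists_grading {J : Type*} (Irr : J → J → Prop) (Pr : J → Prop) (τ : J → J) (h : J → ℚ)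
    (ha : ∀ x y, ¬ Pr y → Irr x y → Irr (τ y) x)
    (hb : ∀ x y, Pr y → Irr x y → Pr x ∧ h y = h x + 1)
    (hc : ∀ y, ∃ p, Pr p ∧ Relation.ReflTransGen Irr p y) :
    ∃ l : J → ℚ, (∀ p, Pr p → l p = h p) ∧ ∀ x y, Irr x y → l y = l x + 1 := by
  have hreach : ∀ y, ∃ n, Pr (τ^[n] y) := by
    intro y
    by_contra hy
    push Not at hy
    obtain ⟨p, hp, hpy⟩ := hc y
    refine Relation.ReflTransGen.head_induction_on (motive := fun q _ => ∀ n, ¬ Pr (τ^[n] q))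
      hpy hy (fun {a b} hab _ hb' => ?_) 0 hp
    have key : ∀ n, Irr (τ^[n] a) (τ^[n] b) ∧ ¬ Pr (τ^[n] a) := by
      have step : ∀ n, Irr (τ^[n] a) (τ^[n] b) →
          Irr (τ^[n + 1] b) (τ^[n] a) ∧ ¬ Pr (τ^[n] a) := by
        intro n hn
        have h1 := ha _ _ (hb' n) hn
        rw [← Function.iterate_succ_apply' τ n b] at h1
        exact ⟨h1, fun hpr => hb' (n + 1) (hb _ _ hpr h1).1⟩
      intro n
      induction n with
      | zero => exact ⟨hab, (step 0 hab).2⟩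
      | succ n ih =>
        obtain ⟨h1, h2⟩ := step n ih.1
        have h3 := ha _ _ h2 h1
        rw [← Function.iterate_succ_apply' τ n a] at h3
        exact ⟨h3, (step (n + 1) h3).2⟩
    exact fun n => (key n).2
  let N : J → ℕ := fun y => Nat.find (hreach y)
  have hN0 : ∀ y, Pr y → N y = 0 := fun y hy => (Nat.find_eq_zero _).2 hy
  have hNs : ∀ y, ¬ Pr y → N y = N (τ y) + 1 := by
    intro y hy
    exact Nat.find_comp_succ (hreach y) (hreach (τ y)) hy
  let l : J → ℚ := fun y => h (τ^[N y] y) + 2 * N y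
  have hlp : ∀ p, Pr p → l p = h p := by
    intro p hp
    simp only [l, hN0 p hp]
    simp
  have hlt : ∀ y, ¬ Pr y → l y = l (τ y) + 2 := by
    intro y hy
    simp only [l, hNs y hy, Function.iterate_succ_apply]
    push_cast
    ring
  refine ⟨l, hlp, ?_⟩
  have main : ∀ n x y, N x + N y = n → Irr x y → l y = l x + 1 := by
    intro n
    induction n using Nat.strong_induction_on with
    | _ n ih =>
      intro x y hn hxy
      by_cases hy : Pr y
      · obtain ⟨hx, hh⟩ := hb x y hy hxy
        rw [hlp y hy, hlp x hx, hh]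
      · have h1 := hNs y hy
        have h2 := ih (N (τ y) + N x) (by omega) _ _ rfl (ha _ _ hy hxy)
        rw [hlt y hy, h2]
        ring
  exact fun x y => main _ x y rfl

theorem HasIrr.iso_right {R : Type} [Ring R] {X Y Z : ModuleCat.{0} R} (h : HasIrr X Y)
    (i : Y ≅ Z) : HasIrr X Z := by
  obtain ⟨f, hf, hf2⟩ := h
  refine ⟨f ≫ i.hom, radSet_comp_right hf _, fun h2 => hf2 ?_⟩
  have := radPowSet_comp_right h2 i.inv
  rwa [Category.assoc, i.hom_inv_id, Category.comp_id] at this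

/-- Chains of irreducible morphisms are isomorphisms or genuine chains. -/
theorem IrrChain.iso_or {R : Type} [Ring R] {n : ℕ} {X Y : ModuleCat.{0} R}
    (c : IrrChain n X Y) (hX : FinIndec R X) (hY : FinIndec R Y) : Nonempty (X ≅ Y) ∨
      Relation.ReflTransGen (fun a b : {M : ModuleCat.{0} R // FinIndec R M} => HasIrr a.1 b.1)
        ⟨X, hX⟩ ⟨Y, hY⟩ := by
  induction c with
  | iso h => exact Or.inl h
  | cons hX' hY' h c ih =>
    right
    rcases ih hY' hY with ⟨⟨i⟩⟩ | h'
    · exact Relation.ReflTransGen.single (h.iso_right i)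
    · exact Relation.ReflTransGen.head (b := ⟨_, hY'⟩) h h'

variable {k R V E : Type} [Field k] [Ring R] [Algebra k R] [Fintype V] {src tgt : E → V}
  {e : V → R} {x : E → R}

namespace IsHerSystem

theorem exists_idem_smul_ne (S : IsHerSystem k src tgt e x) {Y : ModuleCat.{0} R}
    (y : Y) (hy : y ≠ 0) : ∃ c, e c • y ≠ 0 := by
  by_contra h
  push Not at h
  apply hy
  rw [← one_smul R y, ← S.sum, Finset.sum_smul]
  exact Finset.sum_eq_zero fun c _ => h c

theorem iso_projObj_eq (S : IsHerSystem k src tgt e x) {c d : V}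
    (i : projObj (e c) ≅ projObj (e d)) {h : V → ℚ} (hh : ∀ a, h (src a) - h (tgt a) = 1) :
    h c = h d := by
  have key : ∀ c d, Nonempty (projObj (e c) ≅ projObj (e d)) → h c ≤ h d := by
    rintro c d ⟨i⟩
    have h1 : e c * projVal (e d) (i.hom.hom (projGen (S.idem c))) * e d ≠ 0 := by
      rw [mul_assoc, projVal_mul, ← smul_eq_mul, ← map_smul, smul_gen_map]
      intro h0
      have h2 : i.hom.hom (projGen (S.idem c)) = 0 := projVal_ext (h0.trans (map_zero _).symm)
      have h3 : projGen (S.idem c) = 0 := by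
        have h4 := congrArg (fun q : projObj (e c) ⟶ projObj (e c) => q.hom (projGen (S.idem c)))
          i.hom_inv_id
        change i.inv.hom (i.hom.hom (projGen (S.idem c))) = projGen (S.idem c) at h4
        rw [← h4, h2, map_zero]
      have h5 := congrArg (projVal (e c)) h3
      rw [projVal_gen, map_zero] at h5
      exact S.idem_ne c h5
    obtain ⟨p⟩ := S.nonempty_path_of_ne S.gen h1
    have h6 := p.potential_length hh
    have h7 : (0 : ℚ) ≤ p.length := Nat.cast_nonneg _
    linarith
  exact le_antisymm (key c d ⟨i⟩) (key d c ⟨i.symm⟩)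

/-- The Auslander-Reiten quiver of a representation finite tree algebra which is hereditary is
graded, with the projectives graded by distance. -/
theorem exists_length [Fintype E] [FiniteDimensional k R] (S : IsHerSystem k src tgt e x)
    (hrf : RepFinite R) {r : ℕ} (hr : RadVanishes R r) :
    ∃ l : ModuleCat.{0} R → ℚ,
      (∀ X Y, FinIndec R X → FinIndec R Y → HasIrr X Y → l Y = l X + 1) ∧
      (∀ X Y, FinIndec R X → FinIndec R Y → Nonempty (X ≅ Y) → l X = l Y) ∧
      ∀ β, l (projObj (e (src β))) = l (projObj (e (tgt β))) + 1 := by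
  have := IsArtinianRing.of_finite k R
  obtain ⟨h, hh⟩ := S.tree fun _ => 1
  let J := {M : ModuleCat.{0} R // FinIndec R M}
  let Pr : J → Prop := fun y => Module.Projective R y.1
  let Irr : J → J → Prop := fun y z => HasIrr y.1 z.1
  have hne : ∀ y : J, ∃ d, ∃ v : y.1, e d • v ≠ 0 := by
    intro y
    have := y.2.2.1
    obtain ⟨v, hv⟩ := exists_ne (0 : y.1)
    obtain ⟨d, hd⟩ := S.exists_idem_smul_ne v hv
    exact ⟨d, v, hd⟩
  have hexc : ∀ y : J, ∃ d, Pr y → Nonempty (projObj (e d) ≅ y.1) := by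
    intro y
    by_cases hy : Pr y
    · exact (S.exists_iso_projObj y.2 hy).imp fun _ h _ => h
    · exact (hne y).imp fun _ _ h => absurd h hy
  have hext : ∀ y : J, ∃ K : J, ¬ Pr y → ∀ z, Irr z y → Irr K z := by
    intro y
    by_cases hy : Pr y
    · exact ⟨y, fun h => absurd hy h⟩
    · obtain ⟨K, hK, h'⟩ := exists_translate k hrf y.2 hy
      exact ⟨⟨K, hK⟩, fun _ z hz => h' z.1 z.2 hz⟩
  choose c hc using hexc
  choose τ hτ using hext
  have hcd : ∀ (y : J) (hy : Pr y) (d : V), Nonempty (projObj (e d) ≅ y.1) → h (c y) = h d := by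
    rintro y hy d ⟨i⟩
    obtain ⟨j⟩ := hc y hy
    exact S.iso_projObj_eq (j ≪≫ i.symm) hh
  have hproj : ∀ (X Y : ModuleCat.{0} R), Nonempty (X ≅ Y) → Module.Projective R X →
      Module.Projective R Y := fun X Y ⟨i⟩ h => Module.Projective.of_equiv i.toLinearEquiv
  have hirr : ∀ y, ∃ p, Pr p ∧ Relation.ReflTransGen Irr p y := by
    intro y
    obtain ⟨d, v, hd⟩ := hne y
    have := y.2.1
    have := (S.finIndec_projObj d).1
    obtain ⟨n, -, -, h1, h2⟩ := exists_depth hr (f := projMap (e d) v) (m := 0) (fun h0 => hd (by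
      rw [← projMap_gen (S.idem d), h0]; rfl)) trivial
    rcases (irrChain_of_mem (S.finIndec_projObj d) y.2 h1 h2).iso_or (S.finIndec_projObj d) y.2
      with hi | hi
    · exact ⟨y, hproj _ _ hi (S.projective_projObj d), .refl⟩
    · exact ⟨_, S.projective_projObj d, hi⟩
  have hb : ∀ y z, Pr z → Irr y z → Pr y ∧ h (c z) = h (c y) + 1 := by
    intro y z hz hyz
    obtain ⟨i⟩ := hc z hz
    obtain ⟨β, hβ, ⟨j⟩⟩ := S.exists_iso_of_hasIrr_projObj y.2 (hyz.iso_right i.symm)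
    have hy : Pr y := hproj _ _ ⟨j.symm⟩ (S.projective_projObj _)
    refine ⟨hy, ?_⟩
    rw [hcd y hy _ ⟨j.symm⟩, ← hβ, ← hh β]
    ring
  obtain ⟨l, hl1, hl2⟩ := exists_grading Irr Pr τ (fun y => h (c y))
    (fun y z hz hyz => hτ z hz y hyz) hb hirr
  have hlproj : ∀ d, l ⟨projObj (e d), S.finIndec_projObj d⟩ = h d := by
    intro d
    rw [hl1 _ (S.projective_projObj d)]
    exact hcd _ (S.projective_projObj d) d ⟨Iso.refl _⟩
  refine ⟨fun M => if hM : FinIndec R M then l ⟨M, hM⟩ else 0, ?_, ?_, ?_⟩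
  · intro X Y hX hY hXY
    simp only [hX, hY, dite_true]
    exact hl2 ⟨X, hX⟩ ⟨Y, hY⟩ hXY
  · intro X Y hX hY hXY
    simp only [hX, hY, dite_true]
    obtain ⟨i⟩ := hXY
    obtain ⟨p, hp, hpX⟩ := hirr ⟨X, hX⟩
    rcases Relation.ReflTransGen.cases_tail hpX with h0 | ⟨z, -, hz⟩
    · obtain ⟨j⟩ := hc _ hp
      subst h0
      have hY' : Pr ⟨Y, hY⟩ := hproj _ _ ⟨i⟩ hp
      rw [hl1 _ hp, hl1 _ hY']
      exact (hcd ⟨Y, hY⟩ hY' _ ⟨j ≪≫ i⟩).symm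
    · rw [hl2 _ _ hz, hl2 z ⟨Y, hY⟩ (hz.iso_right i)]
  · intro β
    simp only [S.finIndec_projObj, dite_true, hlproj]
    rw [← hh β]
    ring

end IsHerSystem

end LengthFunction

section Injectives

open scoped ModuleCat

variable (k : Type) {R : Type} [Field k] [Ring R] [Algebra k R]

/-- The functionals on the right ideal generated by an idempotent. -/
def dualIdem (f : R) : Submodule k (R →ₗ[k] k) where
  carrier := {ξ | ∀ x, ξ (f * x) = ξ x}
  add_mem' := fun {a b} ha hb x => by
    rw [LinearMap.add_apply, LinearMap.add_apply, ha, hb]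
  zero_mem' := fun _ => rfl
  smul_mem' := fun r y hy x => by
    rw [LinearMap.smul_apply, LinearMap.smul_apply, hy]

instance dualIdemModule (f : R) : Module R (dualIdem k f) where
  smul b ξ := ⟨ξ.1 ∘ₗ LinearMap.mulRight k b, fun x => by
    change ξ.1 (f * x * b) = ξ.1 (x * b)
    rw [mul_assoc, ξ.2]⟩
  one_smul ξ := Subtype.ext (LinearMap.ext fun x => congrArg ξ.1 (mul_one x))
  mul_smul a b ξ := Subtype.ext (LinearMap.ext fun x => congrArg ξ.1 (mul_assoc x a b).symm)
  smul_zero a := Subtype.ext (LinearMap.ext fun x => rfl)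
  smul_add a ξ η := Subtype.ext (LinearMap.ext fun x => rfl)
  add_smul a b ξ := Subtype.ext (LinearMap.ext fun x =>
    (congrArg ξ.1 (mul_add x a b)).trans (map_add _ _ _))
  zero_smul ξ := Subtype.ext (LinearMap.ext fun x =>
    (congrArg ξ.1 (mul_zero x)).trans (map_zero _))

/-- The injective module at an idempotent. -/
def injObj (f : R) : ModuleCat.{0} R := ModuleCat.of R (dualIdem k f)

variable {k}

/-- The functional underlying an element of the injective module at an idempotent. -/
def injVal {f : R} (ξ : injObj k f) : R →ₗ[k] k := (show dualIdem k f from ξ).1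

/-- An element of the injective module at an idempotent. -/
def injMk {f : R} (ξ : R →ₗ[k] k) (h : ∀ x, ξ (f * x) = ξ x) : injObj k f :=
  (⟨ξ, h⟩ : dualIdem k f)

theorem injVal_mul {f : R} (ξ : injObj k f) (x : R) : injVal ξ (f * x) = injVal ξ x :=
  (show dualIdem k f from ξ).2 x

theorem injVal_ext {f : R} {ξ η : injObj k f} (h : ∀ x, injVal ξ x = injVal η x) : ξ = η :=
  Subtype.ext (LinearMap.ext h)

theorem injVal_smul {f : R} (b : R) (ξ : injObj k f) (x : R) :
    injVal (b • ξ) x = injVal ξ (x * b) := rfl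

theorem injVal_zero {f : R} (x : R) : injVal (0 : injObj k f) x = 0 := rfl

theorem finite_injObj [FiniteDimensional k R] (f : R) : Module.Finite R (injObj k f) := by
  have : IsScalarTower k R (dualIdem k f) := ⟨fun r b ξ => Subtype.ext (LinearMap.ext fun x => by
    change ξ.1 (x * r • b) = r • ξ.1 (x * b)
    rw [mul_smul_comm, map_smul])⟩
  have : Module.Finite k (dualIdem k f) := inferInstance
  exact Module.Finite.of_restrictScalars_finite k R (dualIdem k f)

/-- The morphism to the injective at an idempotent determined by a functional. -/
def injMap {f : R} (hf : f * f = f) {X : ModuleCat.{0} R} (φ : X →ₗ[k] k) : X ⟶ injObj k f :=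
  ModuleCat.ofHom
    { toFun := fun v => injMk
        { toFun := fun b => φ ((f * b) • v)
          map_add' := fun a b => by rw [mul_add, add_smul, map_add]
          map_smul' := fun r b => by
            rw [mul_smul_comm, smul_assoc, map_smul, RingHom.id_apply] } fun x => by
              change φ ((f * (f * x)) • v) = φ ((f * x) • v)
              rw [← mul_assoc, hf]
      map_add' := fun v w => injVal_ext fun x => by
        change φ ((f * x) • (v + w)) = φ ((f * x) • v) + φ ((f * x) • w)
        rw [smul_add, map_add]
      map_smul' := fun b v => injVal_ext fun x => by
        change φ ((f * x) • b • v) = φ ((f * (x * b)) • v)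
        rw [← mul_smul, mul_assoc] }

theorem injMap_apply {f : R} (hf : f * f = f) {X : ModuleCat.{0} R} (φ : X →ₗ[k] k) (v : X)
    (b : R) : injVal ((injMap hf φ).hom v) b = φ ((f * b) • v) := rfl

theorem exists_injMap_ne {f : R} (hf : f * f = f) {X : ModuleCat.{0} R} {v : X}
    (hv : f • v ≠ 0) : ∃ q : X ⟶ injObj k f, q.hom (f • v) ≠ 0 := by
  obtain ⟨φ, hφ⟩ : ∃ φ : X →ₗ[k] k, φ (f • v) ≠ 0 := by
    by_contra h
    push Not at h
    exact hv ((Module.forall_dual_apply_eq_zero_iff k (f • v)).1 h)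
  refine ⟨injMap hf φ, fun h0 => hφ ?_⟩
  have h1 := injMap_apply hf φ (f • v) 1
  rw [h0, injVal_zero, mul_one, ← mul_smul, hf] at h1
  exact h1.symm

theorem exists_retraction {f : R} (hf : f * f = f) {M : ModuleCat.{0} R} (u : injObj k f ⟶ M)
    (hu : Function.Injective u.hom) : ∃ s : M ⟶ injObj k f, u ≫ s = 𝟙 _ := by
  let u' : injObj k f →ₗ[k] M := u.hom.restrictScalars k
  obtain ⟨g, hg⟩ := LinearMap.exists_leftInverse_of_injective u' (LinearMap.ker_eq_bot.2 hu)
  let ψ : injObj k f →ₗ[k] k :=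
    { toFun := fun ξ => injVal ξ f
      map_add' := fun ξ η => rfl
      map_smul' := fun r ξ => by
        change injVal ((algebraMap k R r) • ξ) f = r • injVal ξ f
        rw [injVal_smul, ← Algebra.commutes, ← Algebra.smul_def, map_smul] }
  refine ⟨injMap hf (ψ ∘ₗ g), ?_⟩
  ext ξ
  refine injVal_ext fun b => ?_
  change ψ (g ((f * b) • u.hom ξ)) = injVal ξ b
  rw [← map_smul]
  have : g (u' ((f * b) • ξ)) = (f * b) • ξ := LinearMap.congr_fun hg _
  change ψ (g (u' ((f * b) • ξ))) = _
  rw [this]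
  change injVal ((f * b) • ξ) f = _
  rw [injVal_smul, injVal_mul, injVal_mul]

end Injectives

section HereditaryInjectives

variable {k R V E : Type} [Field k] [Ring R] [Algebra k R] [Fintype V] {src tgt : E → V}
  {e : V → R} {x : E → R}

namespace IsHerSystem

theorem arrow_mul_eq_zero (S : IsHerSystem k src tgt e x) (α : E) (y : R) :
    x α * y * e (tgt α) = 0 := by
  rw [← S.right, mul_assoc, mul_assoc, ← mul_assoc (e _), S.sandwich_eq_zero S.gen ⟨fun p => ?_⟩,
    mul_zero]
  obtain ⟨h, hw⟩ := S.tree fun _ => 1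
  have h1 := p.potential_length hw
  have h2 := hw α
  have h3 : (0 : ℚ) ≤ p.length := Nat.cast_nonneg _
  linarith

omit [Fintype V] in
theorem injVal_algebraMap {f : R} (r : k) (ξ : injObj k f) (y : R) :
    injVal (algebraMap k R r • ξ) y = r * injVal ξ y := by
  rw [injVal_smul, ← Algebra.commutes, ← Algebra.smul_def, map_smul, smul_eq_mul]

theorem exists_socle (S : IsHerSystem k src tgt e x) (c : V) : ∃ ω : injObj k (e c),
    ∀ y, e c * y * e c = injVal ω y • e c := by
  obtain ⟨φ, hφ⟩ := Module.Projective.exists_dual_eq_one k (S.idem_ne c)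
  have h1 : ∀ y, e c * y * e c = φ (e c * y * e c) • e c := by
    intro y
    obtain ⟨r, hr⟩ := S.exists_local_scalar S.tree S.gen c y
    rw [hr, map_smul, hφ, smul_eq_mul, mul_one]
  refine ⟨injMk (φ ∘ₗ LinearMap.mulRight k (e c) ∘ₗ LinearMap.mulLeft k (e c)) fun y => ?_, h1⟩
  change φ (e c * (e c * y) * e c) = φ (e c * y * e c)
  rw [← mul_assoc (e c), S.idem]

section Socle

variable (S : IsHerSystem k src tgt e x) {c : V} {ω : injObj k (e c)}
  (hω : ∀ y, e c * y * e c = injVal ω y • e c)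

include S hω

theorem injVal_socle_idem : injVal ω (e c) = 1 := by
  have h1 := hω (e c)
  rw [S.idem, S.idem] at h1
  by_contra hne
  have h2 : (injVal ω (e c) - 1) • e c = 0 := by rw [sub_smul, ← h1, one_smul, sub_self]
  exact S.idem_ne c ((smul_eq_zero.1 h2).resolve_left (sub_ne_zero.2 hne))

theorem socle_ne_zero : ω ≠ 0 := by
  intro h
  have h1 := S.injVal_socle_idem hω
  rw [h, injVal_zero] at h1
  exact zero_ne_one h1

omit S [Fintype V] in
theorem smul_eq_socle (ξ : injObj k (e c)) (y : R) :
    (e c * y) • ξ = algebraMap k R (injVal ξ y) • ω := by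
  refine injVal_ext fun z => ?_
  rw [injVal_algebraMap, injVal_smul, ← injVal_mul, ← mul_assoc, ← mul_assoc, hω,
    smul_mul_assoc, map_smul, injVal_mul, smul_eq_mul, mul_comm]

omit S [Fintype V] in
theorem injective_of_socle {M : ModuleCat.{0} R} (g : injObj k (e c) ⟶ M)
    (hg : g.hom ω ≠ 0) : Function.Injective g.hom := by
  rw [← LinearMap.ker_eq_bot, LinearMap.ker_eq_bot']
  intro ξ hξ
  refine injVal_ext fun y => ?_
  rw [injVal_zero]
  by_contra hne
  apply hg
  have h1 : g.hom ((e c * y) • ξ) = 0 := by rw [map_smul, hξ, smul_zero]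
  rw [smul_eq_socle hω] at h1
  have h2 : ω = algebraMap k R (injVal ξ y)⁻¹ • algebraMap k R (injVal ξ y) • ω := by
    rw [← mul_smul, ← map_mul, inv_mul_cancel₀ hne, map_one, one_smul]
  rw [h2, map_smul, h1, smul_zero]

theorem finIndec_injObj' [FiniteDimensional k R] : FinIndec R (injObj k (e c)) := by
  refine ⟨finite_injObj (e c), ⟨ω, 0, S.socle_ne_zero hω⟩, fun f hf => ?_⟩
  by_cases h : f.hom ω = 0
  · left
    have h1 : (𝟙 _ - f).hom ω = ω := by
      change ω - f.hom ω = ω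
      rw [h, sub_zero]
    have hinj := injective_of_socle hω (𝟙 _ - f) (by rw [h1]; exact S.socle_ne_zero hω)
    have h2 : f ≫ (𝟙 _ - f) = 0 := by
      rw [Preadditive.comp_sub, hf, Category.comp_id, sub_self]
    ext ξ
    apply hinj
    exact (congrArg (fun q : injObj k (e c) ⟶ injObj k (e c) => q.hom ξ) h2).trans
      (map_zero _).symm
  · right
    ext ξ
    apply injective_of_socle hω f h
    exact congrArg (fun q : injObj k (e c) ⟶ injObj k (e c) => q.hom ξ) hf

end Socle

theorem finIndec_injObj [FiniteDimensional k R] (S : IsHerSystem k src tgt e x) (c : V) :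
    FinIndec R (injObj k (e c)) :=
  (S.exists_socle c).elim fun _ h => S.finIndec_injObj' h

/-- The morphism between injectives given by left multiplication by an arrow. -/
def coarrowMap (k : Type) {R V E : Type} [Field k] [Ring R] [Algebra k R] {src tgt : E → V}
    (x : E → R) (e : V → R) (hx : ∀ α, x α * e (src α) = x α) (α : E) :
    injObj k (e (tgt α)) ⟶ injObj k (e (src α)) :=
  ModuleCat.ofHom
    { toFun := fun ξ => injMk (injVal ξ ∘ₗ LinearMap.mulLeft k (x α)) fun y => by
        change injVal ξ (x α * (e (src α) * y)) = injVal ξ (x α * y)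
        rw [← mul_assoc, hx]
      map_add' := fun ξ η => rfl
      map_smul' := fun b ξ => injVal_ext fun y => by
        change injVal ξ (x α * y * b) = injVal ξ (x α * (y * b))
        rw [mul_assoc] }

omit [Fintype V] in
theorem coarrowMap_apply (hx : ∀ α, x α * e (src α) = x α) (α : E) (ξ : injObj k (e (tgt α)))
    (y : R) : injVal ((coarrowMap k x e hx α).hom ξ) y = injVal ξ (x α * y) := rfl

section Coarrow

variable (S : IsHerSystem k src tgt e x) (α : E)

include S

/-- A functional vanishing on the ideal generated by the arrows ending at a vertex. -/
theorem eq_socle_of_arrows {c : V} {ω : injObj k (e c)}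
    (hω : ∀ y, e c * y * e c = injVal ω y • e c) (ξ : injObj k (e c))
    (hξ : ∀ β, tgt β = c → ∀ y, injVal ξ (x β * y) = 0) :
    ξ = algebraMap k R (injVal ξ (e c)) • ω := by
  refine injVal_ext fun y => ?_
  have h0 : ∀ a, a ≠ c → injVal ξ (e c * y * e a) = 0 := by
    intro a ha
    by_contra hne
    have h1 : e c * y * e a ≠ 0 := fun h => hne (by rw [h, map_zero])
    obtain ⟨p⟩ := S.nonempty_path_of_ne S.gen h1
    obtain ⟨r, hr⟩ := S.exists_sandwich_eq_smul S.tree S.gen p y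
    apply hne
    rw [hr, map_smul]
    cases p with
    | nil => exact absurd rfl ha
    | cons q β h => rw [pprod_cons, hξ β rfl, smul_zero]
  have h1 : e c * y = ∑ a, e c * y * e a := by rw [← Finset.mul_sum, S.sum, mul_one]
  rw [injVal_algebraMap, ← injVal_mul, h1, map_sum, Finset.sum_eq_single c (fun a _ => h0 a)
    (fun h => absurd (Finset.mem_univ c) h), hω, map_smul, smul_eq_mul, mul_comm]

/-- Functionals extend along an arrow, by zero on the other arrows. -/
theorem exists_coarrow_preimage (η : injObj k (e (src α))) : ∃ ξ : injObj k (e (tgt α)),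
    (coarrowMap k x e S.right α).hom ξ = η ∧
    ∀ β, tgt β = tgt α → β ≠ α → ∀ y, injVal ξ (x β * y) = 0 := by
  let T : Finset V := Finset.univ.filter fun a => ∃ y, x α * y * e a ≠ 0
  let eα : R := ∑ a ∈ T, e a
  let f := LinearMap.mulLeft k (x α)
  let g := LinearMap.mulLeft k (e (src α))
  obtain ⟨L, hL⟩ : ∃ L : R →ₗ[k] R, L ∘ₗ f = g := by
    have hker : LinearMap.ker f ≤ LinearMap.ker g := fun y hy => S.left_mul_arrow α y hy
    obtain ⟨s, hs⟩ := LinearMap.exists_rightInverse_of_surjective f.rangeRestrict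
      (LinearMap.range_eq_top.2 f.surjective_rangeRestrict)
    obtain ⟨t, ht⟩ := LinearMap.exists_leftInverse_of_injective (LinearMap.range f).subtype
      (Submodule.ker_subtype _)
    refine ⟨g ∘ₗ s ∘ₗ t, LinearMap.ext fun y => ?_⟩
    have h1 : t (f y) = f.rangeRestrict y := LinearMap.congr_fun ht (f.rangeRestrict y)
    change g (s (t (f y))) = g y
    rw [h1, ← sub_eq_zero, ← map_sub]
    apply hker
    rw [LinearMap.mem_ker, map_sub, sub_eq_zero]
    exact congrArg Subtype.val (LinearMap.congr_fun hs (f.rangeRestrict y))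
  let ξ : injObj k (e (tgt α)) :=
    injMk (injVal η ∘ₗ L ∘ₗ LinearMap.mulRight k eα ∘ₗ LinearMap.mulLeft k (e (tgt α)))
      fun y => by
        change injVal η (L (e (tgt α) * (e (tgt α) * y) * eα)) =
          injVal η (L (e (tgt α) * y * eα))
        rw [← mul_assoc (e _), S.idem]
  have hξ : ∀ y, injVal ξ y = injVal η (L (e (tgt α) * y * eα)) := fun _ => rfl
  refine ⟨ξ, injVal_ext fun y => ?_, fun β hβ hne y => ?_⟩
  · rw [coarrowMap_apply, hξ, ← mul_assoc, S.left, mul_assoc]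
    have h1 : L (x α * (y * eα)) = e (src α) * (y * eα) := LinearMap.congr_fun hL _
    have h2 : e (src α) * y * eα = e (src α) * y := by
      have h3 : e (src α) * y = e (src α) * y * ∑ a, e a := by rw [S.sum, mul_one]
      conv_rhs => rw [h3]
      rw [Finset.mul_sum, Finset.mul_sum]
      refine Finset.sum_subset (Finset.subset_univ _) fun a _ ha => ?_
      have h4 : x α * y * e a = 0 := by
        by_contra hh
        exact ha (Finset.mem_filter.2 ⟨Finset.mem_univ _, y, hh⟩)
      rw [mul_assoc] at h4 ⊢
      exact S.left_mul_arrow α _ h4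
    rw [h1, ← mul_assoc, h2, injVal_mul]
  · have h1 : x β * y * eα = 0 := by
      rw [Finset.mul_sum]
      refine Finset.sum_eq_zero fun a ha => ?_
      by_contra hh
      obtain ⟨y', hy'⟩ := (Finset.mem_filter.1 ha).2
      have key : ∀ γ z, x γ * z * e a ≠ 0 → Nonempty (QPath src tgt a (src γ)) := by
        intro γ z hz
        refine S.nonempty_path_of_ne (y := z) S.gen fun h0 => hz ?_
        rw [← S.right, mul_assoc, mul_assoc, ← mul_assoc (e _), h0, mul_zero]
      obtain ⟨p⟩ := key β y hh
      obtain ⟨q⟩ := key α y' hy'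
      exact hne (QPath.last_eq S.tree p q hβ)
    rw [hξ, ← hβ, ← mul_assoc, S.left, h1, map_zero, map_zero]

theorem hasIrr_coarrow [FiniteDimensional k R] :
    HasIrr (injObj k (e (tgt α))) (injObj k (e (src α))) := by
  obtain ⟨ω, hω⟩ := S.exists_socle (tgt α)
  have hd := S.finIndec_injObj (tgt α)
  have hc := S.finIndec_injObj (src α)
  have hkill : (coarrowMap k x e S.right α).hom ω = 0 := by
    refine injVal_ext fun y => ?_
    rw [coarrowMap_apply, injVal_zero]
    have h1 := hω (x α * y)
    rw [← mul_assoc, S.left, S.arrow_mul_eq_zero] at h1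
    exact (smul_eq_zero.1 h1.symm).resolve_right (S.idem_ne _)
  refine ⟨coarrowMap k x e S.right α, mem_radSet_of_not_splitMono hd.2 _ ?_, ?_⟩
  · rintro ⟨s, hs⟩
    apply S.socle_ne_zero hω
    have h1 := congrArg (fun q : injObj k (e (tgt α)) ⟶ injObj k (e (tgt α)) => q.hom ω) hs
    change s.hom ((coarrowMap k x e S.right α).hom ω) = ω at h1
    rw [← h1, hkill, map_zero]
  · rintro ⟨M, u, g, -, hu, ⟨M', g', g'', -, hg', -, hgg⟩, hug⟩
    have hg : g ∈ radSet R _ _ := by rw [hgg]; exact radSet_comp_right hg' _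
    have huω : u.hom ω = 0 := by
      by_contra hne
      obtain ⟨s, hs⟩ := exists_retraction (S.idem _) u (injective_of_socle hω u hne)
      exact not_splitMono_of_mem_radSet hd hu s hs
    choose ξ hξ1 hξ2 using S.exists_coarrow_preimage α
    have huniq : ∀ ζ : injObj k (e (tgt α)), (coarrowMap k x e S.right α).hom ζ = 0 →
        (∀ β, tgt β = tgt α → β ≠ α → ∀ y, injVal ζ (x β * y) = 0) → u.hom ζ = 0 := by
      intro ζ h1 h2
      rw [S.eq_socle_of_arrows hω ζ fun β hβ y => ?_, map_smul, huω, smul_zero]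
      by_cases hβα : β = α
      · subst hβα
        rw [← coarrowMap_apply S.right, h1, injVal_zero]
      · exact h2 β hβ hβα y
    have hadd : ∀ η θ, u.hom (ξ (η + θ)) = u.hom (ξ η) + u.hom (ξ θ) := by
      intro η θ
      rw [← sub_eq_zero, ← map_add, ← map_sub]
      refine huniq _ ?_ fun β h1 h2 y => ?_
      · rw [map_sub, map_add, hξ1, hξ1, hξ1, sub_self]
      · change injVal (ξ (η + θ)) _ - (injVal (ξ η) _ + injVal (ξ θ) _) = 0
        rw [hξ2 _ β h1 h2, hξ2 _ β h1 h2, hξ2 _ β h1 h2, add_zero, sub_zero]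
    have hsmul : ∀ (b : R) η, u.hom (ξ (b • η)) = b • u.hom (ξ η) := by
      intro b η
      rw [← sub_eq_zero, ← map_smul, ← map_sub]
      refine huniq _ ?_ fun β h1 h2 y => ?_
      · rw [map_sub, map_smul, hξ1, hξ1, sub_self]
      · change injVal (ξ (b • η)) _ - injVal (ξ η) (x β * y * b) = 0
        rw [hξ2 _ β h1 h2, mul_assoc, hξ2 _ β h1 h2, sub_zero]
    let s : injObj k (e (src α)) ⟶ M := ModuleCat.ofHom
      { toFun := fun η => u.hom (ξ η)
        map_add' := hadd
        map_smul' := hsmul }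
    refine not_splitEpi_of_mem_radSet hc hg s ?_
    ext η
    change g.hom (u.hom (ξ η)) = η
    conv_rhs => rw [← hξ1 η, hug]
    rfl

end Coarrow

end IsHerSystem

end HereditaryInjectives

section Depth

variable {k R V E : Type} [Field k] [Ring R] [Algebra k R] [Fintype V] {src tgt : E → V}
  {e : V → R} {x : E → R}

theorem IrrChain.length_eq {l : ModuleCat.{0} R → ℚ}
    (h1 : ∀ X Y, FinIndec R X → FinIndec R Y → HasIrr X Y → l Y = l X + 1)
    (h2 : ∀ X Y, FinIndec R X → FinIndec R Y → Nonempty (X ≅ Y) → l X = l Y)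
    {n : ℕ} {X Y : ModuleCat.{0} R} (c : IrrChain n X Y) (hX : FinIndec R X)
    (hY : FinIndec R Y) : l Y = l X + n := by
  induction c with
  | iso h => rw [h2 _ _ hX hY h, Nat.cast_zero, add_zero]
  | cons hX' hY' h c ih =>
    rw [ih hY' hY, h1 _ _ hX' hY' h]
    push_cast
    ring

/-- Through every element of an indecomposable there is a composite of radical morphisms of
the maximal length. -/
theorem IsHerSystem.exists_through [Fintype E] [FiniteDimensional k R]
    (S : IsHerSystem k src tgt e x)
    (hconn : ∀ F : V → ℚ, (∀ β, F (src β) = F (tgt β)) → ∀ a b, F a = F b)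
    (hrf : RepFinite R) {r : ℕ} (hr : NilpotencyIndex R r) {Z : ModuleCat.{0} R}
    (hZ : FinIndec R Z) {c : V} {z : Z} (hz : e c • z ≠ 0) :
    ∃ (P I : ModuleCat.{0} R) (p : P ⟶ Z) (q : Z ⟶ I) (a b : ℕ) (w : P),
      Module.Finite R P ∧ Module.Finite R I ∧ p.hom w = e c • z ∧ q.hom (e c • z) ≠ 0 ∧
      p ∈ radPowSet R a P Z ∧ q ∈ radPowSet R b Z I ∧ a + b + 1 = r := by
  have := IsArtinianRing.of_finite k R
  obtain ⟨l, hl1, hl2, hl3⟩ := S.exists_length hrf hr.2.1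
  have hdep : ∀ {X Y : ModuleCat.{0} R} (m : ℕ) (f : X ⟶ Y), FinIndec R X → FinIndec R Y → f ≠ 0 →
      f ∈ radPowSet R m X Y → ∃ n, m ≤ n ∧ n < r ∧ f ∈ radPowSet R n X Y ∧ l Y = l X + n := by
    intro X Y m f hX hY hf hm
    have := hX.1
    have := hY.1
    obtain ⟨n, h1, h2, h3, h4⟩ := exists_depth hr.2.1 hf hm
    exact ⟨n, h1, h2, h3, (irrChain_of_mem hX hY h3 h4).length_eq hl1 hl2 hX hY⟩
  have hI : ∀ β, l (injObj k (e (src β))) = l (injObj k (e (tgt β))) + 1 := fun β =>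
    hl1 _ _ (S.finIndec_injObj _) (S.finIndec_injObj _) (S.hasIrr_coarrow β)
  have hN := hconn (fun d => l (injObj k (e d)) - l (projObj (e d))) fun β => by
    simp only [hI, hl3]
    ring
  have hcomp : ∀ {X Y : ModuleCat.{0} R} (f : X ⟶ Y) (v : X), Module.Finite R X →
      Module.Finite R Y → f.hom v ≠ 0 → ∀ m, f ∈ radPowSet R m X Y → ∃ (n : ℕ) (d : V), m ≤ n ∧
      n < r ∧ l (injObj k (e d)) = l (projObj (e d)) + n := by
    intro X Y f v hX hY hv m hm
    obtain ⟨d, hd⟩ := S.exists_idem_smul_ne _ hv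
    obtain ⟨q, hq⟩ := exists_injMap_ne (k := k) (S.idem d) hd
    have h0 : projMap (e d) v ≫ f ≫ q ≠ 0 := fun h0 => hq (by
      have h1 := congrArg (fun g : projObj (e d) ⟶ injObj k (e d) => g.hom (projGen (S.idem d))) h0
      change q.hom (f.hom ((projMap (e d) v).hom (projGen (S.idem d)))) = 0 at h1
      rwa [projMap_gen, map_smul] at h1)
    obtain ⟨n, h1, h2, -, h3⟩ := hdep m (projMap (e d) v ≫ f ≫ q) (S.finIndec_projObj d)
      (S.finIndec_injObj d) h0 (radPowSet_comp_left _ (radPowSet_comp_right hm _))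
    exact ⟨n, d, h1, h2, h3⟩
  obtain ⟨q, hq⟩ := exists_injMap_ne (k := k) (S.idem c) hz
  have hp0 : projMap (e c) z ≠ 0 := fun h0 => hz (by
    rw [← projMap_gen (S.idem c) z, h0]; rfl)
  have hq0 : q ≠ 0 := fun h0 => hq (by rw [h0]; rfl)
  obtain ⟨a, -, -, ha, hla⟩ := hdep 0 _ (S.finIndec_projObj c) hZ hp0 trivial
  obtain ⟨b, -, -, hb, hlb⟩ := hdep 0 _ hZ (S.finIndec_injObj c) hq0 trivial
  have hlt : a + b + 1 ≤ r := by
    obtain ⟨n, d, -, h1, h2⟩ := hcomp (𝟙 Z) z hZ.1 hZ.1 (fun h => hz (by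
      change z = 0 at h
      rw [h, smul_zero])) 0 trivial
    have h3 := hN c d
    have h4 : ((a + b : ℕ) : ℚ) = n := by
      push_cast
      linarith
    have h5 : a + b = n := by exact_mod_cast h4
    omega
  have hle : r ≤ a + b + 1 := by
    refine hr.2.2 _ fun X Y hX hY f hf => ?_
    by_contra hne
    obtain ⟨v, hv⟩ : ∃ v, f.hom v ≠ 0 := by
      by_contra h
      push Not at h
      exact hne (ModuleCat.hom_ext (LinearMap.ext h))
    obtain ⟨n, d, h0, -, h2⟩ := hcomp f v hX hY hv _ hf
    have h3 := hN c d
    have h4 : ((a + b : ℕ) : ℚ) = n := by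
      push_cast
      linarith
    have h5 : a + b = n := by exact_mod_cast h4
    omega
  exact ⟨_, _, _, q, a, b, projGen (S.idem c), (S.finIndec_projObj c).1, finite_injObj _,
    projMap_gen (S.idem c) z, hq, ha, hb, by omega⟩

end Depth

section Trees

variable {k A V E : Type} [Field k] [Ring A] [Algebra k A] [Fintype V] [Fintype E]
  (P : QuiverPresentation k A V E)

/-- Functions on the vertices which are constant along the arrows are constant. -/
def ConnFun {V E : Type} (src tgt : E → V) : Prop :=
  ∀ F : V → ℚ, (∀ β, F (src β) = F (tgt β)) → ∀ a b, F a = F b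

theorem QuiverPresentation.IsWalkFrom.eq_of {avoid : Set E} {F : V → ℚ}
    (hF : ∀ β ∉ avoid, F (P.src β) = F (P.tgt β)) :
    ∀ {l : List (E × Bool)} {a b : V}, P.IsWalkFrom a l b → (∀ s ∈ l, s.1 ∉ avoid) → F a = F b
  | [], a, b, h, _ => congrArg F h
  | s :: l, a, b, h, hl => by
    have h1 := QuiverPresentation.IsWalkFrom.eq_of hF h.2 fun t ht =>
      hl t (List.mem_cons_of_mem _ ht)
    have h2 := hF s.1 (hl s List.mem_cons_self)
    rw [← h1, ← h.1]
    rcases hs : s.2 with _ | _ <;>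
    simp [QuiverPresentation.stepSrc, QuiverPresentation.stepTgt, hs, h2]

theorem QuiverPresentation.Connected.connFun (h : P.Connected) : ConnFun P.src P.tgt := by
  intro F hF a b
  obtain ⟨l, hl, -⟩ := h a b
  exact QuiverPresentation.IsWalkFrom.eq_of P (avoid := ∅) (fun β _ => hF β) hl (by simp)

theorem ConnFun.hasPotentials {src tgt : E → V} (h : ConnFun src tgt)
    (hcard : Fintype.card E + 1 = Fintype.card V) : HasPotentials src tgt := by
  let δ : (V → ℚ) →ₗ[ℚ] (E → ℚ) :=
    { toFun := fun h e => h (src e) - h (tgt e)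
      map_add' := fun f g => by ext e; simp; ring
      map_smul' := fun r f => by ext e; simp; ring }
  have hker : LinearMap.ker δ ≤ Submodule.span ℚ {fun _ => (1 : ℚ)} := by
    intro F hF
    have hF' : ∀ β, F (src β) = F (tgt β) := fun β => by
      have := congrFun (LinearMap.mem_ker.1 hF) β
      exact sub_eq_zero.1 this
    have hc := h F hF'
    rcases isEmpty_or_nonempty V with hV | ⟨⟨v⟩⟩
    · have : F = 0 := Subsingleton.elim _ _
      rw [this]; exact Submodule.zero_mem _
    · exact Submodule.mem_span_singleton.2 ⟨F v, by ext w; simp [hc w v]⟩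
  have h1 := (Submodule.finrank_mono hker).trans (finrank_span_le_card _)
  have h2 := LinearMap.finrank_range_add_finrank_ker δ
  simp only [Set.toFinset_singleton, Finset.card_singleton] at h1
  rw [Module.finrank_fintype_fun_eq_card] at h2
  have h3 : LinearMap.range δ = ⊤ := by
    apply Submodule.eq_top_of_finrank_eq
    have := Submodule.finrank_le (LinearMap.range δ)
    rw [Module.finrank_fintype_fun_eq_card] at this ⊢
    omega
  intro w
  obtain ⟨f, hf⟩ := LinearMap.range_eq_top.1 h3 w
  exact ⟨f, fun e => congrFun hf e⟩

theorem QuiverPresentation.mem_compSet_of_src {avoid β : E} {root : V} (hβ : β ≠ avoid) :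
    P.src β ∈ compSet P avoid root ↔ P.tgt β ∈ compSet P avoid root := by
  constructor
  · rintro ⟨l, hl, ha⟩
    exact ⟨(β, false) :: l, ⟨by simp [QuiverPresentation.stepSrc],
      by simpa [QuiverPresentation.stepTgt] using hl⟩,
      by simpa using ⟨hβ, fun a => ⟨fun h => ha _ h, fun h => ha _ h⟩⟩⟩
  · rintro ⟨l, hl, ha⟩
    exact ⟨(β, true) :: l, ⟨by simp [QuiverPresentation.stepSrc],
      by simpa [QuiverPresentation.stepTgt] using hl⟩,
      by simpa using ⟨hβ, fun a => ⟨fun h => ha _ h, fun h => ha _ h⟩⟩⟩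

theorem QuiverPresentation.mem_compSet_root (avoid : E) (root : V) :
    root ∈ compSet P avoid root := ⟨[], rfl, by simp⟩

theorem QuiverPresentation.eq_of_mem_compSet {avoid : E} {root v : V}
    (hv : v ∈ compSet P avoid root) {F : V → ℚ}
    (hF : ∀ β ≠ avoid, F (P.src β) = F (P.tgt β)) : F v = F root := by
  obtain ⟨l, hl, ha⟩ := hv
  exact QuiverPresentation.IsWalkFrom.eq_of P (fun β hβ => hF β hβ) hl ha

theorem QuiverPresentation.mem_compSet_or (h : P.Connected) (avoid : E) (v : V) :
    v ∈ compSet P avoid (P.src avoid) ∨ v ∈ compSet P avoid (P.tgt avoid) := by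
  have := h.connFun P (fun v => if v ∈ compSet P avoid (P.src avoid) ∨
    v ∈ compSet P avoid (P.tgt avoid) then 1 else 0) (fun β => ?_) v (P.src avoid)
  · by_contra hc
    simp [hc, P.mem_compSet_root] at this
  · by_cases hβ : β = avoid
    · subst hβ; simp [P.mem_compSet_root]
    · simp only [P.mem_compSet_of_src hβ]

end Trees

section Chain

variable {V E : Type}

/-- A relation path `γ 0, …, γ n` in a tree, together with the vertex sets of the two halves
of the tree. -/
structure ChainShape (src tgt : E → V) (n : ℕ) (γ : ℕ → E) (U₁ U₂ : Set V) : Prop where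
  pos : 1 ≤ n
  chain : ∀ i < n, src (γ (i + 1)) = tgt (γ i)
  inj : ∀ i < n, ∀ j < n, src (γ (i + 1)) = src (γ (j + 1)) → i = j
  mem_iff : ∀ v, (v ∈ U₁ ∧ v ∈ U₂) ↔ ∃ i < n, v = src (γ (i + 1))
  cover : ∀ v, v ∉ U₁ → v ∈ U₂
  first : src (γ 0) ∉ U₁
  last : tgt (γ n) ∉ U₂
  mono₁ : ∀ β, tgt β ∉ U₁ → src β ∉ U₁
  mono₂ : ∀ β, src β ∉ U₂ → tgt β ∉ U₂
  cross₁ : ∀ β, src β ∉ U₁ → tgt β ∈ U₁ → β = γ 0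
  cross₂ : ∀ β, src β ∈ U₂ → tgt β ∉ U₂ → β = γ n
  out : ∀ β, ∀ i < n, src β = src (γ (i + 1)) → β = γ (i + 1)
  into : ∀ β, ∀ i < n, tgt β = src (γ (i + 1)) → β = γ i

theorem QuiverPresentation.chainShape {k A : Type} [Field k] [Ring A] [Algebra k A] [Fintype V]
    [Fintype E] (P : QuiverPresentation k A V E) (htree : P.IsTreeQuiver) {n : ℕ} (hn : 1 ≤ n)
    {γ : ℕ → E} (hchain : ∀ i < n, P.src (γ (i + 1)) = P.tgt (γ i))
    (hattach : ∀ β : E, (¬ ∃ i ≤ n, γ i = β) → ∀ j < n,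
      P.src β ≠ P.src (γ (j + 1)) ∧ P.tgt β ≠ P.src (γ (j + 1))) :
    ChainShape P.src P.tgt n γ (compSet P (γ 0) (P.tgt (γ n))) (compSet P (γ n) (P.src (γ 0))) := by
  have hconn := htree.1.connFun P
  have hpot := hconn.hasPotentials htree.2
  obtain ⟨l, hl⟩ := hpot fun _ => 1
  have hlen : ∀ i ≤ n, l (P.src (γ i)) = l (P.src (γ 0)) - i := by
    intro i
    induction i with
    | zero => simp
    | succ i ih =>
      intro hi
      have := hl (γ i)
      have := ih (by omega)
      rw [hchain i (by omega)]
      push_cast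
      linarith
  have hlent : ∀ i ≤ n, l (P.tgt (γ i)) = l (P.src (γ 0)) - i - 1 := fun i hi => by
    have := hl (γ i)
    have := hlen i hi
    linarith
  have hγ : ∀ i ≤ n, ∀ j ≤ n, P.src (γ i) = P.src (γ j) → i = j := by
    intro i hi j hj h
    have h1 := hlen i hi
    rw [h, hlen j hj] at h1
    have : (i : ℚ) = j := by linarith
    exact_mod_cast this
  have hγne : ∀ i ≤ n, ∀ j ≤ n, γ i = γ j → i = j := fun i hi j hj h => hγ i hi j hj (by rw [h])
  obtain ⟨F, hF⟩ := hpot fun e => if e = γ 0 then 1 else 0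
  obtain ⟨G, hG⟩ := hpot fun e => if e = γ n then 1 else 0
  have hF' : ∀ β ≠ γ 0, F (P.src β) = F (P.tgt β) := fun β hβ => by
    have := hF β
    rw [if_neg hβ] at this
    linarith
  have hG' : ∀ β ≠ γ n, G (P.src β) = G (P.tgt β) := fun β hβ => by
    have := hG β
    rw [if_neg hβ] at this
    linarith
  have hF0 : F (P.src (γ 0)) = F (P.tgt (γ 0)) + 1 := by
    have := hF (γ 0)
    rw [if_pos rfl] at this
    linarith
  have hGn : G (P.src (γ n)) = G (P.tgt (γ n)) + 1 := by
    have := hG (γ n)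
    rw [if_pos rfl] at this
    linarith
  set U₁ := compSet P (γ 0) (P.tgt (γ n)) with hU₁
  set U₂ := compSet P (γ n) (P.src (γ 0)) with hU₂
  have ht1 : ∀ i ≤ n, P.tgt (γ i) ∈ U₁ := by
    intro i hi
    induction hd : n - i generalizing i with
    | zero => obtain rfl : i = n := by omega
              exact P.mem_compSet_root _ _
    | succ d ih =>
      have h1 := ih (i + 1) (by omega) (by omega)
      rw [← P.mem_compSet_of_src fun h => by have := hγne _ (by omega) _ (by omega) h; omega,
        hchain i (by omega)] at h1
      exact h1
  have hs2 : ∀ i ≤ n, P.src (γ i) ∈ U₂ := by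
    intro i
    induction i with
    | zero => exact fun _ => P.mem_compSet_root _ _
    | succ i ih =>
      intro hi
      rw [hchain i (by omega), ← P.mem_compSet_of_src fun h => by
        have := hγne _ (by omega) _ (by omega) h; omega]
      exact ih (by omega)
  have hFU : ∀ v ∈ U₁, F v = F (P.tgt (γ n)) := fun v hv => P.eq_of_mem_compSet hv hF'
  have hGU : ∀ v ∈ U₂, G v = G (P.src (γ 0)) := fun v hv => P.eq_of_mem_compSet hv hG'
  have hFt : F (P.tgt (γ 0)) = F (P.tgt (γ n)) := hFU _ (ht1 0 (by omega))
  have hGs : G (P.src (γ n)) = G (P.src (γ 0)) := hGU _ (hs2 n le_rfl)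
  have hF1 : ∀ v ∉ U₁, F v = F (P.tgt (γ n)) + 1 := by
    intro v hv
    rcases P.mem_compSet_or htree.1 (γ 0) v with h | h
    · rw [P.eq_of_mem_compSet h hF', hF0, hFt]
    · exfalso
      apply hv
      obtain ⟨p, hp, hp'⟩ := h
      obtain ⟨q, hq, hq'⟩ := ht1 0 (by omega)
      refine ⟨p ++ q, ?_, ?_⟩
      · clear hp' hq' hv
        induction p generalizing v with
        | nil => exact hp ▸ hq
        | cons s p ih => exact ⟨hp.1, ih _ hp.2⟩
      · intro s hs
        rcases List.mem_append.1 hs with hs | hs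
        exacts [hp' s hs, hq' s hs]
  have hG1 : ∀ v ∉ U₂, G v = G (P.src (γ 0)) - 1 := by
    intro v hv
    rcases P.mem_compSet_or htree.1 (γ n) v with h | h
    · exfalso
      apply hv
      obtain ⟨p, hp, hp'⟩ := h
      obtain ⟨q, hq, hq'⟩ := hs2 n le_rfl
      refine ⟨p ++ q, ?_, ?_⟩
      · clear hp' hq' hv
        induction p generalizing v with
        | nil => exact hp ▸ hq
        | cons s p ih => exact ⟨hp.1, ih _ hp.2⟩
      · intro s hs
        rcases List.mem_append.1 hs with hs | hs
        exacts [hp' s hs, hq' s hs]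
    · rw [P.eq_of_mem_compSet h hG']
      linarith
  have hfirst : P.src (γ 0) ∉ U₁ := fun h => by
    have := hFU _ h
    linarith
  have hlast : P.tgt (γ n) ∉ U₂ := fun h => by
    have := hGU _ h
    linarith
  have hout : ∀ β, ∀ i < n, P.src β = P.src (γ (i + 1)) → β = γ (i + 1) := by
    intro β i hi h
    by_cases hβ : ∃ j ≤ n, γ j = β
    · obtain ⟨j, hj, rfl⟩ := hβ
      rw [hγ j hj (i + 1) (by omega) h]
    · exact absurd h (hattach β hβ i hi).1
  have hinto : ∀ β, ∀ i < n, P.tgt β = P.src (γ (i + 1)) → β = γ i := by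
    intro β i hi h
    by_cases hβ : ∃ j ≤ n, γ j = β
    · obtain ⟨j, hj, rfl⟩ := hβ
      have h1 := hlent j hj
      rw [h, hlen (i + 1) (by omega)] at h1
      have : (i : ℚ) = j := by push_cast at h1; linarith
      rw [Nat.cast_injective this]
    · exact absurd h (hattach β hβ i hi).2
  have hmem : ∀ i < n, P.src (γ (i + 1)) ∈ U₁ ∧ P.src (γ (i + 1)) ∈ U₂ := fun i hi =>
    ⟨hchain i hi ▸ ht1 i (by omega), hs2 _ (by omega)⟩
  have hL := hconn (fun v => (if ∃ i < n, v = P.src (γ (i + 1)) then 0 else 1) -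
    (F v - F (P.tgt (γ n))) + (G v - G (P.src (γ 0)))) (fun β => by
      have h1 := hF β
      have h2 := hG β
      by_cases hβ : ∃ j ≤ n, γ j = β
      · obtain ⟨j, hj, rfl⟩ := hβ
        have h3 : (∃ i < n, P.src (γ j) = P.src (γ (i + 1))) ↔ j ≠ 0 := by
          constructor
          · rintro ⟨i, hi, h⟩
            have := hγ _ hj _ (by omega) h
            omega
          · intro h
            exact ⟨j - 1, by omega, by rw [Nat.sub_add_cancel (by omega)]⟩
        have h4 : (∃ i < n, P.tgt (γ j) = P.src (γ (i + 1))) ↔ j ≠ n := by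
          constructor
          · rintro ⟨i, hi, h⟩
            have := hγne _ hj _ (by omega) (hinto _ i hi h)
            omega
          · intro h
            exact ⟨j, by omega, (hchain j (by omega)).symm⟩
        have h5 : γ j = γ 0 ↔ j = 0 := ⟨fun h => hγne _ hj _ (by omega) h, fun h => by rw [h]⟩
        have h6 : γ j = γ n ↔ j = n := ⟨fun h => hγne _ hj _ (by omega) h, fun h => by rw [h]⟩
        simp only [h3, h4]
        simp only [h5, h6] at h1 h2
        split_ifs at * <;> first | linarith | omega
      · have h3 := hattach β hβ
        have h4 : ¬ ∃ i < n, P.src β = P.src (γ (i + 1)) := fun ⟨i, hi, h⟩ => (h3 i hi).1 h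
        have h5 : ¬ ∃ i < n, P.tgt β = P.src (γ (i + 1)) := fun ⟨i, hi, h⟩ => (h3 i hi).2 h
        rw [if_neg fun h => hβ ⟨0, by omega, h.symm⟩] at h1
        rw [if_neg fun h => hβ ⟨n, le_rfl, h.symm⟩] at h2
        simp only [if_neg h4, if_neg h5]
        linarith)
  have hkey : ∀ v, ((if ∃ i < n, v = P.src (γ (i + 1)) then (0 : ℚ) else 1)) =
      (F v - F (P.tgt (γ n))) - (G v - G (P.src (γ 0))) := by
    intro v
    have h1 := hL v (P.src (γ (0 + 1)))
    have h2 := hmem 0 (by omega)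
    rw [if_pos (⟨0, by omega, rfl⟩ : ∃ i < n, P.src (γ (0 + 1)) = P.src (γ (i + 1))),
      hFU _ h2.1, hGU _ h2.2] at h1
    linarith
  refine ⟨hn, hchain, fun i hi j hj h => ?_, fun v => ⟨fun h => ?_, ?_⟩, fun v hv => ?_,
    hfirst, hlast, fun β h h' => ?_, fun β h h' => ?_, fun β h h' => ?_, fun β h h' => ?_,
    hout, hinto⟩
  · have := hγ _ (by omega) _ (by omega) h
    omega
  · by_contra hc
    have := hkey v
    rw [if_neg hc, hFU _ h.1, hGU _ h.2] at this
    linarith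
  · rintro ⟨i, hi, rfl⟩
    exact hmem i hi
  · by_contra hc
    have := hkey v
    rw [hF1 v hv, hG1 v hc] at this
    split_ifs at this <;> linarith
  · have h1 := hFU _ h'
    have h2 := hF1 _ h
    have h3 := hF β
    split_ifs at h3 <;> linarith
  · have h1 := hGU _ h'
    have h2 := hG1 _ h
    have h3 := hG β
    split_ifs at h3 <;> linarith
  · by_contra hβ
    have := hF' β hβ
    rw [hF1 _ h, hFU _ h'] at this
    linarith
  · by_contra hβ
    have := hG' β hβ
    rw [hG1 _ h', hGU _ h] at this
    linarith

/-- Connectivity passes to a retract of the quiver. -/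
theorem ConnFun.of_retract {src tgt : E → V} (h : ConnFun src tgt) {V' E' : Type}
    {src' tgt' : E' → V'} {iV : V' → V} {iE : E' → E}
    (hs : ∀ β, src (iE β) = iV (src' β)) (ht : ∀ β, tgt (iE β) = iV (tgt' β))
    (ρ : V → V') (hρ : ∀ v, ρ (iV v) = v)
    (hρE : ∀ β, ρ (src β) = ρ (tgt β) ∨ β ∈ Set.range iE) : ConnFun src' tgt' := by
  intro F hF a b
  have := h (F ∘ ρ) (fun β => ?_) (iV a) (iV b)
  · simpa [hρ] using this
  · rcases hρE β with h | ⟨β, rfl⟩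
    · simp [h]
    · simp [hs, ht, hρ, hF]

theorem HasPotentials.of_injective {src tgt : E → V} (h : HasPotentials src tgt) {V' E' : Type}
    {src' tgt' : E' → V'} {iV : V' → V} {iE : E' → E} (hinj : Function.Injective iE)
    (hs : ∀ β, src (iE β) = iV (src' β)) (ht : ∀ β, tgt (iE β) = iV (tgt' β)) :
    HasPotentials src' tgt' := by
  intro w
  obtain ⟨F, hF⟩ := h (Function.extend iE w 0)
  refine ⟨F ∘ iV, fun β => ?_⟩
  have := hF (iE β)
  rw [hinj.extend_apply] at this
  rw [← this, hs, ht]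
  rfl

end Chain

section RelPow

variable {A : Type} [Ring A]

/-- Compositions of `n` radical morphisms through modules in a given class. -/
def relPow (S : ModuleCat.{0} A → Prop) : ℕ → ∀ (X Y : ModuleCat.{0} A), Set (X ⟶ Y)
  | 0, _, _ => Set.univ
  | n + 1, X, Y => {f | ∃ (M : ModuleCat.{0} A) (g : X ⟶ M) (h : M ⟶ Y),
      Module.Finite A M ∧ S M ∧ g ∈ radSet A X M ∧ h ∈ relPow S n M Y ∧ f = g ≫ h}

variable {S : ModuleCat.{0} A → Prop}

theorem relPow_comp_left {n : ℕ} {X Y Z : ModuleCat.{0} A} (u : X ⟶ Y) {f : Y ⟶ Z}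
    (hf : f ∈ relPow S n Y Z) : u ≫ f ∈ relPow S n X Z := by
  cases n with
  | zero => trivial
  | succ n =>
    obtain ⟨M, g, h, hM, hS, hg, hh, rfl⟩ := hf
    exact ⟨M, u ≫ g, h, hM, hS, radSet_comp_left u hg, hh, by simp⟩

theorem relPow_comp_right {n : ℕ} {X Y Z : ModuleCat.{0} A} {f : X ⟶ Y}
    (hf : f ∈ relPow S n X Y) (u : Y ⟶ Z) : f ≫ u ∈ relPow S n X Z := by
  induction n generalizing X with
  | zero => trivial
  | succ n ih =>
    obtain ⟨M, g, h, hM, hS, hg, hh, rfl⟩ := hf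
    exact ⟨M, g, h ≫ u, hM, hS, hg, ih hh, by simp⟩

theorem relPow_mono {T : ModuleCat.{0} A → Prop} (hST : ∀ M, S M → T M) {n : ℕ}
    {X Y : ModuleCat.{0} A} {f : X ⟶ Y} (hf : f ∈ relPow S n X Y) : f ∈ relPow T n X Y := by
  induction n generalizing X with
  | zero => trivial
  | succ n ih =>
    obtain ⟨M, g, h, hM, hS, hg, hh, rfl⟩ := hf
    exact ⟨M, g, h, hM, hST M hS, hg, ih hh, rfl⟩

theorem relPow_mono_right {n m : ℕ} (h : n ≤ m) {X Y : ModuleCat.{0} A} {f : X ⟶ Y}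
    (hf : f ∈ relPow S m X Y) : f ∈ relPow S n X Y := by
  induction n generalizing X m with
  | zero => trivial
  | succ n ih =>
    obtain ⟨m, rfl⟩ : ∃ m', m = m' + 1 := ⟨m - 1, by omega⟩
    obtain ⟨M, g, h, hM, hS, hg, hh, rfl⟩ := hf
    exact ⟨M, g, h, hM, hS, hg, ih (by omega) hh, rfl⟩

theorem relPow_comp {n m : ℕ} {X Y Z : ModuleCat.{0} A} {f : X ⟶ Y} {g : Y ⟶ Z}
    (hf : f ∈ relPow S n X Y) (hg : g ∈ relPow S m Y Z) : f ≫ g ∈ relPow S (n + m) X Z := by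
  induction n generalizing X with
  | zero => rw [zero_add]; exact relPow_comp_left f hg
  | succ n ih =>
    obtain ⟨M, u, h, hM, hS, hu, hh, rfl⟩ := hf
    rw [Nat.succ_add, Category.assoc]
    exact ⟨M, u, h ≫ g, hM, hS, hu, ih hh, rfl⟩

theorem mem_relPow_one {X Y : ModuleCat.{0} A} (hY : Module.Finite A Y) (hS : S Y) {f : X ⟶ Y}
    (hf : f ∈ radSet A X Y) : f ∈ relPow S 1 X Y :=
  ⟨Y, f, 𝟙 Y, hY, hS, hf, trivial, by simp⟩

theorem radPowSet_of_relPow {n : ℕ} {X Y : ModuleCat.{0} A} {f : X ⟶ Y}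
    (hf : f ∈ relPow S n X Y) : f ∈ radPowSet A n X Y := by
  induction n generalizing X with
  | zero => trivial
  | succ n ih =>
    obtain ⟨M, g, h, hM, hS, hg, hh, rfl⟩ := hf
    exact ⟨M, g, h, hM, hg, ih hh, rfl⟩

theorem relPow_of_radPowSet {n : ℕ} {X Y : ModuleCat.{0} A} {f : X ⟶ Y}
    (hf : f ∈ radPowSet A n X Y) : f ∈ relPow (fun _ => True) n X Y := by
  induction n generalizing X with
  | zero => trivial
  | succ n ih =>
    obtain ⟨M, g, h, hM, hg, hh, rfl⟩ := hf
    exact ⟨M, g, h, hM, trivial, hg, ih hh, rfl⟩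

end RelPow

section Quotient

variable {A B : Type} [Ring A] [Ring B] (φ : A →+* B)

/-- Restriction of scalars. -/
noncomputable abbrev resFun : ModuleCat.{0} B ⥤ ModuleCat.{0} A := ModuleCat.restrictScalars φ

/-- The modules annihilated by the kernel. -/
def KilledBy (M : ModuleCat.{0} A) : Prop := ∀ a, φ a = 0 → ∀ x : M, a • x = 0

theorem killedBy_resFun (X : ModuleCat.{0} B) : KilledBy φ ((resFun φ).obj X) := fun a ha x => by
  change (φ a • (show X from x) : X) = 0
  rw [ha, zero_smul]

theorem KilledBy.of_injective {M N : ModuleCat.{0} A} (hN : KilledBy φ N) (f : M ⟶ N)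
    (hf : Function.Injective f.hom) : KilledBy φ M := fun a ha x => hf (by
  rw [map_smul, hN a ha, map_zero])

variable {φ} (hφ : Function.Surjective φ)

include hφ

theorem exists_resFun_map {X Y : ModuleCat.{0} B} (f : (resFun φ).obj X ⟶ (resFun φ).obj Y) :
    ∃ g : X ⟶ Y, (resFun φ).map g = f := by
  refine ⟨ModuleCat.ofHom (X := X) (Y := Y)
    { toFun := fun x => f.hom x
      map_add' := fun x y => map_add f.hom _ _
      map_smul' := fun b x => ?_ }, ?_⟩
  · obtain ⟨a, rfl⟩ := hφ b
    exact map_smul f.hom a _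
  · ext x
    rfl

theorem exists_resFun_iso {X Y : ModuleCat.{0} B} (f : (resFun φ).obj X ≅ (resFun φ).obj Y) :
    Nonempty (X ≅ Y) := by
  obtain ⟨g, hg⟩ := exists_resFun_map hφ f.hom
  obtain ⟨h, hh⟩ := exists_resFun_map hφ f.inv
  refine ⟨⟨g, h, (resFun φ).map_injective ?_, (resFun φ).map_injective ?_⟩⟩ <;>
  simp [hg, hh]

theorem KilledBy.exists_iso {M : ModuleCat.{0} A} (hM : KilledBy φ M) :
    ∃ N : ModuleCat.{0} B, Nonempty ((resFun φ).obj N ≅ M) := by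
  have key : ∀ a a', φ a = φ a' → ∀ x : M, a • x = a' • x := fun a a' h x => by
    have := hM (a - a') (by rw [map_sub, h, sub_self]) x
    rwa [sub_smul, sub_eq_zero] at this
  let s : B → A := Function.surjInv hφ
  have hs : ∀ b, φ (s b) = b := Function.surjInv_eq hφ
  let _ : Module B M :=
    { smul := fun b x => s b • x
      one_smul := fun x => (key _ 1 (by rw [hs, map_one]) x).trans (one_smul A x)
      mul_smul := fun b c x => (key _ (s b * s c) (by rw [map_mul, hs, hs, hs]) x).trans
        (mul_smul _ _ x)
      smul_zero := fun b => smul_zero (s b)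
      smul_add := fun b => smul_add (s b)
      add_smul := fun b c x => (key _ (s b + s c) (by rw [map_add, hs, hs, hs]) x).trans
        (add_smul _ _ x)
      zero_smul := fun x => (key _ 0 (by rw [hs, map_zero]) x).trans (zero_smul A x) }
  have hsm : ∀ (a : A) (x : M), φ a • x = a • x := fun a x => key (s (φ a)) a (hs _) x
  obtain ⟨N, f, hf⟩ : ∃ (N : ModuleCat.{0} B) (f : (resFun φ).obj N ≃+ M),
      ∀ (a : A) (x : (resFun φ).obj N), f (a • x) = a • f x :=
    ⟨ModuleCat.of B M, AddEquiv.refl M, hsm⟩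
  exact ⟨N, ⟨LinearEquiv.toModuleIso (X₁ := (resFun φ).obj N) (X₂ := M)
    (f.toLinearEquiv hf)⟩⟩

theorem finite_resFun_iff {X : ModuleCat.{0} B} :
    Module.Finite A ((resFun φ).obj X) ↔ Module.Finite B X := by
  constructor
  · intro h
    obtain ⟨s, hs⟩ := h.fg_top
    have key : ∀ y : (resFun φ).obj X, y ∈ Submodule.span A (s : Set ((resFun φ).obj X)) →
        (show X from y) ∈ Submodule.span B (show Set X from (s : Set ((resFun φ).obj X))) :=
      fun y hy => by
      induction hy using Submodule.span_induction with
      | mem y hy => exact Submodule.subset_span hy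
      | zero => exact Submodule.zero_mem _
      | add y z _ _ h1 h2 => exact Submodule.add_mem _ h1 h2
      | smul a y _ h1 => exact Submodule.smul_mem _ (φ a) h1
    exact ⟨⟨s, eq_top_iff.2 fun x _ => key x (by rw [hs]; trivial)⟩⟩
  · intro h
    obtain ⟨s, hs⟩ := h.fg_top
    have key : ∀ y : X, y ∈ Submodule.span B (s : Set X) →
        (show (resFun φ).obj X from y) ∈
          Submodule.span A (show Set ((resFun φ).obj X) from (s : Set X)) :=
      fun y hy => by
      induction hy using Submodule.span_induction with
      | mem y hy => exact Submodule.subset_span (M := (resFun φ).obj X) hy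
      | zero => exact Submodule.zero_mem (M := (resFun φ).obj X) _
      | add y z _ _ h1 h2 => exact Submodule.add_mem (M := (resFun φ).obj X) _ h1 h2
      | smul b y _ h1 =>
        obtain ⟨a, rfl⟩ := hφ b
        exact Submodule.smul_mem (M := (resFun φ).obj X) _ a h1
    exact ⟨⟨s, eq_top_iff.2 fun x _ => key x (by rw [hs]; trivial)⟩⟩

theorem finIndec_resFun_iff {X : ModuleCat.{0} B} :
    FinIndec A ((resFun φ).obj X) ↔ FinIndec B X := by
  refine and_congr (finite_resFun_iff hφ) (and_congr Iff.rfl ⟨fun h f hf => ?_, fun h f hf => ?_⟩)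
  · have := h ((resFun φ).map f) (by rw [← Functor.map_comp, hf])
    refine this.imp (fun h => ?_) fun h => ?_
    · exact ModuleCat.hom_ext (LinearMap.ext fun x =>
        congrArg (fun g : (resFun φ).obj X ⟶ (resFun φ).obj X => g.hom x) h)
    · exact (resFun φ).map_injective (by rw [h, CategoryTheory.Functor.map_id])
  · obtain ⟨g, rfl⟩ := exists_resFun_map hφ f
    rw [← Functor.map_comp] at hf
    refine (h g ((resFun φ).map_injective hf)).imp (fun h => ?_) fun h => ?_
    · rw [h]; rfl
    · rw [h, CategoryTheory.Functor.map_id]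

omit hφ in
theorem finIndec_of_iso {R : Type} [Ring R] {X Y : ModuleCat.{0} R} (i : X ≅ Y) (h : FinIndec R X) :
    FinIndec R Y := by
  obtain ⟨h1, h2, h3⟩ := h
  let l := i.toLinearEquiv
  refine ⟨Module.Finite.equiv l, l.symm.toEquiv.nontrivial, fun f hf => ?_⟩
  have := h3 (i.hom ≫ f ≫ i.inv) (by simp [reassoc_of% hf])
  refine this.imp (fun h => ?_) fun h => ?_
  · have h4 : f = i.inv ≫ (i.hom ≫ f ≫ i.inv) ≫ i.hom := by simp
    rw [h4, h]; simp
  · have h4 : f = i.inv ≫ (i.hom ≫ f ≫ i.inv) ≫ i.hom := by simp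
    rw [h4, h]; simp

theorem repFinite_of_surjective (h : RepFinite A) : RepFinite B := by
  obtain ⟨n, T, hT⟩ := h
  refine ⟨n, fun i => if h : ∃ N : ModuleCat.{0} B, Nonempty ((resFun φ).obj N ≅ T i) then
    h.choose else ModuleCat.of B PUnit, fun M hM => ?_⟩
  obtain ⟨i, ⟨f⟩⟩ := hT _ ((finIndec_resFun_iff hφ).2 hM)
  have h : ∃ N : ModuleCat.{0} B, Nonempty ((resFun φ).obj N ≅ T i) := ⟨M, ⟨f⟩⟩
  refine ⟨i, ?_⟩
  simp only [dif_pos h]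
  obtain ⟨g⟩ := h.choose_spec
  exact exists_resFun_iso hφ (f ≪≫ g.symm)

theorem map_mem_radSet_iff {X Y : ModuleCat.{0} B} (f : X ⟶ Y) :
    (resFun φ).map f ∈ radSet A _ _ ↔ f ∈ radSet B X Y := by
  constructor
  · intro hf M hM h h' hi
    refine hf _ ((finIndec_resFun_iff hφ).2 hM) ((resFun φ).map h) ((resFun φ).map h') ?_
    rw [← Functor.map_comp, ← Functor.map_comp]
    exact Functor.map_isIso _ _
  · intro hf M hM h h' hi
    have hMk : KilledBy φ M := (killedBy_resFun φ X).of_injective φ h (by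
      intro x y hxy
      have : (h ≫ (resFun φ).map f ≫ h').hom x = (h ≫ (resFun φ).map f ≫ h').hom y := by
        simp only [ModuleCat.hom_comp, LinearMap.comp_apply, hxy]
      exact (ModuleCat.mono_iff_injective _).1 inferInstance this)
    obtain ⟨N, ⟨i⟩⟩ := hMk.exists_iso hφ
    obtain ⟨g, hg⟩ := exists_resFun_map hφ (i.hom ≫ h)
    obtain ⟨g', hg'⟩ := exists_resFun_map hφ (h' ≫ i.inv)
    refine hf N ((finIndec_resFun_iff hφ).1 (finIndec_of_iso i.symm hM)) g g' ?_
    have h2 : (resFun φ).map (g ≫ f ≫ g') = i.hom ≫ (h ≫ (resFun φ).map f ≫ h') ≫ i.inv := by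
      rw [Functor.map_comp, Functor.map_comp, hg, hg']; simp
    have h3 : IsIso ((resFun φ).map (g ≫ f ≫ g')) := by rw [h2]; infer_instance
    exact isIso_of_reflects_iso _ (resFun φ)

theorem map_mem_relPow {n : ℕ} {X Y : ModuleCat.{0} B} {f : X ⟶ Y} (hf : f ∈ radPowSet B n X Y) :
    (resFun φ).map f ∈ relPow (KilledBy φ) n _ _ := by
  induction n generalizing X with
  | zero => trivial
  | succ n ih =>
    obtain ⟨M, g, h, hM, hg, hh, rfl⟩ := hf
    exact ⟨_, _, _, (finite_resFun_iff hφ).2 hM, killedBy_resFun φ M,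
      (map_mem_radSet_iff hφ g).2 hg, ih hh, by rw [Functor.map_comp]⟩

theorem exists_of_map_mem_relPow {n : ℕ} {X Y : ModuleCat.{0} B}
    {f : (resFun φ).obj X ⟶ (resFun φ).obj Y}
    (hf : f ∈ relPow (KilledBy φ) n _ _) : ∃ g ∈ radPowSet B n X Y, (resFun φ).map g = f := by
  induction n generalizing X with
  | zero =>
    obtain ⟨g, hg⟩ := exists_resFun_map hφ f
    exact ⟨g, trivial, hg⟩
  | succ n ih =>
    obtain ⟨M, g, h, hM, hS, hg, hh, rfl⟩ := hf
    obtain ⟨N, ⟨i⟩⟩ := hS.exists_iso hφ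
    obtain ⟨g', hg'⟩ := exists_resFun_map hφ (g ≫ i.inv)
    obtain ⟨h', hh', hh2⟩ := ih (f := i.hom ≫ h) (relPow_comp_left _ hh)
    refine ⟨g' ≫ h', ⟨N, g', h', ?_, ?_, hh', rfl⟩, ?_⟩
    · exact (finite_resFun_iff hφ).1 (Module.Finite.equiv i.symm.toLinearEquiv)
    · rw [← map_mem_radSet_iff hφ, hg']
      exact radSet_comp_right hg _
    · rw [Functor.map_comp, hg', hh2]; simp

theorem radVanishes_iff_relPow {n : ℕ} : RadVanishes B n ↔ ∀ X Y : ModuleCat.{0} A,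
    Module.Finite A X → Module.Finite A Y → KilledBy φ X → KilledBy φ Y →
    ∀ f ∈ relPow (KilledBy φ) n X Y, f = 0 := by
  constructor
  · intro h X Y hX hY hkX hkY f hf
    obtain ⟨X', ⟨i⟩⟩ := hkX.exists_iso hφ
    obtain ⟨Y', ⟨j⟩⟩ := hkY.exists_iso hφ
    obtain ⟨g, hg, hg'⟩ := exists_of_map_mem_relPow hφ (f := i.hom ≫ f ≫ j.inv)
      (relPow_comp_left _ (relPow_comp_right hf _))
    have h0 := h X' Y' ((finite_resFun_iff hφ).1 (Module.Finite.equiv i.symm.toLinearEquiv))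
      ((finite_resFun_iff hφ).1 (Module.Finite.equiv j.symm.toLinearEquiv)) g hg
    have h1 : f = i.inv ≫ (resFun φ).map g ≫ j.hom := by rw [hg']; simp
    rw [h1, h0]
    ext x
    exact map_zero j.hom.hom
  · intro h X Y hX hY f hf
    have h0 := h _ _ ((finite_resFun_iff hφ).2 hX) ((finite_resFun_iff hφ).2 hY)
      (killedBy_resFun φ X) (killedBy_resFun φ Y) _ (map_mem_relPow hφ hf)
    exact ModuleCat.hom_ext (LinearMap.ext fun x =>
      congrArg (fun g : (resFun φ).obj X ⟶ (resFun φ).obj Y => g.hom x) h0)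

end Quotient

section Support

variable {A V : Type} [Ring A] (e : V → A) (U : Set V)

/-- The modules supported on a set of vertices. -/
def SuppIn (M : ModuleCat.{0} A) : Prop := ∀ v ∉ U, ∀ x : M, e v • x = 0

end Support

section Extension

variable {A B V E V' E' : Type} [Ring A] [Ring B] {src tgt : E → V}
  {src' tgt' : E' → V'} {iV : V' → V} {iE : E' → E}

theorem map_pprod (f : A →+* B) (e : V → A) (x : E → A) {a b : V} (p : QPath src tgt a b) :
    f (pprod e x p) = pprod (fun v => f (e v)) (fun α => f (x α)) p := by
  induction p with
  | nil => rw [pprod_nil, pprod_nil]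
  | cons p α h ih => rw [pprod_cons, pprod_cons, map_mul, ih]

theorem IsQuiverSystem.extend [Fintype V] [Fintype V'] {e' : V' → B} {x' : E' → B}
    (S : IsQuiverSystem src' tgt' e' x') (hiV : Function.Injective iV)
    (hiE : Function.Injective iE) (hs : ∀ β, src (iE β) = iV (src' β))
    (ht : ∀ β, tgt (iE β) = iV (tgt' β)) :
    IsQuiverSystem src tgt (Function.extend iV e' 0) (Function.extend iE x' 0) where
  idem a := by
    by_cases h : ∃ a', iV a' = a
    · obtain ⟨a, rfl⟩ := h
      rw [hiV.extend_apply, S.idem]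
    · rw [Function.extend_apply' _ _ _ h]; simp
  orth a b hab := by
    by_cases h : ∃ a', iV a' = a
    · obtain ⟨a, rfl⟩ := h
      by_cases h : ∃ b', iV b' = b
      · obtain ⟨b, rfl⟩ := h
        rw [hiV.extend_apply, hiV.extend_apply, S.orth]
        rintro rfl
        exact hab rfl
      · rw [Function.extend_apply' _ _ b h]; simp
    · rw [Function.extend_apply' _ _ a h]; simp
  sum := by
    rw [← S.sum]
    symm
    refine Fintype.sum_of_injective iV hiV _ _ (fun v hv => ?_) fun v => ?_
    · rw [Function.extend_apply' _ _ v hv]; rfl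
    · rw [hiV.extend_apply]
  left α := by
    by_cases h : ∃ a', iE a' = α
    · obtain ⟨α, rfl⟩ := h
      rw [hiE.extend_apply, ht, hiV.extend_apply, S.left]
    · rw [Function.extend_apply' _ _ α h]; simp
  right α := by
    by_cases h : ∃ a', iE a' = α
    · obtain ⟨α, rfl⟩ := h
      rw [hiE.extend_apply, hs, hiV.extend_apply, S.right]
    · rw [Function.extend_apply' _ _ α h]; simp

theorem pprod_eq_zero_of_mem {e : V → B} {x : E → B} {β : E} (hβ : x β = 0) {a b : V}
    (p : QPath src tgt a b) (hp : β ∈ p.arrows) : pprod e x p = 0 := by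
  induction p with
  | nil => simp [QPath.arrows] at hp
  | cons p α h ih =>
    simp only [QPath.arrows, List.mem_append, List.mem_singleton] at hp
    rw [pprod_cons]
    rcases hp with hp | rfl
    · rw [ih hp, mul_zero]
    · rw [hβ, zero_mul]

theorem QPath.exists_lift (hiV : Function.Injective iV)
    (hs : ∀ β, src (iE β) = iV (src' β)) (ht : ∀ β, tgt (iE β) = iV (tgt' β))
    (hiE : Function.Injective iE) (e' : V' → B) (x' : E' → B) {a b : V}
    (p : QPath src tgt a b) (hp : ∀ β ∈ p.arrows, β ∈ Set.range iE) (ha : a ∈ Set.range iV) :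
    ∃ (a' b' : V') (p' : QPath src' tgt' a' b'), iV b' = b ∧
      pprod e' x' p' = pprod (Function.extend iV e' 0) (Function.extend iE x' 0) p := by
  induction p with
  | nil =>
    obtain ⟨a, rfl⟩ := ha
    exact ⟨a, a, .nil a, rfl, by rw [pprod_nil, pprod_nil, hiV.extend_apply]⟩
  | cons p α h ih =>
    simp only [QPath.arrows, List.mem_append, List.mem_singleton] at hp
    obtain ⟨a', b', p', hb, hp'⟩ := ih fun β hβ => hp β (Or.inl hβ)
    obtain ⟨α, rfl⟩ := hp α (Or.inr rfl)
    refine ⟨a', tgt' α, .cons p' α (hiV ?_), (ht α).symm, ?_⟩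
    · rw [← hs, h, hb]
    · rw [pprod_cons, pprod_cons, hp', hiE.extend_apply]

theorem QPath.nonempty_map (hs : ∀ β, src (iE β) = iV (src' β))
    (ht : ∀ β, tgt (iE β) = iV (tgt' β)) {a b : V'} (p : QPath src' tgt' a b) :
    Nonempty (QPath src tgt (iV a) (iV b)) := by
  induction p with
  | nil => exact ⟨.nil _⟩
  | cons p α h ih =>
    obtain ⟨q⟩ := ih
    rw [← ht]
    exact ⟨.cons q (iE α) (by rw [hs, h])⟩

theorem IsQuiverSystem.pprod_smul_eq_zero [Fintype V] {e : V → A} {x : E → A}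
    (S : IsQuiverSystem src tgt e x) {U : Set V} {M : ModuleCat.{0} A} (hM : SuppIn e U M) {β : E}
    (hβ : ¬ (src β ∈ U ∧ tgt β ∈ U)) {a b : V} (p : QPath src tgt a b) (hp : β ∈ p.arrows)
    (m : M) : pprod e x p • m = 0 := by
  induction p with
  | nil => simp [QPath.arrows] at hp
  | cons p α h ih =>
    simp only [QPath.arrows, List.mem_append, List.mem_singleton] at hp
    rw [pprod_cons, mul_smul]
    rcases hp with hp | rfl
    · rw [ih hp, smul_zero]
    · by_cases h1 : src β ∈ U
      · rw [← S.left, mul_smul, hM _ fun h2 => hβ ⟨h1, h2⟩]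
      · rw [← S.right, mul_smul, hM _ h1, smul_zero]

end Extension

section Hom

variable {k A B V E V' E' : Type} [Field k] [Ring A] [Ring B] [Algebra k A] [Algebra k B]
  [Fintype V] [Fintype V'] {src tgt : E → V} {src' tgt' : E' → V'} {iV : V' → V} {iE : E' → E}
  {e : V → A} {x : E → A} {e' : V' → B} {x' : E' → B}

/-- The surjection of a bound tree algebra onto the algebra of a subquiver. -/
theorem IsHerSystem.exists_surjection (S : IsQuiverSystem src tgt e x)
    (htree : HasPotentials src tgt)
    (hgen : Algebra.adjoin k (Set.range e ∪ Set.range x) = ⊤) (S' : IsHerSystem k src' tgt' e' x')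
    (hiV : Function.Injective iV) (hiE : Function.Injective iE)
    (hs : ∀ β, src (iE β) = iV (src' β)) (ht : ∀ β, tgt (iE β) = iV (tgt' β))
    (hfull : ∀ β, src β ∈ Set.range iV → tgt β ∈ Set.range iV → β ∈ Set.range iE)
    (hzero : ∀ (a b : V) (p : QPath src tgt a b), pprod e x p = 0 →
      ∃ β ∈ p.arrows, β ∉ Set.range iE) :
    ∃ φ : A →ₐ[k] B, Function.Surjective φ ∧ (∀ v, φ (e v) = Function.extend iV e' 0 v) ∧
      ∀ M : ModuleCat.{0} A, SuppIn e (Set.range iV) M ↔ KilledBy (φ : A →+* B) M := by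
  set e₁ := Function.extend iV e' 0 with he₁
  set x₁ := Function.extend iE x' 0 with hx₁
  have S₁ : IsQuiverSystem src tgt e₁ x₁ := S'.toIsQuiverSystem.extend hiV hiE hs ht
  let s : Set (A × B) := Set.range (fun v => (e v, e₁ v)) ∪ Set.range (fun α => (x α, x₁ α))
  let D := Algebra.adjoin k s
  let eD : V → D := fun v => ⟨(e v, e₁ v), Algebra.subset_adjoin (Or.inl ⟨v, rfl⟩)⟩
  let xD : E → D := fun α => ⟨(x α, x₁ α), Algebra.subset_adjoin (Or.inr ⟨α, rfl⟩)⟩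
  let p₁ : D →ₐ[k] A := (AlgHom.fst k A B).comp D.val
  let p₂ : D →ₐ[k] B := (AlgHom.snd k A B).comp D.val
  have hext : ∀ d d' : D, p₁ d = p₁ d' → p₂ d = p₂ d' → d = d' := fun d d' h1 h2 =>
    Subtype.ext (Prod.ext h1 h2)
  have h1e : ∀ v, p₁ (eD v) = e v := fun v => rfl
  have h2e : ∀ v, p₂ (eD v) = e₁ v := fun v => rfl
  have h1x : ∀ α, p₁ (xD α) = x α := fun v => rfl
  have h2x : ∀ α, p₂ (xD α) = x₁ α := fun v => rfl
  have SD : IsQuiverSystem src tgt eD xD :=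
    { idem := fun a => hext _ _ (by rw [map_mul, h1e, S.idem]) (by rw [map_mul, h2e, S₁.idem])
      orth := fun a b h => hext _ _ (by rw [map_mul, h1e, h1e, S.orth a b h, map_zero])
        (by rw [map_mul, h2e, h2e, S₁.orth a b h, map_zero])
      sum := hext _ _ (by simp only [map_sum, h1e, S.sum, map_one])
        (by simp only [map_sum, h2e, S₁.sum, map_one])
      left := fun a => hext _ _ (by rw [map_mul, h1e, h1x, S.left])
        (by rw [map_mul, h2e, h2x, S₁.left])
      right := fun a => hext _ _ (by rw [map_mul, h1e, h1x, S.right])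
        (by rw [map_mul, h2e, h2x, S₁.right]) }
  have hgD : Algebra.adjoin k (Set.range eD ∪ Set.range xD) = ⊤ := by
    rw [← Algebra.adjoin_adjoin_coe_preimage (R := k) (s := s)]
    congr 1
    ext d
    constructor
    · rintro (⟨v, rfl⟩ | ⟨v, rfl⟩)
      exacts [Or.inl ⟨v, rfl⟩, Or.inr ⟨v, rfl⟩]
    · rintro (⟨v, h⟩ | ⟨v, h⟩)
      exacts [Or.inl ⟨v, Subtype.ext h⟩, Or.inr ⟨v, Subtype.ext h⟩]
  have hp1 : ∀ {a b : V} (p : QPath src tgt a b), p₁ (pprod eD xD p) = pprod e x p := fun p =>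
    map_pprod (p₁ : D →+* A) eD xD p
  have hp2 : ∀ {a b : V} (p : QPath src tgt a b), p₂ (pprod eD xD p) = pprod e₁ x₁ p := fun p =>
    map_pprod (p₂ : D →+* B) eD xD p
  have hout : ∀ {β : E}, β ∉ Set.range iE → x₁ β = 0 := fun {β} h => by
    rw [hx₁, Function.extend_apply' _ _ _ h]; rfl
  have hinj : Function.Injective p₁ := by
    rw [injective_iff_map_eq_zero]
    intro d hd
    rw [SD.sum_sandwich d]
    refine Finset.sum_eq_zero fun b _ => Finset.sum_eq_zero fun a _ => ?_
    rcases isEmpty_or_nonempty (QPath src tgt a b) with h | ⟨⟨p⟩⟩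
    · exact SD.sandwich_eq_zero hgD h d
    · obtain ⟨r, hr⟩ := SD.exists_sandwich_eq_smul htree hgD p d
      have h0 : r • pprod e x p = 0 := by
        rw [← hp1, ← map_smul, ← hr, map_mul, map_mul, hd]; simp
      rw [hr]
      by_cases hr0 : r = 0
      · rw [hr0, zero_smul]
      · have h1 := (smul_eq_zero.1 h0).resolve_left hr0
        obtain ⟨β, hβ, hβ'⟩ := hzero _ _ p h1
        have h2 : pprod eD xD p = 0 := hext _ _ (by rw [hp1, h1, map_zero])
          (by rw [hp2, pprod_eq_zero_of_mem (hout hβ') p hβ, map_zero])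
        rw [h2, smul_zero]
  have hsurj : Function.Surjective p₁ := by
    rw [← AlgHom.range_eq_top, eq_top_iff, ← hgen]
    refine Algebra.adjoin_le ?_
    rintro _ (⟨v, rfl⟩ | ⟨v, rfl⟩)
    exacts [⟨eD v, rfl⟩, ⟨xD v, rfl⟩]
  let ψ := AlgEquiv.ofBijective p₁ ⟨hinj, hsurj⟩
  let φ : A →ₐ[k] B := p₂.comp (ψ.symm : A →ₐ[k] D)
  have hφ : ∀ d, φ (p₁ d) = p₂ d := fun d => congrArg p₂ (ψ.symm_apply_apply d)
  have hφe : ∀ v, φ (e v) = e₁ v := fun v => hφ (eD v)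
  have hφx : ∀ v, φ (x v) = x₁ v := fun v => hφ (xD v)
  have hφp : ∀ {a b : V} (p : QPath src tgt a b), φ (pprod e x p) = pprod e₁ x₁ p := fun p => by
    rw [← hp1, hφ, hp2]
  refine ⟨φ, ?_, hφe, fun M => ⟨fun hM a ha m => ?_, fun hM v hv m => hM _ ?_ m⟩⟩
  · rw [← AlgHom.range_eq_top, eq_top_iff, ← S'.gen]
    refine Algebra.adjoin_le ?_
    rintro _ (⟨v, rfl⟩ | ⟨v, rfl⟩)
    · exact ⟨e (iV v), (hφe _).trans (hiV.extend_apply _ _ _)⟩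
    · exact ⟨x (iE v), (hφx _).trans (hiE.extend_apply _ _ _)⟩
  · rw [S.sum_sandwich a, Finset.sum_smul]
    refine Finset.sum_eq_zero fun b _ => ?_
    rw [Finset.sum_smul]
    refine Finset.sum_eq_zero fun c _ => ?_
    by_cases hc : c ∈ Set.range iV
    · rcases isEmpty_or_nonempty (QPath src tgt c b) with h | ⟨⟨p⟩⟩
      · rw [S.sandwich_eq_zero hgen h, zero_smul]
      · obtain ⟨r, hr⟩ := S.exists_sandwich_eq_smul htree hgen p a
        rw [hr]
        by_cases hp : ∀ β ∈ p.arrows, β ∈ Set.range iE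
        · obtain ⟨c', b', p', -, hp'⟩ := QPath.exists_lift hiV hs ht hiE e' x' p hp hc
          have h0 : r • pprod e' x' p' = 0 := by
            rw [hp', ← he₁, ← hx₁, ← hφp, ← map_smul, ← hr, map_mul, map_mul]
            rw [show φ a = 0 from ha]; simp
          rw [(smul_eq_zero.1 h0).resolve_right (S'.pprod_ne_zero p'), zero_smul, zero_smul]
        · push Not at hp
          obtain ⟨β, hβ, hβ'⟩ := hp
          rw [Algebra.smul_def, mul_smul,
            S.pprod_smul_eq_zero hM (fun h => hβ' (hfull β h.1 h.2)) p hβ, smul_zero]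
    · rw [mul_smul, hM c hc, smul_zero]
  · change φ (e v) = 0
    rw [hφe, he₁, Function.extend_apply' _ _ _ hv]; rfl

end Hom

section RelIndex

variable {k A B V E V' E' : Type} [Field k] [Ring A] [Ring B] [Algebra k A] [Algebra k B]
  [Fintype V] [Fintype V'] {src tgt : E → V} {src' tgt' : E' → V'} {iV : V' → V} {iE : E' → E}
  {e : V → A} {x : E → A} {e' : V' → B} {x' : E' → B}

/-- The number `r` is the nilpotency index of the radical of the modules supported on `U`, and
the radical behaves as over a hereditary tree algebra. -/
structure RelIndex (src tgt : E → V) (e : V → A) (U : Set V) (r : ℕ) : Prop where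
  vanish : ∀ X Y : ModuleCat.{0} A, Module.Finite A X → Module.Finite A Y → SuppIn e U X →
    SuppIn e U Y → ∀ f ∈ relPow (SuppIn e U) r X Y, f = 0
  le : ∀ n, (∀ X Y : ModuleCat.{0} A, Module.Finite A X → Module.Finite A Y → SuppIn e U X →
    SuppIn e U Y → ∀ f ∈ relPow (SuppIn e U) n X Y, f = 0) → r ≤ n
  through : ∀ (Z : ModuleCat.{0} A) (c : V) (z : Z), FinIndec A Z → SuppIn e U Z → e c • z ≠ 0 →
    ∃ (P I : ModuleCat.{0} A) (p : P ⟶ Z) (q : Z ⟶ I) (a b : ℕ) (w : P), Module.Finite A P ∧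
      Module.Finite A I ∧ SuppIn e U P ∧ SuppIn e U I ∧ p.hom w = e c • z ∧
      q.hom (e c • z) ≠ 0 ∧ p ∈ relPow (SuppIn e U) a P Z ∧ q ∈ relPow (SuppIn e U) b Z I ∧
      a + b + 1 = r
  proj : ∀ c ∈ U, ∃ (Z : ModuleCat.{0} A) (z : Z), FinIndec A Z ∧ SuppIn e U Z ∧ e c • z = z ∧
    z ≠ 0 ∧ (∀ v, ∀ y : Z, e v • y ≠ 0 → Nonempty (QPath src tgt c v)) ∧
    (∀ X : ModuleCat.{0} A, SuppIn e U X → ∀ w : X, ∃ g : Z ⟶ X, g.hom z = e c • w) ∧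
    ∀ g : Z ⟶ Z, g.hom z = z → g = 𝟙 Z

theorem IsHerSystem.relIndex [Fintype E'] [FiniteDimensional k B] (S : IsQuiverSystem src tgt e x)
    (htree : HasPotentials src tgt)
    (hgen : Algebra.adjoin k (Set.range e ∪ Set.range x) = ⊤) (S' : IsHerSystem k src' tgt' e' x')
    (hiV : Function.Injective iV) (hiE : Function.Injective iE)
    (hs : ∀ β, src (iE β) = iV (src' β)) (ht : ∀ β, tgt (iE β) = iV (tgt' β))
    (hfull : ∀ β, src β ∈ Set.range iV → tgt β ∈ Set.range iV → β ∈ Set.range iE)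
    (hzero : ∀ (a b : V) (p : QPath src tgt a b), pprod e x p = 0 →
      ∃ β ∈ p.arrows, β ∉ Set.range iE)
    (hconn : ConnFun src' tgt') (hrf : RepFinite A) {r : ℕ} (hr : NilpotencyIndex B r) :
    RelIndex src tgt e (Set.range iV) r := by
  have := IsArtinianRing.of_finite k B
  obtain ⟨φ, hφ, hφe, hS⟩ := IsHerSystem.exists_surjection S htree hgen S' hiV hiE hs ht hfull hzero
  have hφ' : Function.Surjective (φ : A →+* B) := hφ
  have hSe : SuppIn e (Set.range iV) = KilledBy (φ : A →+* B) := funext fun M => propext (hS M)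
  have hV : ∀ n, RadVanishes B n ↔ ∀ X Y : ModuleCat.{0} A, Module.Finite A X →
      Module.Finite A Y → SuppIn e (Set.range iV) X → SuppIn e (Set.range iV) Y →
      ∀ f ∈ relPow (SuppIn e (Set.range iV)) n X Y, f = 0 := fun n => by
    rw [radVanishes_iff_relPow hφ', hSe]
  have hφc : ∀ c, φ (e (iV c)) = e' c := fun c => (hφe _).trans (hiV.extend_apply _ _ _)
  refine ⟨(hV r).1 hr.2.1, fun n h => hr.2.2 n ((hV n).2 h), ?_, ?_⟩
  · intro Z c z hZ hZS hz
    have hc : c ∈ Set.range iV := by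
      by_contra hc
      exact hz (hZS c hc z)
    obtain ⟨c, rfl⟩ := hc
    obtain ⟨N, ⟨i⟩⟩ := ((hS Z).1 hZS).exists_iso hφ'
    have hN : FinIndec B N := (finIndec_resFun_iff hφ').1 (finIndec_of_iso i.symm hZ)
    have hiz : ∀ y, i.hom.hom (i.inv.hom y) = y := fun y =>
      congrArg (fun g : Z ⟶ Z => g.hom y) i.inv_hom_id
    let y : N := i.inv.hom z
    have hy : (e' c • y : N) = i.inv.hom (e (iV c) • z) := by
      rw [map_smul]
      change e' c • y = φ (e (iV c)) • y
      rw [hφc]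
    have hy0 : e' c • y ≠ 0 := fun h0 => hz (by
      rw [← hiz (e (iV c) • z), ← hy, h0]
      exact map_zero i.hom.hom)
    obtain ⟨P, I, p, q, a, b, w, hP, hI, hp, hq, ha, hb, hab⟩ :=
      S'.exists_through hconn (repFinite_of_surjective hφ' hrf) hr hN hy0
    refine ⟨(resFun (φ : A →+* B)).obj P, (resFun (φ : A →+* B)).obj I,
      (resFun (φ : A →+* B)).map p ≫ i.hom,
      i.inv ≫ (resFun (φ : A →+* B)).map q, a, b, w, (finite_resFun_iff hφ').2 hP,
      (finite_resFun_iff hφ').2 hI, (hS _).2 (killedBy_resFun _ P),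
      (hS _).2 (killedBy_resFun _ I), ?_, ?_, ?_, ?_, hab⟩
    · change i.hom.hom (p.hom w) = _
      rw [hp, hy, hiz]
    · change q.hom (i.inv.hom (e (iV c) • z)) ≠ 0
      rwa [← hy]
    · rw [hSe]
      exact relPow_comp_right (map_mem_relPow hφ' ha) _
    · rw [hSe]
      exact relPow_comp_left _ (map_mem_relPow hφ' hb)
  · rintro _ ⟨c, rfl⟩
    have hres : ∀ {X : ModuleCat.{0} B} (a : A) (y : X),
        (a • (show (resFun (φ : A →+* B)).obj X from y) : (resFun (φ : A →+* B)).obj X) =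
          (φ a • y : X) := fun a y => rfl
    have hgc : e' c • projGen (S'.idem c) = projGen (S'.idem c) := smul_gen _
    have hg0 : projGen (S'.idem c) ≠ 0 := fun h0 => by
      have h1 := congrArg (projVal (e' c)) h0
      rw [projVal_gen, map_zero] at h1
      exact S'.idem_ne c h1
    refine ⟨(resFun (φ : A →+* B)).obj (projObj (e' c)), projGen (S'.idem c),
      (finIndec_resFun_iff hφ').2 (S'.finIndec_projObj c),
      (hS _).2 (killedBy_resFun _ _), ?_, hg0, ?_, ?_, ?_⟩
    · change φ (e (iV c)) • projGen (S'.idem c) = projGen (S'.idem c)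
      rw [hφc, hgc]
    · intro v y hy
      change φ (e v) • (show projObj (e' c) from y) ≠ 0 at hy
      by_cases hv : v ∈ Set.range iV
      · obtain ⟨v, rfl⟩ := hv
        rw [hφc] at hy
        have h1 : e' v * projVal (e' c) (show projObj (e' c) from y) * e' c ≠ 0 := fun h0 => hy (by
          apply projVal_ext
          rw [map_smul, map_zero, smul_eq_mul, ← h0, mul_assoc, projVal_mul])
        obtain ⟨p⟩ := S'.nonempty_path_of_ne S'.gen h1
        exact QPath.nonempty_map hs ht p
      · rw [hφe, Function.extend_apply' _ _ _ hv] at hy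
        exact absurd (zero_smul _ _) hy
    · intro X hX w
      obtain ⟨N, ⟨i⟩⟩ := ((hS X).1 hX).exists_iso hφ'
      have hiz : ∀ y, i.hom.hom (i.inv.hom y) = y := fun y =>
        congrArg (fun g : X ⟶ X => g.hom y) i.inv_hom_id
      refine ⟨(resFun (φ : A →+* B)).map (projMap (e' c) (show N from i.inv.hom w)) ≫ i.hom, ?_⟩
      change i.hom.hom ((projMap (e' c) (show N from i.inv.hom w)).hom (projGen (S'.idem c))) = _
      rw [projMap_gen, ← hφc]
      change i.hom.hom (e (iV c) • i.inv.hom w) = _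
      rw [map_smul, hiz]
    · intro g hg
      obtain ⟨h, rfl⟩ := exists_resFun_map hφ' g
      have : h = 𝟙 _ := hom_ext_gen (S'.idem c) hg
      rw [this, CategoryTheory.Functor.map_id]

end RelIndex

section Complement

variable {k M : Type} [Field k] [AddCommGroup M] [Module k M]

/-- Compatible complements of a subspace along a chain of linear maps. -/
theorem exists_chain_complement (n : ℕ) (F : ℕ → Submodule k M) (N : Submodule k M)
    (T : ℕ → M →ₗ[k] M) (hT : ∀ i, i + 1 < n → ∀ m ∈ F i, T i m ∈ F (i + 1))
    (hN : ∀ i, i + 1 < n → ∀ m ∈ F i, T i m ∈ N → m ∈ N) :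
    ∃ W : ℕ → Submodule k M, ∀ i, W i ≤ F i ∧ Disjoint (W i) N ∧ F i ≤ W i ⊔ N ∧
      (i + 1 < n → ∀ m ∈ W i, T i m ∈ W (i + 1)) := by
  let G : ℕ → Submodule k M → Prop := fun i W => W ≤ F i ∧ Disjoint W N ∧ F i ≤ W ⊔ N
  have ext : ∀ i D, D ≤ F i → Disjoint D N → ∃ W, D ≤ W ∧ G i W := fun i D hD hDN => by
    obtain ⟨C, hDC, hC⟩ := (hDN.mono_right (inf_le_right (a := F i))).exists_isCompl
    refine ⟨C ⊓ F i, le_inf hDC hD, inf_le_right, ?_, ?_⟩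
    · rw [disjoint_iff, inf_assoc]
      exact hC.inf_eq_bot
    · have h1 : (C ⊓ F i) ⊔ (F i ⊓ N) = F i := by
        rw [inf_comm, inf_sup_assoc_of_le C inf_le_left, hC.sup_eq_top, inf_top_eq]
      calc F i = (C ⊓ F i) ⊔ (F i ⊓ N) := h1.symm
        _ ≤ _ := sup_le_sup_left inf_le_right _
  have step : ∀ i W, G i W → ∃ W', G (i + 1) W' ∧ (i + 1 < n → ∀ m ∈ W, T i m ∈ W') := by
    intro i W hW
    by_cases hi : i + 1 < n
    · obtain ⟨W', h1, h2⟩ := ext (i + 1) (W.map (T i)) (by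
        rintro _ ⟨m, hm, rfl⟩
        exact hT i hi m (hW.1 hm)) (by
        rw [Submodule.disjoint_def]
        rintro _ ⟨m, hm, rfl⟩ hmN
        rw [(Submodule.disjoint_def.1 hW.2.1) m hm (hN i hi m (hW.1 hm) hmN), map_zero])
      exact ⟨W', h2, fun _ m hm => h1 ⟨m, hm, rfl⟩⟩
    · obtain ⟨W', -, h2⟩ := ext (i + 1) ⊥ bot_le disjoint_bot_left
      exact ⟨W', h2, fun h => absurd h hi⟩
  obtain ⟨W₀, -, hW₀⟩ := ext 0 ⊥ bot_le disjoint_bot_left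
  choose f hf hf' using step
  let W : ∀ i : ℕ, {W // G i W} := fun i =>
    Nat.rec ⟨W₀, hW₀⟩ (fun i W => ⟨f i W.1 W.2, hf i W.1 W.2⟩) i
  exact ⟨fun i => (W i).1, fun i => ⟨(W i).2.1, (W i).2.2.1, (W i).2.2.2,
    hf' i (W i).1 (W i).2⟩⟩

end Complement

section Splitting

variable {k A V E : Type} [Field k] [Ring A] [Algebra k A] [Fintype V] [Fintype E]
  {src tgt : E → V} {e : V → A} {x : E → A}

/-- The product of the first arrows of a chain. -/
def chainProd (x : E → A) (γ : ℕ → E) : ℕ → A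
  | 0 => x (γ 0)
  | i + 1 => x (γ (i + 1)) * chainProd x γ i

omit [Fintype V] [Fintype E] in
theorem ChainShape.pprod_cases {n : ℕ} {γ : ℕ → E} {U₁ U₂ : Set V}
    (C : ChainShape src tgt n γ U₁ U₂) (hzero : chainProd x γ n = 0)
    {v b : V} (hv : v ∉ U₁) (p : QPath src tgt v b) :
    b ∉ U₁ ∨ (∃ i < n, b = src (γ (i + 1)) ∧ ∃ y, pprod e x p = chainProd x γ i * y) ∨
      pprod e x p = 0 := by
  induction p with
  | nil => exact Or.inl hv
  | cons p α h ih =>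
    subst h
    rw [pprod_cons]
    rcases ih with h | ⟨i, hi, hb, y, hy⟩ | h
    · by_cases hα : tgt α ∈ U₁
      · obtain rfl := C.cross₁ α h hα
        exact Or.inr (Or.inl ⟨0, C.pos, (C.chain 0 C.pos).symm, _, rfl⟩)
      · exact Or.inl hα
    · obtain rfl := C.out α i hi hb
      have h1 : x (γ (i + 1)) * (chainProd x γ i * y) = chainProd x γ (i + 1) * y :=
        (mul_assoc _ _ _).symm
      rw [hy, h1]
      rcases Nat.lt_or_ge (i + 1) n with h | h
      · exact Or.inr (Or.inl ⟨i + 1, h, (C.chain (i + 1) h).symm, y, rfl⟩)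
      · obtain rfl : i + 1 = n := by omega
        exact Or.inr (Or.inr (by rw [hzero, zero_mul]))
    · exact Or.inr (Or.inr (by rw [h, mul_zero]))

variable (S : IsQuiverSystem src tgt e x) (htree : HasPotentials src tgt)
  (hgen : Algebra.adjoin k (Set.range e ∪ Set.range x) = ⊤)
  {n : ℕ} {γ : ℕ → E} {U₁ U₂ : Set V} (C : ChainShape src tgt n γ U₁ U₂)
  (hzero : chainProd x γ n = 0)

include S htree hgen C hzero in
theorem ChainShape.sandwich_eq_zero {v w : V} (hv : v ∉ U₁) (hw : w ∉ U₂) (a : A) :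
    e w * a * e v = 0 := by
  rcases isEmpty_or_nonempty (QPath src tgt v w) with h | ⟨⟨p⟩⟩
  · exact S.sandwich_eq_zero hgen h a
  · obtain ⟨r, hr⟩ := S.exists_sandwich_eq_smul htree hgen p a
    rcases C.pprod_cases (e := e) hzero hv p with h | ⟨i, hi, hb, -⟩ | h
    · exact absurd (C.cover w h) hw
    · exact absurd ((C.mem_iff w).2 ⟨i, hi, hb⟩).2 hw
    · rw [hr, h, smul_zero]

/-- The largest submodule supported on `U`. -/
def suppSub (e : V → A) (U : Set V) (M : Type) [AddCommGroup M] [Module A M] :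
    Submodule A M where
  carrier := {m | ∀ v ∉ U, ∀ a : A, e v • a • m = 0}
  add_mem' := fun hm hm' v hv a => by rw [smul_add, smul_add, hm v hv, hm' v hv, add_zero]
  zero_mem' := fun v _ a => by rw [smul_zero, smul_zero]
  smul_mem' := fun b m hm v hv a => by
    rw [smul_smul a b m]
    exact hm v hv _

include S htree hgen C hzero in
/-- The largest submodule supported on `U₂` has a complement supported on `U₁`. -/
theorem ChainShape.exists_isCompl (M : Type) [AddCommGroup M] [Module k M] [Module A M]
    [IsScalarTower k A M] :
    ∃ N : Submodule A M, IsCompl (suppSub e U₂ M) N ∧ ∀ v ∉ U₁, ∀ m ∈ N, e v • m = 0 := by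
  have hs : ∀ m : M, m = ∑ v, e v • m := fun m => by
    rw [← Finset.sum_smul, S.sum, one_smul]
  have hee : ∀ v (m : M), e v • e v • m = e v • m := fun v m => by rw [smul_smul, S.idem]
  have hoe : ∀ v w, v ≠ w → ∀ m : M, e v • e w • m = 0 := fun v w h m => by
    rw [smul_smul, S.orth v w h, zero_smul]
  have hxs : ∀ β (m : M), x β • e (src β) • m = x β • m := fun β m => by rw [smul_smul, S.right]
  have hex : ∀ β (m : M), e (tgt β) • x β • m = x β • m := fun β m => by rw [smul_smul, S.left]
  have hin : ∀ i < n, src (γ (i + 1)) ∈ U₁ ∧ src (γ (i + 1)) ∈ U₂ := fun i hi =>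
    (C.mem_iff _).2 ⟨i, hi, rfl⟩
  let F : ℕ → Submodule k M := fun i => LinearMap.range (Algebra.lsmul k k M (e (src (γ (i + 1)))))
  have hF : ∀ i m, m ∈ F i ↔ e (src (γ (i + 1))) • m = m := fun i m =>
    ⟨by rintro ⟨m, rfl⟩; exact hee _ m, fun h => ⟨m, h⟩⟩
  let N : Submodule k M := (suppSub e U₂ M).restrictScalars k
  let T : ℕ → M →ₗ[k] M := fun i => Algebra.lsmul k k M (x (γ (i + 1)))
  obtain ⟨W, hW⟩ := exists_chain_complement n F N T (fun i hi m hm => by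
      rw [hF]
      change e (src (γ (i + 1 + 1))) • x (γ (i + 1)) • m = x (γ (i + 1)) • m
      rw [C.chain (i + 1) hi, hex]) (fun i hi m hm hmN => by
      rw [hF] at hm
      intro v hv a
      obtain ⟨r, z, hz⟩ := S.exists_mul_idem_eq hgen (src (γ (i + 1))) a
      rw [← hm, smul_smul a, hz, add_smul, smul_add]
      have h1 : e v • (r • e (src (γ (i + 1)))) • m = 0 := by
        rw [smul_smul, mul_smul_comm, S.orth, smul_zero, zero_smul]
        rintro rfl
        exact hv (hin i (by omega)).2
      rw [h1, zero_add, Finset.sum_smul, Finset.smul_sum]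
      refine Finset.sum_eq_zero fun β hβ => ?_
      obtain rfl := C.out β i (by omega) (Finset.mem_filter.1 hβ).2
      rw [mul_smul]
      exact hmN v hv _)
  let Q : Set M := {m | (∀ v ∉ U₁, e v • m = 0) ∧ ∀ i < n, e (src (γ (i + 1))) • m ∈ W i}
  have hQa : ∀ m ∈ Q, ∀ m' ∈ Q, m + m' ∈ Q := fun m hm m' hm' =>
    ⟨fun v hv => by rw [smul_add, hm.1 v hv, hm'.1 v hv, add_zero], fun i hi => by
      rw [smul_add]
      exact (W i).add_mem (hm.2 i hi) (hm'.2 i hi)⟩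
  have hQ0 : (0 : M) ∈ Q := ⟨fun v _ => smul_zero _, fun i _ => by
    rw [smul_zero]
    exact (W i).zero_mem⟩
  have hQs : ∀ (a : A), ∀ m ∈ Q, a • m ∈ Q := by
    intro a
    have ha : a ∈ Algebra.adjoin k (Set.range e ∪ Set.range x) := by rw [hgen]; trivial
    induction ha using Algebra.adjoin_induction with
    | mem a ha =>
      intro m hm
      rcases ha with ⟨v, rfl⟩ | ⟨β, rfl⟩
      · refine ⟨fun w hw => ?_, fun i hi => ?_⟩
        · by_cases h : w = v
          · subst h; rw [hee, hm.1 _ hw]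
          · exact hoe _ _ h m
        · by_cases h : src (γ (i + 1)) = v
          · subst h; rw [hee]; exact hm.2 i hi
          · rw [hoe _ _ h]; exact (W i).zero_mem
      · refine ⟨fun w hw => ?_, fun i hi => ?_⟩
        · by_cases h : w = tgt β
          · subst h
            rw [hex, ← hxs, hm.1 _ (C.mono₁ β hw), smul_zero]
          · rw [← hex, hoe _ _ h]
        · by_cases h : src (γ (i + 1)) = tgt β
          · obtain rfl := C.into β i hi h.symm
            rw [h, hex]
            rcases i with _ | j
            · rw [← hxs, hm.1 _ C.first, smul_zero]
              exact (W 0).zero_mem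
            · rw [← hxs]
              exact (hW j).2.2.2 hi _ (hm.2 j (by omega))
          · rw [← hex, hoe _ _ h]; exact (W i).zero_mem
    | algebraMap r =>
      intro m hm
      rw [algebraMap_smul]
      refine ⟨fun v hv => ?_, fun i hi => ?_⟩
      · rw [smul_comm, hm.1 v hv, smul_zero]
      · rw [smul_comm]
        exact (W i).smul_mem r (hm.2 i hi)
    | add a b _ _ ha hb => exact fun m hm => by rw [add_smul]; exact hQa _ (ha m hm) _ (hb m hm)
    | mul a b _ _ ha hb => exact fun m hm => by rw [mul_smul]; exact ha _ (hb m hm)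
  let R : Submodule A M :=
    { carrier := Q
      add_mem' := fun h h' => hQa _ h _ h'
      zero_mem' := hQ0
      smul_mem' := fun a m hm => hQs a m hm }
  refine ⟨R, ⟨?_, ?_⟩, fun v hv m hm => hm.1 v hv⟩
  · rw [Submodule.disjoint_def]
    intro m hm hmQ
    rw [hs m]
    refine Finset.sum_eq_zero fun v _ => ?_
    by_cases h1 : v ∈ U₁
    · by_cases h2 : v ∈ U₂
      · obtain ⟨i, hi, rfl⟩ := (C.mem_iff v).1 ⟨h1, h2⟩
        exact Submodule.disjoint_def.1 (hW i).2.1 _ (hmQ.2 i hi)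
          ((suppSub e U₂ M).smul_mem _ hm)
      · have := hm v h2 1
        rwa [one_smul] at this
    · exact hmQ.1 v h1
  · rw [codisjoint_iff, eq_top_iff]
    intro m _
    rw [hs m]
    refine Submodule.sum_mem _ fun v _ => ?_
    by_cases h1 : v ∈ U₁
    · by_cases h2 : v ∈ U₂
      · obtain ⟨i, hi, rfl⟩ := (C.mem_iff v).1 ⟨h1, h2⟩
        obtain ⟨y, hy, z, hz, hyz⟩ := Submodule.mem_sup.1
          ((hW i).2.2.1 ((hF i _).2 (hee _ m)))
        rw [← hyz]
        have hy' := (hF i y).1 ((hW i).1 hy)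
        refine Submodule.add_mem _ (Submodule.mem_sup_right ⟨fun w hw => ?_, fun j hj => ?_⟩)
          (Submodule.mem_sup_left hz)
        · rw [← hy', hoe]
          rintro rfl
          exact hw h1
        · by_cases hij : j = i
          · subst hij; rwa [hy']
          · rw [← hy', hoe _ _ fun h => hij (C.inj j hj i hi h)]
            exact (W j).zero_mem
      · refine Submodule.mem_sup_right ⟨fun w hw => hoe _ _ (by rintro rfl; exact hw h1) m,
          fun i hi => ?_⟩
        rw [hoe _ _ (by rintro rfl; exact h2 (hin i hi).2)]
        exact (W i).zero_mem
    · refine Submodule.mem_sup_left fun w hw a => ?_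
      rw [smul_smul a, smul_smul, ← mul_assoc,
        C.sandwich_eq_zero S htree hgen hzero h1 hw, zero_smul]

end Splitting

section Glue

variable {A V E : Type} [Ring A] {src tgt : E → V} {e : V → A}

theorem SuppIn.of_injective {U : Set V} {M N : ModuleCat.{0} A} (hM : SuppIn e U M) (i : N ⟶ M)
    (hi : Function.Injective i.hom) : SuppIn e U N := fun v hv y => hi (by
  rw [map_smul, hM v hv, map_zero])

theorem SuppIn.of_surjective {U : Set V} {M N : ModuleCat.{0} A} (hM : SuppIn e U M) (p : M ⟶ N)
    (hp : Function.Surjective p.hom) : SuppIn e U N := fun v hv y => by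
  obtain ⟨m, rfl⟩ := hp y
  rw [← map_smul, hM v hv, map_zero]

theorem injective_of_retract {M N : ModuleCat.{0} A} {i : N ⟶ M} {p : M ⟶ N} (h : i ≫ p = 𝟙 N) :
    Function.Injective i.hom :=
  Function.LeftInverse.injective (g := p.hom) fun y => congrArg (fun g : N ⟶ N => g.hom y) h

theorem surjective_of_retract {M N : ModuleCat.{0} A} {i : N ⟶ M} {p : M ⟶ N} (h : i ≫ p = 𝟙 N) :
    Function.Surjective p.hom := fun y => ⟨i.hom y, congrArg (fun g : N ⟶ N => g.hom y) h⟩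

theorem suppIn_inter {U U' : Set V} {M : ModuleCat.{0} A} :
    SuppIn e (U ∩ U') M ↔ SuppIn e U M ∧ SuppIn e U' M :=
  ⟨fun h => ⟨fun v hv => h v fun hv' => hv hv'.1, fun v hv => h v fun hv' => hv hv'.2⟩,
    fun h v hv => by
      by_cases h1 : v ∈ U
      · exact h.2 v fun h2 => hv ⟨h1, h2⟩
      · exact h.1 v h1⟩

/-- The module `M` is the direct sum of a module supported on `U₁` and the largest submodule
supported on `U₂`. -/
def HasSplit (e : V → A) (U₁ U₂ : Set V) (M : ModuleCat.{0} A) : Prop :=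
  ∃ (T Q : ModuleCat.{0} A) (i : T ⟶ M) (p : M ⟶ T) (j : Q ⟶ M) (q : M ⟶ Q), i ≫ p = 𝟙 T ∧
    j ≫ q = 𝟙 Q ∧ p ≫ i + q ≫ j = 𝟙 M ∧ SuppIn e U₂ T ∧ SuppIn e U₁ Q ∧
    (∀ (X : ModuleCat.{0} A), SuppIn e U₂ X → ∀ f : X ⟶ M, f ≫ p ≫ i = f) ∧
    ∀ (X : ModuleCat.{0} A), SuppIn e U₂ X → ∀ f : X ⟶ Q, f = 0

theorem hasSplit_of_isCompl {U₁ U₂ : Set V} (M : ModuleCat.{0} A) {N : Submodule A M}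
    (h : IsCompl (suppSub e U₂ M) N) (hN : ∀ v ∉ U₁, ∀ m ∈ N, e v • m = 0) :
    HasSplit e U₁ U₂ M := by
  have hT : ∀ (X : ModuleCat.{0} A), SuppIn e U₂ X → ∀ (f : X ⟶ M) (y : X),
      f.hom y ∈ suppSub e U₂ M := fun X hX f y v hv a => by
    rw [← map_smul, ← map_smul, hX v hv, map_zero]
  refine ⟨ModuleCat.of A (suppSub e U₂ M), ModuleCat.of A N,
    ModuleCat.ofHom (suppSub e U₂ M).subtype,
    ModuleCat.ofHom (Submodule.projectionOnto _ _ h), ModuleCat.ofHom N.subtype,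
    ModuleCat.ofHom (Submodule.projectionOnto _ _ h.symm), ?_, ?_, ?_, ?_, ?_, ?_, ?_⟩
  · exact ModuleCat.hom_ext (LinearMap.ext fun y => Submodule.projectionOnto_apply_left h y)
  · exact ModuleCat.hom_ext (LinearMap.ext fun y => Submodule.projectionOnto_apply_left h.symm y)
  · refine ModuleCat.hom_ext (LinearMap.ext fun y => ?_)
    exact Submodule.projection_add_projection_eq_self h y
  · intro v hv y
    refine Subtype.ext ?_
    have := y.2 v hv 1
    rwa [one_smul] at this
  · exact fun v hv y => Subtype.ext (hN v hv y.1 y.2)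
  · intro X hX f
    refine ModuleCat.hom_ext (LinearMap.ext fun y => ?_)
    exact congrArg Subtype.val (Submodule.projectionOnto_apply_of_mem_left h (hT X hX f y))
  · intro X hX f
    refine ModuleCat.hom_ext (LinearMap.ext fun y => ?_)
    have h1 : (f.hom y).1 ∈ suppSub e U₂ M := hT X hX (f ≫ ModuleCat.ofHom N.subtype) y
    exact Subtype.ext (Submodule.disjoint_def.1 h.disjoint _ h1 (f.hom y).2)

variable {U₁ U₂ : Set V} (hsplit : ∀ M : ModuleCat.{0} A, Module.Finite A M → HasSplit e U₁ U₂ M)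

include hsplit in
theorem relPow_of_suppIn {P P' : ModuleCat.{0} A → Prop}
    (hP : ∀ (M N : ModuleCat.{0} A) (i : N ⟶ M), Function.Injective i.hom → P M →
      SuppIn e U₂ N → P' N) {n : ℕ} {X Y : ModuleCat.{0} A} (hX : SuppIn e U₂ X) {f : X ⟶ Y}
    (hf : f ∈ relPow P n X Y) : f ∈ relPow P' n X Y := by
  induction n generalizing X with
  | zero => trivial
  | succ n ih =>
    obtain ⟨M, g, h, hM, hPM, hg, hh, rfl⟩ := hf
    obtain ⟨T, Q, i, p, j, q, hip, -, -, hT, -, hfac, -⟩ := hsplit M hM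
    refine ⟨T, g ≫ p, i ≫ h, Module.Finite.of_surjective p.hom (surjective_of_retract hip),
      hP M T i (injective_of_retract hip) hPM hT, radSet_comp_right hg p,
      ih hT (relPow_comp_left i hh), ?_⟩
    conv_lhs => rw [← hfac X hX g]
    simp only [Category.assoc]

theorem RelIndex.lt {U : Set V} {r n : ℕ} (R : RelIndex src tgt e U r) {X Y : ModuleCat.{0} A}
    (hX : Module.Finite A X) (hY : Module.Finite A Y) (hXU : SuppIn e U X) (hYU : SuppIn e U Y)
    {f : X ⟶ Y} (hf : f ∈ relPow (SuppIn e U) n X Y) (x : X) (hx : f.hom x ≠ 0) : n < r := by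
  by_contra h
  rw [R.vanish X Y hX hY hXU hYU f (relPow_mono_right (not_lt.1 h) hf)] at hx
  exact hx rfl

variable {r₁ r₂ r₁₂ : ℕ} (R₁ : RelIndex src tgt e U₁ r₁) (R₂ : RelIndex src tgt e U₂ r₂)
  (R₁₂ : RelIndex src tgt e (U₁ ∩ U₂) r₁₂)

include R₁ R₁₂ in
theorem RelIndex.inter_le_left : r₁₂ ≤ r₁ :=
  R₁₂.le _ fun X Y hX hY hXU hYU f hf => R₁.vanish X Y hX hY (suppIn_inter.1 hXU).1
    (suppIn_inter.1 hYU).1 f (relPow_mono (fun _ h => (suppIn_inter.1 h).1) hf)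

include R₂ R₁₂ in
theorem RelIndex.inter_le_right : r₁₂ ≤ r₂ :=
  R₁₂.le _ fun X Y hX hY hXU hYU f hf => R₂.vanish X Y hX hY (suppIn_inter.1 hXU).2
    (suppIn_inter.1 hYU).2 f (relPow_mono (fun _ h => (suppIn_inter.1 h).2) hf)

include R₁ R₂ R₁₂ in
/-- A bound on the length of a non-zero composition passing through the intersection. -/
theorem RelIndex.comp_le [IsArtinianRing A] [Fintype V] (hsum : ∑ v, e v = 1) {a b : ℕ}
    {W Z T : ModuleCat.{0} A} (hW : Module.Finite A W) (hZ : Module.Finite A Z)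
    (hT : Module.Finite A T) (hWU : SuppIn e U₁ W) (hZU : SuppIn e (U₁ ∩ U₂) Z)
    (hTU : SuppIn e U₂ T) {u : W ⟶ Z} {v : Z ⟶ T} (hu : u ∈ relPow (SuppIn e U₁) a W Z)
    (hv : v ∈ relPow (SuppIn e U₂) b Z T) (huv : u ≫ v ≠ 0) : a + b + r₁₂ + 1 ≤ r₁ + r₂ := by
  obtain ⟨N, p, i, hN, hip, hne⟩ := exists_indec_factor {(0 : W ⟶ T)} rfl (by
    rintro _ rfl _ rfl
    exact add_zero _) Z hZ u v huv
  have hNU : SuppIn e (U₁ ∩ U₂) N := hZU.of_injective i (injective_of_retract hip)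
  obtain ⟨w, c, hwc⟩ : ∃ (w : W) (c : V), (i ≫ v).hom (e c • (u ≫ p).hom w) ≠ 0 := by
    by_contra hcon
    push Not at hcon
    refine hne (ModuleCat.hom_ext (LinearMap.ext fun w => ?_))
    have h1 : (u ≫ p).hom w = ∑ c, e c • (u ≫ p).hom w := by
      rw [← Finset.sum_smul, hsum, one_smul]
    change (i ≫ v).hom ((u ≫ p).hom w) = 0
    rw [h1, map_sum]
    exact Finset.sum_eq_zero fun c _ => hcon w c
  have hz : e c • (u ≫ p).hom w ≠ 0 := fun h => hwc (by rw [h, map_zero])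
  obtain ⟨P, I, p', q', a', b', w', hP, hI, hPU, hIU, hp', hq', hpa, hqb, hab⟩ :=
    R₁₂.through N c _ hN hNU hz
  have h1 : a + b' < r₁ := R₁.lt hW hI hWU (suppIn_inter.1 hIU).1
    (relPow_comp (relPow_comp_right hu p)
      (relPow_mono (fun _ h => (suppIn_inter.1 h).1) hqb)) (e c • w) (by
      change q'.hom ((u ≫ p).hom (e c • w)) ≠ 0
      rwa [map_smul])
  have h2 : a' + b < r₂ := R₂.lt hP hT (suppIn_inter.1 hPU).2 hTU
    (relPow_comp (relPow_mono (fun _ h => (suppIn_inter.1 h).2) hpa)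
      (relPow_comp_left i hv)) w' (by
      change (i ≫ v).hom (p'.hom w') ≠ 0
      rwa [hp'])
  omega

/-- The submodule generated by the components outside of `U`. -/
def outSub (e : V → A) (U : Set V) (X : Type) [AddCommGroup X] [Module A X] : Submodule A X :=
  Submodule.span A {y | ∃ v ∉ U, ∃ m : X, y = e v • m}

theorem suppIn_quotient (U : Set V) (X : ModuleCat.{0} A) :
    SuppIn e U (ModuleCat.of A (X ⧸ outSub e U X)) := by
  intro v hv y
  obtain ⟨m, rfl⟩ := Submodule.mkQ_surjective _ (show X ⧸ outSub e U X from y)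
  exact ((outSub e U X).mkQ.map_smul (e v) m).symm.trans
    ((Submodule.Quotient.mk_eq_zero _).2 (Submodule.subset_span ⟨v, hv, m, rfl⟩))

theorem exists_quotient_factor {U : Set V} {X T : ModuleCat.{0} A} (hT : SuppIn e U T)
    (g : X ⟶ T) : ∃ g' : ModuleCat.of A (X ⧸ outSub e U X) ⟶ T,
      ModuleCat.ofHom (outSub e U X).mkQ ≫ g' = g := by
  refine ⟨ModuleCat.ofHom ((outSub e U X).liftQ g.hom (Submodule.span_le.2 ?_)), ?_⟩
  · rintro _ ⟨v, hv, m, rfl⟩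
    change g.hom (e v • m) = 0
    rw [map_smul, hT v hv]
  · exact ModuleCat.hom_ext (LinearMap.ext fun y => rfl)

theorem mkQ_mem_radSet {U : Set V} {X : ModuleCat.{0} A}
    (hX : ∀ N : ModuleCat.{0} A, SuppIn e U N → ∀ f : N ⟶ X, f = 0) :
    ModuleCat.ofHom (outSub e U X).mkQ ∈ radSet A X (ModuleCat.of A (X ⧸ outSub e U X)) := by
  intro M hM h h' hi
  have hs : Function.Surjective h'.hom := by
    intro m
    refine ⟨(h ≫ ModuleCat.ofHom (outSub e U X).mkQ).hom
      ((inv (h ≫ ModuleCat.ofHom (outSub e U X).mkQ ≫ h')).hom m), ?_⟩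
    exact congrArg (fun g : M ⟶ M => g.hom m)
      (IsIso.inv_hom_id (h ≫ ModuleCat.ofHom (outSub e U X).mkQ ≫ h'))
  have h0 := hX M ((suppIn_quotient U X).of_surjective h' hs) h
  have h1 := IsIso.hom_inv_id (h ≫ ModuleCat.ofHom (outSub e U X).mkQ ≫ h')
  simp only [h0, Limits.zero_comp] at h1
  exact hM.2.id_ne_zero h1.symm

include hsplit R₁ R₂ R₁₂ in
theorem RelIndex.comp_eq_zero [IsArtinianRing A] [Fintype V] (hsum : ∑ v, e v = 1) {n j : ℕ}
    (hn : r₁ + r₂ ≤ j + n + r₁₂) {W X Y : ModuleCat.{0} A} (hW : Module.Finite A W)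
    (hX : Module.Finite A X) (hY : Module.Finite A Y) (hWU : SuppIn e U₁ W) (hXU : SuppIn e U₁ X)
    (hX0 : ∀ N : ModuleCat.{0} A, SuppIn e U₂ N → ∀ f : N ⟶ X, f = 0) {u : W ⟶ X} {f : X ⟶ Y}
    (hu : u ∈ relPow (SuppIn e U₁) j W X) (hf : f ∈ radPowSet A n X Y) : u ≫ f = 0 := by
  induction n generalizing j X with
  | zero =>
    have := R₂.inter_le_right R₁₂
    rw [R₁.vanish W X hW hX hWU hXU u (relPow_mono_right (by omega) hu), Limits.zero_comp]
  | succ n ih =>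
    obtain ⟨M, g, h, hM, hg, hh, rfl⟩ := hf
    obtain ⟨T, Q, i, p, l, q, hip, hlq, hpq, hT, hQ, hfac, hQ0⟩ := hsplit M hM
    obtain ⟨T', Q', i', p', l', q', hip', -, -, hT', -, hfac', -⟩ := hsplit Y hY
    have hQf : Module.Finite A Q := Module.Finite.of_surjective q.hom (surjective_of_retract hlq)
    have hTf' : Module.Finite A T' :=
      Module.Finite.of_surjective p'.hom (surjective_of_retract hip')
    have e1 : u ≫ g ≫ h = u ≫ (g ≫ p) ≫ i ≫ h + (u ≫ g ≫ q) ≫ l ≫ h := by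
      have : u ≫ g ≫ h = u ≫ g ≫ (p ≫ i + q ≫ l) ≫ h := by rw [hpq]; simp
      rw [this]; simp
    have h2 : (u ≫ g ≫ q) ≫ l ≫ h = 0 :=
      ih (j := j + 1) (by omega) hQf hQ hQ0
        (relPow_comp hu (mem_relPow_one hQf hQ (radSet_comp_right hg q)))
        (radPowSet_comp_left l hh)
    obtain ⟨g', hg'⟩ := exists_quotient_factor hT (g ≫ p)
    let π := ModuleCat.ofHom (outSub e U₂ X).mkQ
    have hZf : Module.Finite A (ModuleCat.of A (X ⧸ outSub e U₂ X)) :=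
      inferInstanceAs (Module.Finite A (X ⧸ outSub e U₂ X))
    have hZ1 : SuppIn e U₁ (ModuleCat.of A (X ⧸ outSub e U₂ X)) :=
      hXU.of_surjective π (Submodule.mkQ_surjective _)
    have hZ2 := suppIn_quotient (e := e) U₂ X
    have h3 : g' ≫ i ≫ h ∈ relPow (SuppIn e U₂) n _ Y :=
      relPow_of_suppIn hsplit (fun _ _ _ _ _ h => h) hZ2
        (relPow_of_radPowSet (radPowSet_comp_left g' (radPowSet_comp_left i hh)))
    have h4 : (u ≫ π) ≫ (g' ≫ i ≫ h) ≫ p' = 0 := by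
      by_contra hne
      have := R₁.comp_le R₂ R₁₂ hsum hW hZf hTf' hWU (suppIn_inter.2 ⟨hZ1, hZ2⟩) hT'
        (relPow_comp hu (mem_relPow_one hZf hZ1 (mkQ_mem_radSet hX0))) (relPow_comp_right h3 p') hne
      omega
    have h5 : u ≫ (g ≫ p) ≫ i ≫ h = 0 := by
      have h6 := hfac' _ hZ2 (g' ≫ i ≫ h)
      calc u ≫ (g ≫ p) ≫ i ≫ h = (u ≫ π) ≫ g' ≫ i ≫ h := by
            rw [← hg']; simp only [Category.assoc, π]
        _ = ((u ≫ π) ≫ (g' ≫ i ≫ h) ≫ p') ≫ i' := by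
            conv_lhs => rw [← h6]
            simp only [Category.assoc]
        _ = 0 := by rw [h4, Limits.zero_comp]
    rw [e1, h2, h5, add_zero]

include hsplit R₁ R₂ R₁₂ in
theorem RelIndex.radVanishes [IsArtinianRing A] [Fintype V] (hsum : ∑ v, e v = 1) :
    RadVanishes A (r₁ + r₂ - r₁₂) := by
  intro X Y hX hY f hf
  have l1 := R₁.inter_le_left R₁₂
  have l2 := R₂.inter_le_right R₁₂
  obtain ⟨T, Q, i, p, l, q, hip, hlq, hpq, hT, hQ, hfac, hQ0⟩ := hsplit X hX
  obtain ⟨T', Q', i', p', l', q', hip', -, -, hT', -, hfac', -⟩ := hsplit Y hY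
  have hQf : Module.Finite A Q := Module.Finite.of_surjective q.hom (surjective_of_retract hlq)
  have hTf : Module.Finite A T := Module.Finite.of_surjective p.hom (surjective_of_retract hip)
  have hTf' : Module.Finite A T' :=
    Module.Finite.of_surjective p'.hom (surjective_of_retract hip')
  have h1 : l ≫ f = 0 := by
    have := R₁.comp_eq_zero hsplit R₂ R₁₂ hsum (n := r₁ + r₂ - r₁₂) (j := 0) (by omega) hQf hQf hY
      hQ hQ hQ0 (u := 𝟙 Q) (f := l ≫ f) trivial (radPowSet_comp_left l hf)
    rwa [Category.id_comp] at this
  have h2 : i ≫ f = 0 := by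
    have h3 : i ≫ f ∈ relPow (SuppIn e U₂) (r₁ + r₂ - r₁₂) T Y :=
      relPow_of_suppIn hsplit (fun _ _ _ _ _ h => h) hT
        (relPow_of_radPowSet (radPowSet_comp_left i hf))
    have h4 := R₂.vanish T T' hTf hTf' hT hT' ((i ≫ f) ≫ p')
      (relPow_comp_right (relPow_mono_right (by omega) h3) p')
    rw [← hfac' T hT (i ≫ f), ← Category.assoc, h4, Limits.zero_comp]
  have h3 : f = p ≫ i ≫ f + q ≫ l ≫ f := by
    have : f = (p ≫ i + q ≫ l) ≫ f := by rw [hpq, Category.id_comp]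
    conv_lhs => rw [this]
    simp
  rw [h3, h1, h2]; simp

include hsplit R₁ R₂ R₁₂ in
theorem RelIndex.le_of_radVanishes {c : V} (hc : c ∈ U₁) (hc' : c ∈ U₂)
    (hmono : ∀ β, tgt β ∉ U₁ → src β ∉ U₁) {m : ℕ} (hm : RadVanishes A m) :
    r₁ + r₂ ≤ m + r₁₂ := by
  obtain ⟨Z, z, hZ, hZ2, hcz, hz, hpath, hproj, hend⟩ := R₂.proj c hc'
  have hstay : ∀ {v : V}, QPath src tgt c v → v ∈ U₁ := by
    intro v p
    induction p with
    | nil => exact hc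
    | cons p α h ih =>
      subst h
      by_contra hv
      exact hmono α hv ih
  have hZ1 : SuppIn e U₁ Z := fun v hv y => by
    by_contra h
    obtain ⟨p⟩ := hpath v y h
    exact hv (hstay p)
  have hcz0 : e c • z ≠ 0 := by rwa [hcz]
  obtain ⟨P, I, p, q, a, b, w, hP, hI, hPU, hIU, hp, hq, hpa, hqb, hab⟩ :=
    R₁.through Z c z hZ hZ1 hcz0
  obtain ⟨P₂, I₂, p₂, q₂, a₂, b₂, w₂, hP₂, hI₂, hP₂U, -, hp₂, hq₂, hpa₂, hqb₂, hab₂⟩ :=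
    R₂.through Z c z hZ hZ2 hcz0
  rw [hcz] at hp hq hp₂ hq₂
  have hb : b < r₁₂ := by
    obtain ⟨T, Q, i, t, -, -, hit, -, -, hT, -, hfac, -⟩ := hsplit I hI
    have h1 : q ∈ relPow (SuppIn e (U₁ ∩ U₂)) b Z I :=
      relPow_of_suppIn hsplit
        (fun M N i hi hM hN => suppIn_inter.2 ⟨hM.of_injective i hi, hN⟩) hZ2 hqb
    refine R₁₂.lt hZ.1 (Module.Finite.of_surjective t.hom (surjective_of_retract hit))
      (suppIn_inter.2 ⟨hZ1, hZ2⟩)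
      (suppIn_inter.2 ⟨hIU.of_injective i (injective_of_retract hit), hT⟩)
      (relPow_comp_right h1 t) z fun h0 => hq ?_
    have h2 : i.hom ((q ≫ t).hom z) = q.hom z :=
      congrArg (fun g : Z ⟶ I => g.hom z) (hfac Z hZ2 q)
    rw [← h2, h0, map_zero]
  have ha₂ : a₂ = 0 := by
    rcases a₂ with _ | a₂
    · rfl
    · obtain ⟨M, g, h, -, -, hg, -, rfl⟩ := hpa₂
      obtain ⟨s, hs⟩ := hproj P₂ hP₂U w₂
      refine absurd (hend (s ≫ g ≫ h) ?_)
        (not_splitEpi_of_mem_radSet hZ (radSet_comp_right hg h) s)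
      change (g ≫ h).hom (s.hom z) = z
      rw [hs, map_smul, hp₂, hcz]
  have hne : (p ≫ q₂).hom w ≠ 0 := by
    change q₂.hom (p.hom w) ≠ 0
    rwa [hp]
  have hlt : a + b₂ < m := by
    by_contra h
    refine hne ?_
    rw [hm P I₂ hP hI₂ (p ≫ q₂) (radPowSet_mono (not_lt.1 h)
      (radPowSet_comp (radPowSet_of_relPow hpa) (radPowSet_of_relPow hqb₂)))]
    rfl
  omega

end Glue

section Presentation

variable {k A V E : Type} [Field k] [Ring A] [Algebra k A] [Fintype V] [Fintype E]
  (P : QuiverPresentation k A V E)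

theorem QuiverPresentation.isQuiverSystem : IsQuiverSystem P.src P.tgt P.idem P.arrow where
  idem := P.idem_idem
  orth := P.idem_orth
  sum := P.sum_idem
  left := fun α => by
    conv_lhs => rw [← P.arrow_mem α]
    rw [← mul_assoc, ← mul_assoc, P.idem_idem, P.arrow_mem]
  right := fun α => by
    conv_lhs => rw [← P.arrow_mem α]
    rw [mul_assoc, P.idem_idem, P.arrow_mem]

theorem QuiverPresentation.pprod_eq_qprod {a b : V} (p : QPath P.src P.tgt a b) :
    pprod P.idem P.arrow p = P.qprod p := by
  induction p with
  | nil => rw [pprod_nil, QuiverPresentation.qprod]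
  | cons p α h ih => rw [pprod_cons, QuiverPresentation.qprod, ih]

omit [Fintype V] [Fintype E] in
theorem QPath.arrows_comp {src tgt : E → V} {a b c : V} (p : QPath src tgt a b)
    (q : QPath src tgt b c) : (p.comp q).arrows = p.arrows ++ q.arrows := by
  induction q with
  | nil => simp [QPath.arrows, QPath.comp]
  | cons q α h ih => simp [QPath.arrows, QPath.comp, ih]

theorem QuiverPresentation.two_le_length {a b : V} (p : QPath P.src P.tgt a b)
    (hp : P.qprod p = 0) : 2 ≤ p.length := by
  rcases p with _ | ⟨_ | ⟨p, α, h⟩, β, h'⟩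
  · rw [QuiverPresentation.qprod] at hp
    exact absurd hp (P.idem_ne _)
  · subst h'
    rw [QuiverPresentation.qprod, QuiverPresentation.qprod, P.isQuiverSystem.right] at hp
    exact absurd hp (P.arrow_ne _)
  · rw [QPath.length, QPath.length]
    omega

theorem QuiverPresentation.subset_arrows {l : List E}
    (huniq : ∀ (x y : V) (q : QPath P.src P.tgt x y), P.IsZeroRel q → q.arrows = l)
    {a b : V} (p : QPath P.src P.tgt a b) (hp : P.qprod p = 0) {β : E} (hβ : β ∈ l) :
    β ∈ p.arrows := by
  induction hn : p.length using Nat.strong_induction_on generalizing a b with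
  | _ n ih =>
    by_cases hz : P.IsZeroRel p
    · rwa [huniq _ _ p hz]
    · have : ∃ (x y : V) (q : QPath P.src P.tgt x y) (p₁ : QPath P.src P.tgt a x)
          (p₂ : QPath P.src P.tgt y b), p = p₁.comp (q.comp p₂) ∧ q.length < p.length ∧
          P.qprod q = 0 := by
        by_contra hc
        push Not at hc
        exact hz ⟨hp, P.two_le_length p hp, hc⟩
      obtain ⟨x, y, q, p₁, p₂, hpq, hlt, hq⟩ := this
      have := ih q.length (by omega) q hq rfl
      rw [hpq, QPath.arrows_comp, QPath.arrows_comp]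
      simp [this]

theorem QuiverPresentation.wprod_ofFn {n : ℕ} (alf : Fin (n + 1) → E) (γ : ℕ → E)
    (h : ∀ i : Fin (n + 1), γ i = alf i) :
    P.wprod (List.ofFn alf) = chainProd P.arrow γ n := by
  induction n with
  | zero =>
    simp [QuiverPresentation.wprod, chainProd, ← h 0]
  | succ n ih =>
    have h1 := ih (fun i => alf i.castSucc) (fun i => h i.castSucc)
    rw [QuiverPresentation.wprod] at h1 ⊢
    rw [List.ofFn_succ', List.concat_eq_append, List.map_append, List.reverse_append,
      List.prod_append, h1, chainProd, ← h (Fin.last (n + 1))]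
    simp

open scoped ModuleCat in
theorem ChainShape.hasSplit (htree : HasPotentials P.src P.tgt) {n : ℕ} {γ : ℕ → E}
    {U₁ U₂ : Set V} (C : ChainShape P.src P.tgt n γ U₁ U₂) (hzero : chainProd P.arrow γ n = 0)
    (M : ModuleCat.{0} A) : HasSplit P.idem U₁ U₂ M := by
  let _ : Module k M := Module.compHom M (algebraMap k A)
  have : IsScalarTower k A M := ⟨fun r a y => by
    rw [Algebra.smul_def, mul_smul]
    rfl⟩
  obtain ⟨N, hN, hN'⟩ := C.exists_isCompl (k := k) P.isQuiverSystem htree P.generates hzero M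
  exact hasSplit_of_isCompl M hN hN'

theorem QuiverPresentation.relIndex_component (htree : P.IsTreeQuiver) (hrf : RepFinite A)
    {B V' E' : Type} [Ring B] [Algebra k B] [FiniteDimensional k B] [Fintype V'] [Fintype E']
    (P' : QuiverPresentation k B V' E') (hher : Hereditary B) {U : Set V} {X : Set E}
    (eV : V' ≃ U) (eE : E' ≃ X)
    (hc : ∀ β : E', P.src (eE β : E) = (eV (P'.src β) : V) ∧
      P.tgt (eE β : E) = (eV (P'.tgt β) : V))
    (hX : ∀ β, P.src β ∈ U → P.tgt β ∈ U → β ∈ X)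
    (hzero : ∀ (a b : V) (p : QPath P.src P.tgt a b), P.qprod p = 0 → ∃ β ∈ p.arrows, β ∉ X)
    (ρ : V → V) (hρU : ∀ v, ρ v ∈ U) (hρ : ∀ v ∈ U, ρ v = v)
    (hρE : ∀ β, ρ (P.src β) = ρ (P.tgt β) ∨ P.src β ∈ U ∧ P.tgt β ∈ U)
    {r : ℕ} (hr : NilpotencyIndex B r) :
    RelIndex P.src P.tgt P.idem U r := by
  have hconn := htree.1.connFun P
  have hpot := hconn.hasPotentials htree.2
  have hV : Set.range (fun v => (eV v : V)) = U := by
    ext v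
    exact ⟨by rintro ⟨v, rfl⟩; exact (eV v).2, fun hv => ⟨eV.symm ⟨v, hv⟩, by simp⟩⟩
  have hE : Set.range (fun v => (eE v : E)) = X := by
    ext v
    exact ⟨by rintro ⟨v, rfl⟩; exact (eE v).2, fun hv => ⟨eE.symm ⟨v, hv⟩, by simp⟩⟩
  have hiE : Function.Injective (fun v => (eE v : E)) := Subtype.val_injective.comp eE.injective
  have hs : ∀ β, P.src (eE β : E) = (eV (P'.src β) : V) := fun β => (hc β).1
  have ht : ∀ β, P.tgt (eE β : E) = (eV (P'.tgt β) : V) := fun β => (hc β).2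
  have S' : IsHerSystem k P'.src P'.tgt P'.idem P'.arrow :=
    { toIsQuiverSystem := P'.isQuiverSystem
      tree := hpot.of_injective (iV := fun v => (eV v : V)) hiE hs ht
      gen := P'.generates
      idem_ne := P'.idem_ne
      arrow_ne := P'.arrow_ne
      her := hher }
  have hconn' : ConnFun P'.src P'.tgt :=
    hconn.of_retract (iV := fun v => (eV v : V)) hs ht (fun v => eV.symm ⟨ρ v, hρU v⟩)
      (fun v => by
        have : (⟨ρ (eV v : V), hρU _⟩ : U) = eV v := Subtype.ext (hρ _ (eV v).2)
        rw [this, Equiv.symm_apply_apply])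
      (fun β => by
        rcases hρE β with h | h
        · left
          congr 2
        · right
          rw [hE]
          exact hX β h.1 h.2)
  rw [← hV]
  have hiV : Function.Injective (fun v => (eV v : V)) := Subtype.val_injective.comp eV.injective
  refine IsHerSystem.relIndex P.isQuiverSystem hpot P.generates S' hiV hiE hs ht ?_ ?_ hconn' hrf hr
  · rw [hV, hE]
    exact hX
  · intro a b p hp
    rw [hE]
    exact hzero a b p (by rw [← P.pprod_eq_qprod, hp])

end Presentation

section Chain

variable {V E : Type} {src tgt : E → V} {n : ℕ} {γ : ℕ → E} {U₁ U₂ : Set V}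

theorem ChainShape.mem (C : ChainShape src tgt n γ U₁ U₂) {i : ℕ} (hi : i < n) :
    src (γ (i + 1)) ∈ U₁ ∧ src (γ (i + 1)) ∈ U₂ :=
  (C.mem_iff _).2 ⟨i, hi, rfl⟩

theorem ChainShape.tgt_first (C : ChainShape src tgt n γ U₁ U₂) :
    tgt (γ 0) = src (γ 1) :=
  (C.chain 0 C.pos).symm

theorem ChainShape.mem_one (C : ChainShape src tgt n γ U₁ U₂) :
    src (γ 1) ∈ U₁ ∧ src (γ 1) ∈ U₂ :=
  C.mem C.pos

theorem ChainShape.mem_end (C : ChainShape src tgt n γ U₁ U₂) :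
    src (γ n) ∈ U₁ ∧ src (γ n) ∈ U₂ := by
  have := C.mem (i := n - 1) (by have := C.pos; omega)
  rwa [Nat.sub_add_cancel C.pos] at this

/-- The retraction of the vertices onto the first component. -/
theorem ChainShape.exists_retract_left (C : ChainShape src tgt n γ U₁ U₂) :
    ∃ ρ : V → V, (∀ v, ρ v ∈ U₁) ∧ (∀ v ∈ U₁, ρ v = v) ∧
      ∀ β, ρ (src β) = ρ (tgt β) ∨ src β ∈ U₁ ∧ tgt β ∈ U₁ := by
  refine ⟨fun v => if v ∈ U₁ then v else src (γ 1), fun v => ?_, fun v hv => if_pos hv,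
    fun β => ?_⟩
  · dsimp only
    split_ifs with h
    exacts [h, C.mem_one.1]
  · dsimp only
    by_cases hs : src β ∈ U₁
    · exact Or.inr ⟨hs, by_contra fun ht => C.mono₁ β ht hs⟩
    · left
      by_cases ht : tgt β ∈ U₁
      · rw [if_neg hs, if_pos ht, C.cross₁ β hs ht, C.tgt_first]
      · rw [if_neg hs, if_neg ht]

/-- The retraction of the vertices onto the second component. -/
theorem ChainShape.exists_retract_right (C : ChainShape src tgt n γ U₁ U₂) :
    ∃ ρ : V → V, (∀ v, ρ v ∈ U₂) ∧ (∀ v ∈ U₂, ρ v = v) ∧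
      ∀ β, ρ (src β) = ρ (tgt β) ∨ src β ∈ U₂ ∧ tgt β ∈ U₂ := by
  refine ⟨fun v => if v ∈ U₂ then v else src (γ n), fun v => ?_, fun v hv => if_pos hv,
    fun β => ?_⟩
  · dsimp only
    split_ifs with h
    exacts [h, C.mem_end.2]
  · dsimp only
    by_cases hs : src β ∈ U₂
    · by_cases ht : tgt β ∈ U₂
      · exact Or.inr ⟨hs, ht⟩
      · left
        rw [if_pos hs, if_neg ht, C.cross₂ β hs ht]
    · rw [if_neg hs, if_neg (C.mono₂ β hs)]
      exact Or.inl rfl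

/-- The retraction of the vertices onto the chain of interior vertices. -/
theorem ChainShape.exists_retract_inter (C : ChainShape src tgt n γ U₁ U₂) :
    ∃ ρ : V → V, (∀ v, ρ v ∈ U₁ ∩ U₂) ∧ (∀ v ∈ U₁ ∩ U₂, ρ v = v) ∧
      ∀ β, ρ (src β) = ρ (tgt β) ∨ src β ∈ U₁ ∩ U₂ ∧ tgt β ∈ U₁ ∩ U₂ := by
  refine ⟨fun v => if v ∈ U₁ then if v ∈ U₂ then v else src (γ n) else src (γ 1),
    fun v => ?_, fun v hv => by simp [hv.1, hv.2], fun β => ?_⟩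
  · dsimp only
    split_ifs with h h'
    exacts [⟨h, h'⟩, C.mem_end, C.mem_one]
  · dsimp only
    by_cases hs : src β ∈ U₁
    · have ht : tgt β ∈ U₁ := by_contra fun ht => C.mono₁ β ht hs
      rw [if_pos hs, if_pos ht]
      by_cases hs' : src β ∈ U₂
      · by_cases ht' : tgt β ∈ U₂
        · exact Or.inr ⟨⟨hs, hs'⟩, ht, ht'⟩
        · left
          rw [if_pos hs', if_neg ht', C.cross₂ β hs' ht']
      · rw [if_neg hs', if_neg (C.mono₂ β hs')]
        exact Or.inl rfl
    · left
      by_cases ht : tgt β ∈ U₁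
      · have h0 := C.cross₁ β hs ht
        have ht' : tgt β = src (γ 1) := by rw [h0, C.tgt_first]
        rw [if_neg hs, if_pos ht, ht', if_pos C.mem_one.2]
      · rw [if_neg hs, if_neg ht]

end Chain

section Final

variable {k A V E : Type} [Field k] [Ring A] [Algebra k A] [FiniteDimensional k A]
  [Fintype V] [Fintype E] (P : QuiverPresentation k A V E)

theorem QuiverPresentation.nilpotencyIndex_add {n : ℕ} {γ : ℕ → E} {U₁ U₂ : Set V}
    (htree : P.IsTreeQuiver) (C : ChainShape P.src P.tgt n γ U₁ U₂)
    (hzero : chainProd P.arrow γ n = 0) {r₁ r₂ r₁₂ r : ℕ}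
    (R₁ : RelIndex P.src P.tgt P.idem U₁ r₁) (R₂ : RelIndex P.src P.tgt P.idem U₂ r₂)
    (R₁₂ : RelIndex P.src P.tgt P.idem (U₁ ∩ U₂) r₁₂) (hr : NilpotencyIndex A r) :
    r + r₁₂ = r₁ + r₂ := by
  have : IsArtinianRing A := IsArtinianRing.of_finite k A
  have hpot := (htree.1.connFun P).hasPotentials htree.2
  have hsplit : ∀ M : ModuleCat.{0} A, Module.Finite A M → HasSplit P.idem U₁ U₂ M :=
    fun M _ => C.hasSplit P hpot hzero M
  have h₁ := hr.2.2 _ (RelIndex.radVanishes hsplit R₁ R₂ R₁₂ P.sum_idem)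
  have h₂ := RelIndex.le_of_radVanishes hsplit R₁ R₂ R₁₂ C.mem_one.1 C.mem_one.2 C.mono₁ hr.2.1
  have h₃ := RelIndex.inter_le_left R₁ R₁₂
  omega

end Final

/-- Theorem: let `A = kQ_A/I_A` where `Q_A` is a linear chain `1 → 2 → ⋯ → m+1` carrying
the single zero-relation `α_m ⋯ α_1`, possibly with arbitrary quivers attached at the two
end vertices, and let `A_1`, `A_2`, `A_1 ∩ A_2` be the hereditary algebras on the
components obtained by deleting `α_1` (containing `α_m`), deleting `α_m` (containing
`α_1`), and their intersection.  Then `r_A = r_(A_1) + r_(A_2) - r_(A_1 ∩ A_2)`. -/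
theorem nilpotency_index_pullback_formula_chain (k A : Type) [Field k] [IsAlgClosed k] [Ring A] [Algebra k A]
    [FiniteDimensional k A] (V E : Type) [Fintype V] [Fintype E]
    (P : QuiverPresentation k A V E) (hadm : P.Admissible) (hmin : P.Minimal)
    (m : ℕ) (hm : 2 ≤ m) (alf : Fin m → E)
    (hchain : ∀ (i : ℕ) (h : i + 1 < m), P.src (alf ⟨i + 1, h⟩) = P.tgt (alf ⟨i, by omega⟩))
    (hzero : P.wprod (List.ofFn alf) = 0)
    (hminrel : ∀ l₁ l₂ l₃ : List E, List.ofFn alf = l₁ ++ l₂ ++ l₃ → l₂.length < m →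
      P.wprod l₂ ≠ 0)
    (huniq : ∀ (x y : V) (q : QPath P.src P.tgt x y), P.IsZeroRel q →
      q.arrows = List.ofFn alf)
    (hmono : P.Monomial) (htree : P.IsTreeQuiver) (hrf : RepFinite A)
    (hattach : ∀ β : E, (¬ ∃ i, alf i = β) → ∀ (j : ℕ) (_h1 : 1 ≤ j) (_h2 : j < m),
      P.src β ≠ P.src (alf ⟨j, by omega⟩) ∧ P.tgt β ≠ P.src (alf ⟨j, by omega⟩))
    (B1 : Type) [Ring B1] [Algebra k B1] [FiniteDimensional k B1]
    (V1 E1 : Type) [Fintype V1] [Fintype E1] (P1 : QuiverPresentation k B1 V1 E1)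
    (hadm1 : P1.Admissible) (hmin1 : P1.Minimal) (hher1 : Hereditary B1)
    (eV1 : V1 ≃ compSet P (alf ⟨0, by omega⟩) (P.tgt (alf ⟨m - 1, by omega⟩)))
    (eE1 : E1 ≃ compArr P (alf ⟨0, by omega⟩) (P.tgt (alf ⟨m - 1, by omega⟩)))
    (hc1 : ∀ e : E1, P.src ((eE1 e : E)) = ((eV1 (P1.src e) : V)) ∧
      P.tgt ((eE1 e : E)) = ((eV1 (P1.tgt e) : V)))
    (B2 : Type) [Ring B2] [Algebra k B2] [FiniteDimensional k B2]
    (V2 E2 : Type) [Fintype V2] [Fintype E2] (P2 : QuiverPresentation k B2 V2 E2)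
    (hadm2 : P2.Admissible) (hmin2 : P2.Minimal) (hher2 : Hereditary B2)
    (eV2 : V2 ≃ compSet P (alf ⟨m - 1, by omega⟩) (P.src (alf ⟨0, by omega⟩)))
    (eE2 : E2 ≃ compArr P (alf ⟨m - 1, by omega⟩) (P.src (alf ⟨0, by omega⟩)))
    (hc2 : ∀ e : E2, P.src ((eE2 e : E)) = ((eV2 (P2.src e) : V)) ∧
      P.tgt ((eE2 e : E)) = ((eV2 (P2.tgt e) : V)))
    (B12 : Type) [Ring B12] [Algebra k B12] [FiniteDimensional k B12]
    (V12 E12 : Type) [Fintype V12] [Fintype E12] (P12 : QuiverPresentation k B12 V12 E12)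
    (hadm12 : P12.Admissible) (hmin12 : P12.Minimal) (hher12 : Hereditary B12)
    (eV12 : V12 ≃ ((compSet P (alf ⟨0, by omega⟩) (P.tgt (alf ⟨m - 1, by omega⟩)) ∩
      compSet P (alf ⟨m - 1, by omega⟩) (P.src (alf ⟨0, by omega⟩)) : Set V)))
    (eE12 : E12 ≃ ((compArr P (alf ⟨0, by omega⟩) (P.tgt (alf ⟨m - 1, by omega⟩)) ∩
      compArr P (alf ⟨m - 1, by omega⟩) (P.src (alf ⟨0, by omega⟩)) : Set E)))
    (hc12 : ∀ e : E12, P.src ((eE12 e : E)) = ((eV12 (P12.src e) : V)) ∧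
      P.tgt ((eE12 e : E)) = ((eV12 (P12.tgt e) : V))) :
    ∀ mA m1 m2 m12 : ℕ, NilpotencyIndex A mA → NilpotencyIndex B1 m1 →
      NilpotencyIndex B2 m2 → NilpotencyIndex B12 m12 → mA + m12 = m1 + m2 := by
  intro mA m1 m2 m12 hA h1 h2 h12
  obtain ⟨n, rfl⟩ : ∃ n, m = n + 1 := ⟨m - 1, by omega⟩
  have hn : 1 ≤ n := by omega
  let γ : ℕ → E := fun i => if h : i < n + 1 then alf ⟨i, h⟩ else alf ⟨0, by omega⟩
  have hγ : ∀ i (h : i < n + 1), γ i = alf ⟨i, h⟩ := fun i h => dif_pos h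
  have h0 : alf ⟨0, by omega⟩ = γ 0 := (hγ 0 (by omega)).symm
  have hlast : alf ⟨n + 1 - 1, by omega⟩ = γ n := (hγ n (by omega)).symm
  have hprod : chainProd P.arrow γ n = 0 := by
    rw [← P.wprod_ofFn alf γ fun i => hγ i i.2, hzero]
  have hmem : ∀ i ≤ n, ∀ (a b : V) (p : QPath P.src P.tgt a b), P.qprod p = 0 →
      γ i ∈ p.arrows := fun i hi a b p hp =>
    P.subset_arrows huniq p hp (by
      rw [hγ i (by omega)]
      exact List.mem_ofFn.2 ⟨_, rfl⟩)
  have C : ChainShape P.src P.tgt n γ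
      (compSet P (alf ⟨0, by omega⟩) (P.tgt (alf ⟨n + 1 - 1, by omega⟩)))
      (compSet P (alf ⟨n + 1 - 1, by omega⟩) (P.src (alf ⟨0, by omega⟩))) := by
    rw [h0, hlast]
    refine P.chainShape htree hn (fun i hi => ?_) (fun β hβ j hj => ?_)
    · rw [hγ i (by omega), hγ (i + 1) (by omega)]
      exact hchain i (by omega)
    · rw [hγ (j + 1) (by omega)]
      refine hattach β ?_ (j + 1) (by omega) (by omega)
      rintro ⟨i, hi⟩
      exact hβ ⟨i, by omega, by rw [← hi]; exact hγ i i.2⟩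
  have hX₁ : ∀ β, P.src β ∈ compSet P (alf ⟨0, by omega⟩) (P.tgt (alf ⟨n + 1 - 1, by omega⟩)) →
      P.tgt β ∈ compSet P (alf ⟨0, by omega⟩) (P.tgt (alf ⟨n + 1 - 1, by omega⟩)) →
      β ∈ compArr P (alf ⟨0, by omega⟩) (P.tgt (alf ⟨n + 1 - 1, by omega⟩)) :=
    fun β hs ht => ⟨fun h => C.first (congrArg P.src (h.trans h0) ▸ hs), hs, ht⟩
  have hX₂ : ∀ β, P.src β ∈ compSet P (alf ⟨n + 1 - 1, by omega⟩) (P.src (alf ⟨0, by omega⟩)) →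
      P.tgt β ∈ compSet P (alf ⟨n + 1 - 1, by omega⟩) (P.src (alf ⟨0, by omega⟩)) →
      β ∈ compArr P (alf ⟨n + 1 - 1, by omega⟩) (P.src (alf ⟨0, by omega⟩)) :=
    fun β hs ht => ⟨fun h => C.last (congrArg P.tgt (h.trans hlast) ▸ ht), hs, ht⟩
  obtain ⟨ρ₁, hU₁, hid₁, hE₁⟩ := C.exists_retract_left
  obtain ⟨ρ₂, hU₂, hid₂, hE₂⟩ := C.exists_retract_right
  obtain ⟨ρ, hU, hid, hE⟩ := C.exists_retract_inter
  exact P.nilpotencyIndex_add htree C hprod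
    (P.relIndex_component htree hrf P1 hher1 eV1 eE1 hc1 hX₁
      (fun a b p hp => ⟨γ 0, hmem 0 (by omega) a b p hp, fun h => h.1 h0.symm⟩)
      ρ₁ hU₁ hid₁ hE₁ h1)
    (P.relIndex_component htree hrf P2 hher2 eV2 eE2 hc2 hX₂
      (fun a b p hp => ⟨γ n, hmem n le_rfl a b p hp, fun h => h.1 hlast.symm⟩)
      ρ₂ hU₂ hid₂ hE₂ h2)
    (P.relIndex_component htree hrf P12 hher12 eV12 eE12 hc12
      (fun β hs ht => ⟨hX₁ β hs.1 ht.1, hX₂ β hs.2 ht.2⟩)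
      (fun a b p hp => ⟨γ 0, hmem 0 (by omega) a b p hp, fun h => h.1.1 h0.symm⟩)
      ρ hU hid hE h12)
    hA
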